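/- For every integer n ≥ 0 and every real a ≥ 0, the set of λ ∈ ℝ with (a,λ) ∈ Γ_n has exactly two elements; in other words, the projection (a,λ) ↦ a from Γ_n ∩ {(a,λ) : a ≥ 0} to [0,∞) is a 2-to-1 covering. -/

import Mathlib

open Complex Filter

/-- `y` is an eigenfunction of the PT-symmetric cubic oscillator with
parameter `a` and eigenvalue `λ`. -/
def IsCubicEigenfunction (a lam : ℂ) (y : ℂ → ℂ) : Prop :=
  Differentiable ℂ y ∧ y ≠ 0 ∧
  (∀ z : ℂ, -(deriv (deriv y) z) + (z ^ 3 - a * z) * y z = -lam * y z) ∧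
  Tendsto (fun t : ℝ => y (Complex.I * t)) atTop (nhds 0) ∧
  Tendsto (fun t : ℝ => y (Complex.I * t)) atBot (nhds 0)

/-- The real spectral locus of the PT-symmetric cubic oscillator. -/
def cubicRealLocus : Set (ℝ × ℝ) :=
  {q : ℝ × ℝ | ∃ y : ℂ → ℂ, IsCubicEigenfunction (q.1 : ℂ) (q.2 : ℂ) y}

/-- The set of nonreal zeros of `y`. -/
def nonrealZeros (y : ℂ → ℂ) : Set ℂ := {z : ℂ | y z = 0 ∧ z.im ≠ 0}

/-- `Γ_n`: the points of the real spectral locus admitting an eigenfunction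
with exactly `2n` nonreal zeros. -/
def cubicGamma (n : ℕ) : Set (ℝ × ℝ) :=
  {q : ℝ × ℝ | ∃ y : ℂ → ℂ, IsCubicEigenfunction (q.1 : ℂ) (q.2 : ℂ) y ∧
    (nonrealZeros y).Finite ∧ (nonrealZeros y).ncard = 2 * n}

namespace CubicPT
open Topology Set

/-- sequences with super-geometric decay -/
def Fast (b : ℕ → ℂ) : Prop := ∀ R : ℝ, 0 < R → ∃ M : ℝ, ∀ n, ‖b n‖ * R ^ n ≤ M

/-- the derivative coefficients -/
def dco (b : ℕ → ℂ) (n : ℕ) : ℂ := (n + 1 : ℂ) * b (n + 1)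

lemma dco_bound {b : ℕ → ℂ} {R M : ℝ} (hR : 0 < R) (h : ∀ n, ‖b n‖ * (2 * R) ^ n ≤ M) (n : ℕ) :
    ‖dco b n‖ * R ^ n ≤ M / R := by
  have h1 := h (n + 1)
  have h2 : ((n : ℝ) + 1) ≤ 2 ^ (n + 1) := by
    have := (Nat.lt_two_pow_self (n := n + 1)).le
    exact_mod_cast this
  rw [le_div_iff₀ hR, dco, norm_mul]
  have h3 : ‖(n + 1 : ℂ)‖ = (n : ℝ) + 1 := by
    have := Complex.norm_natCast (n + 1)
    push_cast at this
    exact this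
  rw [h3]
  calc ((n : ℝ) + 1) * ‖b (n + 1)‖ * R ^ n * R = ((n : ℝ) + 1) * (‖b (n + 1)‖ * R ^ (n + 1)) := by ring
    _ ≤ 2 ^ (n + 1) * (‖b (n + 1)‖ * R ^ (n + 1)) := by gcongr
    _ = ‖b (n + 1)‖ * (2 * R) ^ (n + 1) := by rw [mul_pow]; ring
    _ ≤ M := h1

lemma Fast.dco {b : ℕ → ℂ} (h : Fast b) : Fast (dco b) := by
  intro R hR
  obtain ⟨M, hM⟩ := h (2 * R) (by positivity)
  exact ⟨M / R, dco_bound hR hM⟩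

lemma term_bound {b : ℕ → ℂ} {R M : ℝ} (hR : 0 < R) (h : ∀ n, ‖b n‖ * (2 * R) ^ n ≤ M)
    {z : ℂ} (hz : ‖z‖ ≤ R) (n : ℕ) : ‖b n * z ^ n‖ ≤ M * (1 / 2) ^ n := by
  rw [norm_mul, norm_pow]
  calc ‖b n‖ * ‖z‖ ^ n ≤ ‖b n‖ * R ^ n := by gcongr
    _ = (‖b n‖ * (2 * R) ^ n) * (1 / 2) ^ n := by
        rw [mul_pow, one_div, inv_pow]; field_simp
    _ ≤ M * (1 / 2) ^ n := by gcongr; exact h n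

lemma summable_half (M : ℝ) : Summable (fun n : ℕ => M * (1 / 2 : ℝ) ^ n) :=
  (summable_geometric_of_lt_one (by norm_num) (by norm_num)).mul_left M

lemma Fast.summable {b : ℕ → ℂ} (h : Fast b) (z : ℂ) : Summable (fun n => b n * z ^ n) := by
  have hR : 0 < ‖z‖ + 1 := by positivity
  obtain ⟨M, hM⟩ := h (2 * (‖z‖ + 1)) (by positivity)
  exact Summable.of_norm_bounded (summable_half M) (fun n => term_bound hR hM (by linarith) n)

/-- sum of the power series -/
noncomputable def ps (b : ℕ → ℂ) (z : ℂ) : ℂ := ∑' n, b n * z ^ n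

lemma Fast.hasSum {b : ℕ → ℂ} (h : Fast b) (z : ℂ) : HasSum (fun n => b n * z ^ n) (ps b z) :=
  (h.summable z).hasSum

lemma ps_zero (b : ℕ → ℂ) : ps b 0 = b 0 := by
  unfold ps
  rw [tsum_eq_single 0]
  · simp
  · intro n hn; simp [hn]

lemma Fast.hasDerivAt {b : ℕ → ℂ} (h : Fast b) (z : ℂ) :
    HasDerivAt (ps b) (ps (CubicPT.dco b) z) z := by
  have hR : 0 < ‖z‖ + 1 := by positivity
  obtain ⟨M, hM⟩ := h.dco (2 * (‖z‖ + 1)) (by positivity)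
  have hu : Summable (fun n : ℕ => if n = 0 then (0 : ℝ) else M * (1 / 2) ^ (n - 1)) := by
    rw [← summable_nat_add_iff 1]
    simpa using summable_half M
  have key := hasDerivAt_tsum_of_isPreconnected (𝕜 := ℂ) (F := ℂ) (g := fun n z => b n * z ^ n)
    (g' := fun n z => b n * (n * z ^ (n - 1))) (t := Metric.ball (0 : ℂ) (‖z‖ + 1)) (y₀ := 0) (y := z)
    hu Metric.isOpen_ball (convex_ball _ _).isPreconnected ?_ ?_ ?_ (h.summable 0) ?_
  · have e : (∑' n : ℕ, b n * (n * z ^ (n - 1))) = ps (CubicPT.dco b) z := by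
      unfold ps
      have hs : Summable (fun n : ℕ => b n * ((n : ℂ) * z ^ (n - 1))) := by
        rw [← summable_nat_add_iff 1]
        refine (h.dco.summable z).congr (fun n => ?_)
        simp only [CubicPT.dco, Nat.add_sub_cancel, Nat.cast_add, Nat.cast_one]; ring
      rw [hs.tsum_eq_zero_add]
      simp only [CubicPT.dco, Nat.cast_zero, zero_mul, mul_zero, zero_add, Nat.add_sub_cancel, Nat.cast_add, Nat.cast_one]
      congr 1; ext n; ring
    rw [← e]; exact key
  · intro n w _
    exact (hasDerivAt_pow n w).const_mul _
  · intro n w hw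
    rcases n with _ | n
    · simp
    · have hw' : ‖w‖ ≤ ‖z‖ + 1 := by simpa using (Metric.mem_ball.1 hw).le
      have := term_bound hR hM hw' n
      simp only [CubicPT.dco] at this
      simp only [Nat.add_sub_cancel, Nat.cast_add, Nat.cast_one]
      simp only [Nat.succ_ne_zero, if_false]
      convert this using 1
      congr 1
      ring
  · simpa using hR
  · simp

/-- coefficients of the solution with Cauchy data `(A,B)` at `0` -/
noncomputable def cf (a l A B : ℂ) : ℕ → ℂ
  | 0 => A
  | 1 => B
  | 2 => l * A / 2
  | 3 => (l * B - a * A) / 6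
  | 4 => (l * (l * A / 2) - a * B) / 12
  | n + 5 => (cf a l A B n - a * cf a l A B (n + 2) + l * cf a l A B (n + 3)) / ((n + 5) * (n + 4))

lemma norm_den (n : ℕ) : ‖((n : ℂ) + 5) * (n + 4)‖ = ((n : ℝ) + 5) * (n + 4) := by
  have := Complex.norm_natCast ((n + 5) * (n + 4))
  push_cast at this
  exact this

lemma cf_norm_succ {a l A B : ℂ} {K : ℝ} (ha : ‖a‖ ≤ K) (hl : ‖l‖ ≤ K) (n : ℕ) :
    ‖cf a l A B (n + 5)‖ * (((n : ℝ) + 5) * (n + 4)) ≤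
      ‖cf a l A B n‖ + K * ‖cf a l A B (n + 2)‖ + K * ‖cf a l A B (n + 3)‖ := by
  have hd : (0 : ℝ) < ((n : ℝ) + 5) * (n + 4) := by positivity
  rw [cf, norm_div, norm_den, div_mul_cancel₀ _ hd.ne']
  calc _ ≤ ‖cf a l A B n - a * cf a l A B (n + 2)‖ + ‖l * cf a l A B (n + 3)‖ := norm_add_le _ _
    _ ≤ ‖cf a l A B n‖ + ‖a * cf a l A B (n + 2)‖ + ‖l * cf a l A B (n + 3)‖ := by
        gcongr; exact norm_sub_le _ _
    _ ≤ _ := by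
        rw [norm_mul, norm_mul]; gcongr

lemma cf_crude {a l A B : ℂ} {K : ℝ} (hK : 0 ≤ K) (ha : ‖a‖ ≤ K) (hl : ‖l‖ ≤ K)
    (hA : ‖A‖ ≤ 1) (hB : ‖B‖ ≤ 1) : ∀ n, ‖cf a l A B n‖ ≤ (1 + 2 * K) ^ n := by
  intro n
  induction n using Nat.strong_induction_on with
  | _ n ih =>
    have hlA : ‖l * A‖ ≤ K := by
      rw [norm_mul]; nlinarith [norm_nonneg A, norm_nonneg l]
    have hlB : ‖l * B‖ ≤ K := by
      rw [norm_mul]; nlinarith [norm_nonneg B, norm_nonneg l]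
    have haA : ‖a * A‖ ≤ K := by
      rw [norm_mul]; nlinarith [norm_nonneg A, norm_nonneg a]
    have haB : ‖a * B‖ ≤ K := by
      rw [norm_mul]; nlinarith [norm_nonneg B, norm_nonneg a]
    match n with
    | 0 => simpa [cf] using hA
    | 1 => simp [cf]; linarith
    | 2 =>
      simp only [cf, norm_div, Complex.norm_ofNat]
      nlinarith
    | 3 =>
      simp only [cf, norm_div, Complex.norm_ofNat]
      have := norm_sub_le (l * B) (a * A)
      have h1 : (1:ℝ) ≤ (1 + 2 * K)^2 := by nlinarith
      nlinarith
    | 4 =>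
      simp only [cf, norm_div, Complex.norm_ofNat]
      have := norm_sub_le (l * (l * A / 2)) (a * B)
      have h2 : ‖l * (l * A / 2)‖ ≤ K * K := by
        rw [norm_mul, norm_div, Complex.norm_ofNat]
        have := norm_nonneg (l * A)
        have : ‖l * A‖ / 2 ≤ K := by linarith
        gcongr
      have h1 : (1:ℝ) + 2 * K ≤ (1 + 2 * K)^2 := by nlinarith
      have h3 : (1 + 2 * K) ^ 4 = (1 + 2 * K)^2 * (1 + 2 * K)^2 := by ring
      nlinarith
    | n + 5 =>
      have h := cf_norm_succ (A := A) (B := B) ha hl n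
      have h0 := ih n (by omega)
      have h2 := ih (n + 2) (by omega)
      have h3 := ih (n + 3) (by omega)
      have hq : 1 ≤ 1 + 2 * K := by linarith
      have e0 : (1 + 2 * K) ^ n ≤ (1 + 2 * K) ^ (n + 4) := pow_le_pow_right₀ hq (by omega)
      have e2 : (1 + 2 * K) ^ (n + 2) ≤ (1 + 2 * K) ^ (n + 4) := pow_le_pow_right₀ hq (by omega)
      have e3 : (1 + 2 * K) ^ (n + 3) ≤ (1 + 2 * K) ^ (n + 4) := pow_le_pow_right₀ hq (by omega)
      have hd : (1 : ℝ) ≤ ((n : ℝ) + 5) * (n + 4) := by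
        have : (0:ℝ) ≤ n := Nat.cast_nonneg n
        nlinarith
      have h4 : ‖cf a l A B (n + 5)‖ ≤ ‖cf a l A B (n + 5)‖ * (((n : ℝ) + 5) * (n + 4)) :=
        le_mul_of_one_le_right (norm_nonneg _) hd
      have h5 : K * ‖cf a l A B (n + 2)‖ ≤ K * (1 + 2 * K) ^ (n + 4) :=
        mul_le_mul_of_nonneg_left (h2.trans e2) hK
      have h6 : K * ‖cf a l A B (n + 3)‖ ≤ K * (1 + 2 * K) ^ (n + 4) :=
        mul_le_mul_of_nonneg_left (h3.trans e3) hK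
      calc ‖cf a l A B (n + 5)‖ ≤ (1 + 2 * K) ^ (n + 4) + K * (1 + 2 * K) ^ (n + 4) +
            K * (1 + 2 * K) ^ (n + 4) := by linarith
        _ = (1 + 2 * K) ^ (n + 5) := by ring

lemma cf_fast (K R : ℝ) (hK : 0 ≤ K) (hR : 0 < R) : ∃ M : ℝ, ∀ a l A B : ℂ, ‖a‖ ≤ K → ‖l‖ ≤ K →
    ‖A‖ ≤ 1 → ‖B‖ ≤ 1 → ∀ n, ‖cf a l A B n‖ * R ^ n ≤ M := by
  obtain ⟨N, hN⟩ := exists_nat_ge (R ^ 5 + K * R ^ 3 + K * R ^ 2)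
  refine ⟨(max 1 ((1 + 2 * K) * R)) ^ (N + 5), ?_⟩
  intro a l A B ha hl hA hB n
  set q := max 1 ((1 + 2 * K) * R) with hq
  have hq1 : 1 ≤ q := le_max_left _ _
  have hq2 : (1 + 2 * K) * R ≤ q := le_max_right _ _
  induction n using Nat.strong_induction_on with
  | _ n ih =>
    rcases lt_or_ge n (N + 5) with h | h
    · calc ‖cf a l A B n‖ * R ^ n ≤ (1 + 2 * K) ^ n * R ^ n := by
            gcongr; exact cf_crude hK ha hl hA hB n
        _ = ((1 + 2 * K) * R) ^ n := (mul_pow _ _ _).symm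
        _ ≤ q ^ n := by gcongr
        _ ≤ q ^ (N + 5) := pow_le_pow_right₀ hq1 h.le
    · obtain ⟨m, rfl⟩ : ∃ m, n = m + 5 := ⟨n - 5, by omega⟩
      have hm : N ≤ m := by omega
      have h := cf_norm_succ (A := A) (B := B) ha hl m
      have h0 := ih m (by omega)
      have h2 := ih (m + 2) (by omega)
      have h3 := ih (m + 3) (by omega)
      have hmN : (N : ℝ) ≤ m := by exact_mod_cast hm
      have hd : R ^ 5 + K * R ^ 3 + K * R ^ 2 ≤ ((m : ℝ) + 5) * (m + 4) := by
        have : (0:ℝ) ≤ N := Nat.cast_nonneg N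
        nlinarith
      have hd0 : (0 : ℝ) < ((m : ℝ) + 5) * (m + 4) := by positivity
      set Q := q ^ (N + 5)
      have hQ : 0 ≤ Q := by positivity
      have : ‖cf a l A B (m + 5)‖ * R ^ (m + 5) * (((m : ℝ) + 5) * (m + 4)) ≤
          Q * (((m : ℝ) + 5) * (m + 4)) := by
        calc _ = (‖cf a l A B (m + 5)‖ * (((m : ℝ) + 5) * (m + 4))) * R ^ (m + 5) := by ring
          _ ≤ (‖cf a l A B m‖ + K * ‖cf a l A B (m + 2)‖ + K * ‖cf a l A B (m + 3)‖) * R ^ (m + 5) := by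
              gcongr
          _ = (‖cf a l A B m‖ * R ^ m) * R ^ 5 + K * (‖cf a l A B (m + 2)‖ * R ^ (m + 2)) * R ^ 3
              + K * (‖cf a l A B (m + 3)‖ * R ^ (m + 3)) * R ^ 2 := by ring
          _ ≤ Q * R ^ 5 + K * Q * R ^ 3 + K * Q * R ^ 2 := by gcongr
          _ = Q * (R ^ 5 + K * R ^ 3 + K * R ^ 2) := by ring
          _ ≤ _ := by gcongr
      exact le_of_mul_le_mul_right this hd0

lemma cf_Fast {a l A B : ℂ} (hA : ‖A‖ ≤ 1) (hB : ‖B‖ ≤ 1) : Fast (cf a l A B) := by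
  intro R hR
  obtain ⟨M, hM⟩ := cf_fast (max ‖a‖ ‖l‖) R (le_max_of_le_left (norm_nonneg _)) hR
  exact ⟨M, hM a l A B (le_max_left _ _) (le_max_right _ _) hA hB⟩

/-- potential -/
noncomputable def V (a l z : ℂ) : ℂ := z ^ 3 - a * z + l

lemma cf_ode {a l A B : ℂ} (hA : ‖A‖ ≤ 1) (hB : ‖B‖ ≤ 1) (z : ℂ) :
    ps (dco (dco (cf a l A B))) z = V a l z * ps (cf a l A B) z := by
  have hF : Fast (cf a l A B) := cf_Fast hA hB
  have h0 := hF.hasSum z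
  have h2 : HasSum (fun n => dco (dco (cf a l A B)) n * z ^ n) (V a l z * ps (cf a l A B) z) := by
    rw [← hasSum_nat_add_iff' 3]
    have s1 := (hasSum_nat_add_iff' (f := fun n => cf a l A B n * z ^ n) 2).2 h0
    have s2 := (hasSum_nat_add_iff' (f := fun n => cf a l A B n * z ^ n) 3).2 h0
    have := ((h0.mul_left (z ^ 3)).sub (s1.mul_left (a * z))).add (s2.mul_left l)
    convert this using 1
    · ext n
      simp only [dco]
      rw [show n + 3 + 1 + 1 = n + 5 from rfl]
      rw [cf]
      have h5 : ((n : ℂ) + 5) ≠ 0 := by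
        have := Nat.cast_ne_zero (R := ℂ).2 (Nat.succ_ne_zero (n + 4))
        push_cast at this; convert this using 1; ring
      have h4 : ((n : ℂ) + 4) ≠ 0 := by
        have := Nat.cast_ne_zero (R := ℂ).2 (Nat.succ_ne_zero (n + 3))
        push_cast at this; convert this using 1; ring
      push_cast
      rw [show ((n : ℂ) + 3 + 1) = n + 4 by ring, show ((n : ℂ) + 4 + 1) = n + 5 by ring]
      field_simp
      ring
    · simp [Finset.sum_range_succ, dco, cf, V]
      ring
  exact h2.tsum_eq

/-- fundamental solution data -/
noncomputable def ph (a : ℂ) (A B : ℂ) (l z : ℂ) : ℂ := ps (cf a l A B) z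
noncomputable def ph' (a : ℂ) (A B : ℂ) (l z : ℂ) : ℂ := ps (dco (cf a l A B)) z

/-- `y` with derivative `y1` solves the equation -/
def IsSol (a l : ℂ) (y y1 : ℂ → ℂ) : Prop :=
  (∀ z, HasDerivAt y (y1 z) z) ∧ ∀ z, HasDerivAt y1 (V a l z * y z) z

lemma ph_isSol {a A B : ℂ} (l : ℂ) (hA : ‖A‖ ≤ 1) (hB : ‖B‖ ≤ 1) :
    IsSol a l (ph a A B l) (ph' a A B l) := by
  refine ⟨fun z => (cf_Fast hA hB).hasDerivAt z, fun z => ?_⟩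
  have := (cf_Fast (a := a) (l := l) hA hB).dco.hasDerivAt z
  rw [cf_ode hA hB] at this
  exact this

lemma cf_continuous (a A B : ℂ) (n : ℕ) : Continuous (fun l => cf a l A B n) := by
  induction n using Nat.strong_induction_on with
  | _ n ih =>
    match n with
    | 0 => simp only [cf]; fun_prop
    | 1 => simp only [cf]; fun_prop
    | 2 => simp only [cf]; fun_prop
    | 3 => simp only [cf]; fun_prop
    | 4 => simp only [cf]; fun_prop
    | n + 5 =>
      have h0 := ih n (by omega)
      have h2 := ih (n + 2) (by omega)
      have h3 := ih (n + 3) (by omega)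
      simp only [cf]
      fun_prop

lemma ps_cont_aux {b : ℂ → ℕ → ℂ} (hb : ∀ n, Continuous (fun l => b l n))
    (h : ∀ K R : ℝ, 0 ≤ K → 0 < R → ∃ M : ℝ, ∀ l, ‖l‖ ≤ K → ∀ n, ‖b l n‖ * R ^ n ≤ M) :
    Continuous (fun q : ℂ × ℂ => ps (b q.1) q.2) := by
  rw [continuous_iff_continuousAt]
  intro q
  have hR : 0 < ‖q‖ + 1 := by positivity
  obtain ⟨M, hM⟩ := h (‖q‖ + 1) (2 * (‖q‖ + 1)) hR.le (by positivity)
  have : ContinuousOn (fun q : ℂ × ℂ => ps (b q.1) q.2) (Metric.ball 0 (‖q‖ + 1)) := by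
    unfold ps
    refine continuousOn_tsum (u := fun n => M * (1 / 2) ^ n) ?_ (summable_half M) ?_
    · intro n
      have := hb n
      fun_prop
    · intro n p hp
      have hp' : ‖p‖ ≤ ‖q‖ + 1 := by simpa using (Metric.mem_ball.1 hp).le
      exact term_bound hR (hM p.1 ((norm_fst_le p).trans hp')) ((norm_snd_le p).trans hp') n
  exact this.continuousAt (Metric.isOpen_ball.mem_nhds (by simp))

lemma ph_cont {a A B : ℂ} (hA : ‖A‖ ≤ 1) (hB : ‖B‖ ≤ 1) :
    Continuous (fun q : ℂ × ℂ => ph a A B q.1 q.2) := by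
  refine ps_cont_aux (b := fun l => cf a l A B) (cf_continuous a A B) ?_
  intro K R hK hR
  obtain ⟨M, hM⟩ := cf_fast (max ‖a‖ K) R (le_max_of_le_left (norm_nonneg _)) hR
  exact ⟨M, fun l hl => hM a l A B (le_max_left _ _) (hl.trans (le_max_right _ _)) hA hB⟩

lemma ph'_cont {a A B : ℂ} (hA : ‖A‖ ≤ 1) (hB : ‖B‖ ≤ 1) :
    Continuous (fun q : ℂ × ℂ => ph' a A B q.1 q.2) := by
  refine ps_cont_aux (b := fun l => dco (cf a l A B)) ?_ ?_
  · intro n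
    have := cf_continuous a A B (n + 1)
    unfold dco
    fun_prop
  intro K R hK hR
  obtain ⟨M, hM⟩ := cf_fast (max ‖a‖ K) (2 * R) (le_max_of_le_left (norm_nonneg _)) (by positivity)
  exact ⟨M / R, fun l hl => dco_bound hR
    (hM a l A B (le_max_left _ _) (hl.trans (le_max_right _ _)) hA hB)⟩

lemma ph_zero (a A B l : ℂ) : ph a A B l 0 = A := by
  unfold ph; rw [ps_zero]; simp [cf]
lemma ph'_zero (a A B l : ℂ) : ph' a A B l 0 = B := by
  unfold ph'; rw [ps_zero]; simp [dco, cf]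

/-- Wronskian is constant -/
lemma IsSol.wronsk {a l : ℂ} {y y1 w w1 : ℂ → ℂ} (h : IsSol a l y y1) (g : IsSol a l w w1) (z z' : ℂ) :
    y z * w1 z - y1 z * w z = y z' * w1 z' - y1 z' * w z' := by
  have hd : ∀ z, HasDerivAt (fun z => y z * w1 z - y1 z * w z) 0 z := by
    intro z
    have := ((h.1 z).fun_mul (g.2 z)).fun_sub ((h.2 z).fun_mul (g.1 z))
    exact this.congr_deriv (by ring)
  exact is_const_of_deriv_eq_zero (fun z => (hd z).differentiableAt) (fun z => (hd z).deriv) z z'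

lemma IsSol.lin {a l : ℂ} {y y1 w w1 : ℂ → ℂ} (h : IsSol a l y y1) (g : IsSol a l w w1) (α β : ℂ) :
    IsSol a l (fun z => α * y z + β * w z) (fun z => α * y1 z + β * w1 z) := by
  refine ⟨fun z => ((h.1 z).const_mul α).fun_add ((g.1 z).const_mul β), fun z => ?_⟩
  have := ((h.2 z).const_mul α).fun_add ((g.2 z).const_mul β)
  exact this.congr_deriv (by ring)

/-- general solution by Cauchy data at 0 -/
noncomputable def sol (a l α β z : ℂ) : ℂ := α * ph a 1 0 l z + β * ph a 0 1 l z
noncomputable def sol' (a l α β z : ℂ) : ℂ := α * ph' a 1 0 l z + β * ph' a 0 1 l z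

lemma sol_isSol (a l α β : ℂ) : IsSol a l (sol a l α β) (sol' a l α β) :=
  (ph_isSol l (by simp) (by simp)).lin (ph_isSol l (by simp) (by simp)) α β

lemma sol_zero (a l α β : ℂ) : sol a l α β 0 = α := by simp [sol, ph_zero]
lemma sol'_zero (a l α β : ℂ) : sol' a l α β 0 = β := by simp [sol', ph'_zero]

lemma ph_wronsk (a l z : ℂ) : ph a 1 0 l z * ph' a 0 1 l z - ph' a 1 0 l z * ph a 0 1 l z = 1 := by
  rw [(ph_isSol (a := a) (A := 1) (B := 0) l (by simp) (by simp)).wronsk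
    (ph_isSol (a := a) (A := 0) (B := 1) l (by simp) (by simp)) z 0]
  simp [ph_zero, ph'_zero]

lemma sol_cont (a : ℂ) : Continuous (fun q : ℂ × ℂ × ℂ × ℂ => sol a q.1 q.2.1 q.2.2.1 q.2.2.2) := by
  have h1 := (ph_cont (a := a) (A := 1) (B := 0) (by simp) (by simp))
  have h2 := (ph_cont (a := a) (A := 0) (B := 1) (by simp) (by simp))
  have g1 := h1.comp (f := fun q : ℂ × ℂ × ℂ × ℂ => (q.1, q.2.2.2)) (by fun_prop)
  have g2 := h2.comp (f := fun q : ℂ × ℂ × ℂ × ℂ => (q.1, q.2.2.2)) (by fun_prop)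
  simp only [Function.comp_def] at g1 g2
  unfold sol
  fun_prop

lemma sol'_cont (a : ℂ) : Continuous (fun q : ℂ × ℂ × ℂ × ℂ => sol' a q.1 q.2.1 q.2.2.1 q.2.2.2) := by
  have h1 := (ph'_cont (a := a) (A := 1) (B := 0) (by simp) (by simp))
  have h2 := (ph'_cont (a := a) (A := 0) (B := 1) (by simp) (by simp))
  have g1 := h1.comp (f := fun q : ℂ × ℂ × ℂ × ℂ => (q.1, q.2.2.2)) (by fun_prop)
  have g2 := h2.comp (f := fun q : ℂ × ℂ × ℂ × ℂ => (q.1, q.2.2.2)) (by fun_prop)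
  simp only [Function.comp_def] at g1 g2
  unfold sol'
  fun_prop

/-- two solutions with the same Cauchy data coincide -/
lemma IsSol.eq_sol {a l : ℂ} {y y1 : ℂ → ℂ} (h : IsSol a l y y1) (z : ℂ) :
    y z = sol a l (y 0) (y1 0) z ∧ y1 z = sol' a l (y 0) (y1 0) z := by
  have h0 := h.wronsk (ph_isSol (a := a) (A := 1) (B := 0) l (by simp) (by simp)) z 0
  have h1 := h.wronsk (ph_isSol (a := a) (A := 0) (B := 1) l (by simp) (by simp)) z 0
  have hw := ph_wronsk a l z
  simp only [ph_zero, ph'_zero] at h0 h1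
  unfold sol sol'
  constructor
  · linear_combination (-ph a 0 1 l z) * h0 + ph a 1 0 l z * h1 - y z * hw
  · linear_combination (-ph' a 0 1 l z) * h0 + ph' a 1 0 l z * h1 - y1 z * hw

/-- solution with given data at a point -/
lemma exists_sol (a l z0 A B : ℂ) : ∃ y y1, IsSol a l y y1 ∧ y z0 = A ∧ y1 z0 = B := by
  have hw := ph_wronsk a l z0
  refine ⟨_, _, sol_isSol a l (A * ph' a 0 1 l z0 - B * ph a 0 1 l z0)
    (B * ph a 1 0 l z0 - A * ph' a 1 0 l z0), ?_, ?_⟩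
  · unfold sol; linear_combination A * hw
  · unfold sol'; linear_combination B * hw

lemma IsSol.eq_of_data {a l : ℂ} {y y1 w w1 : ℂ → ℂ} (h : IsSol a l y y1) (g : IsSol a l w w1) (z0 : ℂ)
    (e0 : y z0 = w z0) (e1 : y1 z0 = w1 z0) : (∀ z, y z = w z) ∧ ∀ z, y1 z = w1 z := by
  have hy := h.eq_sol
  have hz : IsSol a l (fun z => y z - w z) (fun z => y1 z - w1 z) := by
    have := h.lin g 1 (-1)
    simpa [sub_eq_add_neg] using this
  have h0 := hz.wronsk (ph_isSol (a := a) (A := 1) (B := 0) l (by simp) (by simp)) 0 z0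
  have h1 := hz.wronsk (ph_isSol (a := a) (A := 0) (B := 1) l (by simp) (by simp)) 0 z0
  simp only [ph_zero, ph'_zero, e0, e1, sub_self] at h0 h1
  have e2 : y 0 = w 0 := by linear_combination h1
  have e3 : y1 0 = w1 0 := by linear_combination -h0
  refine ⟨fun z => ?_, fun z => ?_⟩
  · rw [(h.eq_sol z).1, (g.eq_sol z).1, e2, e3]
  · rw [(h.eq_sol z).2, (g.eq_sol z).2, e2, e3]

end CubicPT

namespace CubicPT
open Topology Set

lemma hd_re {f : ℝ → ℂ} {f' : ℂ} {t : ℝ} (h : HasDerivAt f f' t) :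
    HasDerivAt (fun t => (f t).re) f'.re t :=
  (Complex.reCLM.hasFDerivAt.comp_hasDerivAt t h)

lemma hd_im {f : ℝ → ℂ} {f' : ℂ} {t : ℝ} (h : HasDerivAt f f' t) :
    HasDerivAt (fun t => (f t).im) f'.im t :=
  (Complex.imCLM.hasFDerivAt.comp_hasDerivAt t h)

lemma hd_conj {f : ℝ → ℂ} {f' : ℂ} {t : ℝ} (h : HasDerivAt f f' t) :
    HasDerivAt (fun t => (starRingEnd ℂ) (f t)) ((starRingEnd ℂ) f') t :=
  (Complex.conjCLE.toContinuousLinearMap.hasFDerivAt.comp_hasDerivAt t h)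

lemma hd_normSq {f : ℝ → ℂ} {f' : ℂ} {t : ℝ} (h : HasDerivAt f f' t) :
    HasDerivAt (fun t => normSq (f t)) (2 * (f' * (starRingEnd ℂ) (f t)).re) t := by
  have := ((hd_re h).fun_mul (hd_re h)).fun_add ((hd_im h).fun_mul (hd_im h))
  simp only [normSq_apply]
  refine this.congr_deriv ?_
  simp; ring

/-- barrier lemma -/
lemma barrier {f f' : ℝ → ℂ} {B B' : ℝ → ℝ} {s T : ℝ} (hst : s ≤ T)
    (hf : ContinuousOn f (Icc s T)) (hB : ContinuousOn B (Icc s T))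
    (hf' : ∀ t ∈ Ioo s T, HasDerivAt f (f' t) t) (hB' : ∀ t ∈ Ioo s T, HasDerivAt B (B' t) t)
    (h : ∀ t ∈ Ioo s T, ‖f' t‖ ≤ -B' t) : ‖f s - f T‖ ≤ B s - B T := by
  set e : ℂ := f T - f s with he
  have hanti : AntitoneOn (fun t => ((starRingEnd ℂ) e * f t).re + ‖e‖ * B t) (Icc s T) := by
    refine antitoneOn_of_hasDerivWithinAt_nonpos (convex_Icc s T)
      (f' := fun t => ((starRingEnd ℂ) e * f' t).re + ‖e‖ * B' t) ?_ ?_ ?_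
    · refine ContinuousOn.add ?_ (continuousOn_const.mul hB)
      exact Complex.continuous_re.comp_continuousOn (continuousOn_const.mul hf)
    · intro t ht
      rw [interior_Icc] at ht
      exact ((hd_re ((hf' t ht).const_mul _)).fun_add ((hB' t ht).const_mul _)).hasDerivWithinAt
    · intro t ht
      rw [interior_Icc] at ht
      have h1 : ((starRingEnd ℂ) e * f' t).re ≤ ‖e‖ * ‖f' t‖ := by
        refine (Complex.re_le_norm _).trans ?_
        rw [norm_mul, RCLike.norm_conj]
      have := mul_le_mul_of_nonneg_left (h t ht) (norm_nonneg e)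
      linarith
  have := hanti (left_mem_Icc.2 hst) (right_mem_Icc.2 hst) hst
  dsimp only at this
  have h2 : ((starRingEnd ℂ) e * f T).re - ((starRingEnd ℂ) e * f s).re = ‖e‖ * ‖e‖ := by
    rw [← Complex.sub_re, ← mul_sub, ← he, mul_comm, Complex.mul_conj, Complex.ofReal_re,
      Complex.normSq_eq_norm_sq]; ring
  have h3 : ‖e‖ * ‖e‖ ≤ ‖e‖ * (B s - B T) := by linarith
  have h4 : 0 ≤ B s - B T := by
    have hm : AntitoneOn B (Icc s T) := by
      refine antitoneOn_of_hasDerivWithinAt_nonpos (convex_Icc s T) (f' := B') hB ?_ ?_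
      · intro t ht; rw [interior_Icc] at ht; exact (hB' t ht).hasDerivWithinAt
      · intro t ht; rw [interior_Icc] at ht; have := h t ht; have := norm_nonneg (f' t); linarith
    have := hm (left_mem_Icc.2 hst) (right_mem_Icc.2 hst) hst
    linarith
  rw [norm_sub_rev, ← he]
  rcases (norm_nonneg e).eq_or_lt with h0 | h0
  · rw [← h0]; exact h4
  · exact le_of_mul_le_mul_left h3 h0

/-! WKB data -/
noncomputable def rt (z : ℂ) : ℂ := Complex.exp (Complex.log z / 2)
noncomputable def pw (a : ℝ) (z : ℂ) : ℂ :=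
  Complex.exp ((2 / 5 : ℂ) * rt z ^ 5 - a * rt z - (3 / 4 : ℂ) * Complex.log z)
noncomputable def qw (a : ℝ) (z : ℂ) : ℂ := rt z ^ 3 - a / (2 * rt z) - 3 / (4 * rt z ^ 2)
/-- remainder potential without `l` -/
noncomputable def Rw (a : ℝ) (z : ℂ) : ℂ :=
  (a:ℂ) ^ 2 / (4 * rt z ^ 2) + a / rt z ^ 3 + (21 / 16) / rt z ^ 4

lemma rt_ne (z : ℂ) : rt z ≠ 0 := Complex.exp_ne_zero _
lemma pw_ne (a : ℝ) (z : ℂ) : pw a z ≠ 0 := Complex.exp_ne_zero _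

lemma rt_sq {z : ℂ} (hz : z ≠ 0) : rt z ^ 2 = z := by
  unfold rt
  rw [← Complex.exp_nat_mul]
  push_cast
  rw [show (2 : ℂ) * (Complex.log z / 2) = Complex.log z by ring, Complex.exp_log hz]

lemma rt_hasDeriv {z : ℂ} (hz : z ∈ slitPlane) : HasDerivAt rt (1 / (2 * rt z)) z := by
  have h0 : z ≠ 0 := slitPlane_ne_zero hz
  have h := ((Complex.hasDerivAt_log hz).div_const 2).cexp
  refine h.congr_deriv ?_
  change rt z * _ = _
  have := rt_ne z
  nth_rewrite 2 [← rt_sq h0]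
  field_simp

lemma pw_hasDeriv (a : ℝ) {z : ℂ} (hz : z ∈ slitPlane) : HasDerivAt (pw a) (qw a z * pw a z) z := by
  have h0 : z ≠ 0 := slitPlane_ne_zero hz
  have hr := rt_hasDeriv hz
  have h := ((((hr.fun_pow 5).const_mul (2 / 5 : ℂ)).fun_sub (hr.const_mul (a : ℂ))).fun_sub
    ((Complex.hasDerivAt_log hz).const_mul (3 / 4 : ℂ))).cexp
  refine h.congr_deriv ?_
  change pw a z * _ = _
  have := rt_ne z
  unfold qw
  have hz' : z⁻¹ = (rt z ^ 2)⁻¹ := by rw [rt_sq h0]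
  rw [hz']
  field_simp
  push_cast
  ring

lemma qw_hasDeriv (a : ℝ) {z : ℂ} (hz : z ∈ slitPlane) :
    HasDerivAt (qw a) (3 / 2 * rt z + a / (4 * rt z ^ 3) + 3 / (4 * rt z ^ 4)) z := by
  have hr := rt_hasDeriv hz
  have hn := rt_ne z
  have h := ((hr.fun_pow 3).fun_sub (((hr.const_mul (2:ℂ)).fun_inv (by simpa using hn)).const_mul (a : ℂ))).fun_sub
    ((((hr.fun_pow 2).const_mul (4:ℂ)).fun_inv (by simpa using hn)).const_mul (3 : ℂ))
  have h2 := h.congr_deriv (g' := 3 / 2 * rt z + a / (4 * rt z ^ 3) + 3 / (4 * rt z ^ 4)) (by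
    field_simp; push_cast; ring)
  exact h2

lemma qw_riccati (a : ℝ) (l : ℂ) {z : ℂ} (h0 : z ≠ 0) :
    (3 / 2 * rt z + a / (4 * rt z ^ 3) + 3 / (4 * rt z ^ 4)) + qw a z ^ 2 = V a l z - (l - Rw a z) := by
  have hn := rt_ne z
  unfold qw V Rw
  nth_rewrite 7 8 [← rt_sq h0]
  field_simp
  ring

lemma rt_norm {z : ℂ} (hz : z ≠ 0) : ‖rt z‖ ^ 2 = ‖z‖ := by
  rw [← norm_pow, rt_sq hz]

lemma Rw_norm {a : ℝ} (ha : 0 ≤ a) {z : ℂ} (hz : 1 ≤ ‖z‖) : ‖Rw a z‖ ≤ a ^ 2 + a + 2 := by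
  have h0 : z ≠ 0 := by intro h; rw [h] at hz; simp at hz; linarith
  have h1 : 1 ≤ ‖rt z‖ := by
    have := rt_norm h0
    nlinarith [norm_nonneg (rt z)]
  have hp : ∀ n : ℕ, 1 ≤ ‖rt z‖ ^ n := fun n => one_le_pow₀ h1
  unfold Rw
  refine (norm_add_le _ _).trans ?_
  have e1 : ‖(a:ℂ) ^ 2 / (4 * rt z ^ 2)‖ ≤ a ^ 2 := by
    rw [norm_div, norm_mul, norm_pow, norm_pow, Complex.norm_ofNat, Complex.norm_real, Real.norm_eq_abs, sq_abs]
    apply div_le_self (by positivity)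
    have := hp 2; linarith
  have e2 : ‖(a:ℂ) / rt z ^ 3‖ ≤ a := by
    rw [norm_div, norm_pow, Complex.norm_real, Real.norm_eq_abs, abs_of_nonneg ha]
    exact div_le_self ha (hp 3)
  have e3 : ‖(21 / 16 : ℂ) / rt z ^ 4‖ ≤ 2 := by
    rw [norm_div, norm_pow]
    have : ‖(21 / 16 : ℂ)‖ ≤ 2 := by rw [norm_div, Complex.norm_ofNat, Complex.norm_ofNat]; norm_num
    exact (div_le_self (norm_nonneg _) (hp 4)).trans this
  have := norm_add_le ((a:ℂ) ^ 2 / (4 * rt z ^ 2)) (a / rt z ^ 3)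
  linarith

lemma slit_of {z : ℂ} (hx : 0 ≤ z.re) (hz : z ≠ 0) : z ∈ slitPlane := by
  rw [mem_slitPlane_iff]
  by_contra! h
  exact hz (Complex.ext (le_antisymm h.1 hx) h.2)

lemma rt_re_im {z : ℂ} (hz : z ≠ 0) :
    (rt z).re ^ 2 - (rt z).im ^ 2 = z.re ∧ 2 * (rt z).re * (rt z).im = z.im := by
  have h2 := rt_sq hz
  generalize rt z = w at *
  subst h2
  constructor
  · rw [pow_two w, Complex.mul_re]; ring
  · rw [pow_two w, Complex.mul_im]; ring

lemma rt_quad {z : ℂ} (hx : 0 ≤ z.re) (ht : 0 ≤ z.im) (hz : z ≠ 0) :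
    0 < (rt z).re ∧ 0 ≤ (rt z).im ∧ (rt z).im ≤ (rt z).re := by
  have h1 : 0 < (rt z).re := by
    unfold rt
    rw [Complex.exp_re]
    refine mul_pos (Real.exp_pos _) ?_
    have := Complex.abs_arg_le_pi_div_two_iff.2 hx
    rw [abs_le] at this
    have e : (Complex.log z / 2).im = z.arg / 2 := by
      rw [show (2:ℂ) = ((2:ℝ):ℂ) by norm_num, Complex.div_ofReal_im, Complex.log_im]
    rw [e]
    apply Real.cos_pos_of_mem_Ioo
    constructor <;> linarith [Real.pi_pos]
  obtain ⟨hre, him⟩ := rt_re_im hz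
  have h3 : 0 ≤ (rt z).im := by
    by_contra! h; nlinarith
  exact ⟨h1, h3, by nlinarith⟩

/-- the growth scale -/
noncomputable def ks (z : ℂ) : ℝ := Real.sqrt (z.re + z.im) / 2

lemma qw_im {a : ℝ} (ha : 0 ≤ a) {z : ℂ} (hx : 0 ≤ z.re) (ht : 0 ≤ z.im) (hz : z ≠ 0) :
    ks z * z.im ≤ (qw a z).im := by
  obtain ⟨h1, h2, h3⟩ := rt_quad hx ht hz
  obtain ⟨e1, e2⟩ := rt_re_im hz
  have hk : ks z ≤ (rt z).re := by
    unfold ks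
    rw [div_le_iff₀ (by norm_num : (0:ℝ) < 2)]
    apply Real.sqrt_le_iff.2
    constructor
    · positivity
    · nlinarith
  unfold qw
  set w := rt z
  have hw : normSq w ≠ 0 := by simp [w, rt_ne]
  have hw0 : 0 < normSq w := lt_of_le_of_ne (normSq_nonneg _) hw.symm
  have t1 : (w ^ 3).im = 3 * w.re ^ 2 * w.im - w.im ^ 3 := by
    rw [show w ^ 3 = w * w * w by ring]; simp [Complex.mul_im, Complex.mul_re]; ring
  have t2 : ((a:ℂ) / (2 * w)).im ≤ 0 := by
    rw [div_eq_mul_inv, mul_inv]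
    rw [show (2:ℂ)⁻¹ = ((2⁻¹:ℝ):ℂ) by norm_num, Complex.im_ofReal_mul, Complex.im_ofReal_mul, Complex.inv_im]
    have : 0 ≤ w.im / normSq w := by positivity
    rw [neg_div]
    nlinarith [mul_nonneg ha this]
  have t3 : ((3:ℂ) / (4 * w ^ 2)).im ≤ 0 := by
    rw [rt_sq hz, div_eq_mul_inv, mul_inv]
    rw [show (4:ℂ)⁻¹ = ((4⁻¹:ℝ):ℂ) by norm_num, show (3:ℂ) = ((3:ℝ):ℂ) by norm_num,
      Complex.im_ofReal_mul, Complex.im_ofReal_mul, Complex.inv_im]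
    have : 0 ≤ z.im / normSq z := div_nonneg ht (normSq_nonneg _)
    rw [neg_div]
    nlinarith
  rw [Complex.sub_im, Complex.sub_im, t1]
  have t4 : ks z * z.im ≤ w.re * z.im := by gcongr
  have t5 : w.im ^ 3 ≤ w.re ^ 2 * w.im := by
    have : w.im ^ 2 ≤ w.re ^ 2 := by gcongr
    nlinarith
  nlinarith

end CubicPT

namespace CubicPT
open Topology Set

/-- point on the vertical line -/
noncomputable def zl (x t : ℝ) : ℂ := (x : ℂ) + t * I

@[simp] lemma zl_re (x t : ℝ) : (zl x t).re = x := by simp [zl]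
@[simp] lemma zl_im (x t : ℝ) : (zl x t).im = t := by simp [zl]

lemma zl_cont : Continuous (fun q : ℝ × ℝ => zl q.1 q.2) := by unfold zl; fun_prop

lemma zl_eta (z : ℂ) : zl z.re z.im = z := by simp [zl, Complex.re_add_im]

lemma hd_vert {F : ℂ → ℂ} {F' : ℂ} {x t : ℝ} (h : HasDerivAt F F' (zl x t)) :
    HasDerivAt (fun t : ℝ => F (zl x t)) (F' * I) t := by
  have h1 : HasDerivAt (fun w : ℂ => (x : ℂ) + w * I) I (t : ℂ) := by
    simpa using ((hasDerivAt_id (t : ℂ)).mul_const I).const_add (x : ℂ)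
  have h2 : HasDerivAt F F' ((x : ℂ) + t * I) := h
  exact (h2.comp (t : ℂ) h1).comp_ofReal

lemma hd_horiz {F : ℂ → ℂ} {F' : ℂ} {x t : ℝ} (h : HasDerivAt F F' (zl x t)) :
    HasDerivAt (fun x : ℝ => F (zl x t)) F' x := by
  have h1 : HasDerivAt (fun w : ℂ => w + (t : ℂ) * I) 1 (x : ℂ) := by
    simpa using (hasDerivAt_id (x : ℂ)).add_const ((t : ℂ) * I)
  have h2 : HasDerivAt F F' ((x : ℂ) + t * I) := h
  exact ((h2.comp (x : ℂ) h1).comp_ofReal).congr_deriv (by simp)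

lemma G_ineq {s κ k : ℝ} (hs : 0 < s) (hκ : 1 ≤ κ) (hk : κ ^ 2 ≤ k) (hk2 : s / 2 ≤ k) :
    s * ((1 + s) * Real.sqrt (1 + s)) * κ ≤ 4 * (1 + k * s ^ 2) := by
  set m := Real.sqrt (1 + s) with hm
  have hm2 : m ^ 2 = 1 + s := Real.sq_sqrt (by linarith)
  have hm0 : 0 ≤ m := Real.sqrt_nonneg _
  rcases le_or_gt s 1 with h | h
  · have hm3 : m ≤ 3 / 2 := by nlinarith
    have h1 : (1 + s) * m ≤ 3 := by nlinarith
    have h2 : s * ((1 + s) * m) * κ ≤ s * 3 * κ := by gcongr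
    have h3 : κ ^ 2 * s ^ 2 ≤ k * s ^ 2 := by gcongr
    nlinarith [sq_nonneg (κ * s - 1)]
  · have h1 : m * κ ≤ 2 * k := by
      apply le_of_sq_le_sq _ (by nlinarith)
      calc (m * κ) ^ 2 = (1 + s) * κ ^ 2 := by rw [mul_pow, hm2]
        _ ≤ (2 * s) * k := by
            have : 1 + s ≤ 2 * s := by linarith
            gcongr
        _ ≤ (2 * k) ^ 2 := by nlinarith
    have h2 : s * ((1 + s) * m) * κ = s * (1 + s) * (m * κ) := by ring
    rw [h2]
    have h3 : s * (1 + s) * (m * κ) ≤ s * (1 + s) * (2 * k) := by gcongr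
    have h4 : s * (1 + s) ≤ 2 * s ^ 2 := by nlinarith
    have hk0 : 0 ≤ k := by nlinarith
    nlinarith

lemma G_deriv {A τ : ℝ} (hτ : 0 < τ) : HasDerivAt (fun τ => A / Real.sqrt (1 + Real.sqrt τ))
    (-(A / (4 * Real.sqrt τ * ((1 + Real.sqrt τ) * Real.sqrt (1 + Real.sqrt τ))))) τ := by
  have hs : 0 < Real.sqrt τ := Real.sqrt_pos.2 hτ
  have h1 := Real.hasDerivAt_sqrt hτ.ne'
  have h2 := (h1.const_add 1).sqrt (by positivity)
  have hm : 0 < Real.sqrt (1 + Real.sqrt τ) := Real.sqrt_pos.2 (by positivity)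
  have h3 := (h2.fun_inv hm.ne').const_mul A
  refine h3.congr_deriv ?_
  rw [Real.sq_sqrt (by positivity)]
  field_simp
  try ring

lemma ks_pos_facts {x τ : ℝ} (hx : 0 ≤ x) (hτ : 0 ≤ τ) (hk : 1 ≤ ks (zl x τ)) :
    4 ≤ x + τ ∧ zl x τ ≠ 0 ∧ 1 ≤ ‖zl x τ‖ ∧ zl x τ ∈ slitPlane ∧ Real.sqrt τ / 2 ≤ ks (zl x τ) := by
  have h1 : 2 ≤ Real.sqrt (x + τ) := by unfold ks at hk; simp at hk; linarith
  have h2 : 4 ≤ x + τ := by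
    have := (Real.le_sqrt (by norm_num) (by linarith)).1 h1
    linarith
  have h3 : 1 ≤ ‖zl x τ‖ := by
    have e1 := Complex.abs_re_le_norm (zl x τ)
    have e2 := Complex.abs_im_le_norm (zl x τ)
    simp only [zl_re, zl_im, abs_of_nonneg hx, abs_of_nonneg hτ] at e1 e2
    linarith
  have h4 : zl x τ ≠ 0 := by intro h; rw [h] at h3; simp at h3; linarith
  refine ⟨h2, h4, h3, slit_of (by simpa using hx) h4, ?_⟩
  unfold ks
  simp only [zl_re, zl_im]
  gcongr
  linarith

lemma ks_mono {x τ τ' : ℝ} (h : τ ≤ τ') : ks (zl x τ) ≤ ks (zl x τ') := by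
  unfold ks; simp only [zl_re, zl_im]; gcongr

lemma wkb_T {a x ρ τ0 T : ℝ} {l : ℂ} (ha : 0 ≤ a) (hx : 0 ≤ x) (hρ : ‖l‖ + (a ^ 2 + a + 2) ≤ ρ)
    (hτ0 : 0 ≤ τ0) (hT : τ0 ≤ T) (hk : (48 * ρ) ^ 2 ≤ ks (zl x τ0)) {y y1 : ℂ → ℂ}
    (hy : IsSol a l y y1) (h0 : y (zl x T) = pw a (zl x T))
    (h1 : y1 (zl x T) = qw a (zl x T) * pw a (zl x T)) :
    ‖y (zl x τ0) / pw a (zl x τ0) - 1‖ ≤ 24 * ρ / Real.sqrt (ks (zl x τ0)) ∧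
    ‖(y1 (zl x τ0) - qw a (zl x τ0) * y (zl x τ0)) / pw a (zl x τ0)‖ ≤
      3 / 2 * ρ / (1 + ks (zl x τ0) * τ0) := by
  have hρ2 : 2 ≤ ρ := by have := norm_nonneg l; nlinarith
  have hk1 : ∀ τ, τ0 ≤ τ → 1 ≤ ks (zl x τ) := fun τ h => by
    have := ks_mono (x := x) h; nlinarith
  have facts : ∀ τ, τ0 ≤ τ → _ := fun τ h => ks_pos_facts hx (hτ0.trans h) (hk1 τ h)
  have hslit : ∀ τ, τ0 ≤ τ → zl x τ ∈ slitPlane := fun τ h => (facts τ h).2.2.2.1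
  set U : ℝ → ℂ := fun τ => y (zl x τ) / pw a (zl x τ) with hU
  set W : ℝ → ℂ := fun τ => pw a (zl x τ) * (y1 (zl x τ) - qw a (zl x τ) * y (zl x τ)) with hW
  have dU : ∀ τ, τ0 ≤ τ → HasDerivAt U (W τ / pw a (zl x τ) ^ 2 * I) τ := by
    intro τ h
    have hp := pw_ne a (zl x τ)
    have e1 := (hy.1 (zl x τ)).fun_div (pw_hasDeriv a (hslit τ h)) hp
    have e2 := hd_vert e1
    refine e2.congr_deriv ?_
    simp only [hW]
    field_simp
  have dW : ∀ τ, τ0 ≤ τ → HasDerivAt W ((l - Rw a (zl x τ)) * pw a (zl x τ) ^ 2 * U τ * I) τ := by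
    intro τ h
    have hp := pw_ne a (zl x τ)
    have e1 := (pw_hasDeriv a (hslit τ h)).fun_mul ((hy.2 (zl x τ)).fun_sub
      ((qw_hasDeriv a (hslit τ h)).fun_mul (hy.1 (zl x τ))))
    have e2 := hd_vert e1
    refine e2.congr_deriv ?_
    have hr := qw_riccati a l (facts τ h).2.1
    simp only [hU]
    have hr2 : V a l (zl x τ) = (3 / 2 * rt (zl x τ) + a / (4 * rt (zl x τ) ^ 3) + 3 / (4 * rt (zl x τ) ^ 4))
      + qw a (zl x τ) ^ 2 + (l - Rw a (zl x τ)) := by rw [hr]; ring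
    rw [hr2]
    generalize (3 / 2 * rt (zl x τ) + a / (4 * rt (zl x τ) ^ 3) + 3 / (4 * rt (zl x τ) ^ 4)) = X
    field_simp
    ring
  have cU : ContinuousOn U (Icc τ0 T) := fun τ h => (dU τ h.1).continuousAt.continuousWithinAt
  have cW : ContinuousOn W (Icc τ0 T) := fun τ h => (dW τ h.1).continuousAt.continuousWithinAt
  obtain ⟨τm, hτm, hmax⟩ := isCompact_Icc.exists_isMaxOn (nonempty_Icc.2 hT) cU.norm
  set As := ‖U τm‖ with hAs
  have hA : ∀ τ ∈ Icc τ0 T, ‖U τ‖ ≤ As := fun τ h => hmax h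
  have hAs0 : 0 ≤ As := norm_nonneg _
  have hUT : U T = 1 := by simp only [hU]; rw [h0]; exact div_self (pw_ne _ _)
  have hWT : W T = 0 := by simp only [hW]; rw [h0, h1]; ring
  -- bound on W
  set γ : ℝ → ℝ := fun τ => 1 / (1 + ks (zl x τ) * τ) with hγ
  have hγ0 : ∀ τ, τ0 ≤ τ → 0 < γ τ := fun τ h => by
    have := hk1 τ h; have : 0 ≤ τ := hτ0.trans h
    simp only [hγ]; positivity
  set N : ℝ → ℝ := fun τ => normSq (pw a (zl x τ)) with hN
  have dN : ∀ τ, τ0 ≤ τ → HasDerivAt N (-(2 * (qw a (zl x τ)).im * N τ)) τ := by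
    intro τ h
    have := hd_normSq (hd_vert (pw_hasDeriv a (hslit τ h)))
    refine this.congr_deriv ?_
    simp only [hN]
    rw [show qw a (zl x τ) * pw a (zl x τ) * I * (starRingEnd ℂ) (pw a (zl x τ)) =
      (pw a (zl x τ) * (starRingEnd ℂ) (pw a (zl x τ))) * (qw a (zl x τ) * I) by ring,
      Complex.mul_conj, Complex.re_ofReal_mul]
    simp
    ring
  have dγ : ∀ τ, τ0 ≤ τ → HasDerivAt γ (-((ks (zl x τ) + τ / (8 * ks (zl x τ))) * γ τ ^ 2)) τ := by
    intro τ h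
    have h4 := (facts τ h).1
    have hk' := hk1 τ h
    have hτ : 0 ≤ τ := hτ0.trans h
    have hpos : 0 < 1 + ks (zl x τ) * τ := by positivity
    have hsq : 0 < Real.sqrt (x + τ) := Real.sqrt_pos.2 (by linarith)
    have dk : HasDerivAt (fun τ => ks (zl x τ)) (1 / (8 * ks (zl x τ))) τ := by
      have e := (((hasDerivAt_id τ).const_add x).sqrt (by simp; linarith)).div_const 2
      have e2 : HasDerivAt (fun τ => ks (zl x τ)) (1 / (2 * Real.sqrt (x + τ)) / 2) τ := by
        unfold ks; simpa only [zl_re, zl_im, id] using e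
      refine e2.congr_deriv ?_
      unfold ks; simp only [zl_re, zl_im]
      field_simp
      norm_num
    have e3 := ((dk.fun_mul (hasDerivAt_id τ)).const_add 1).fun_inv hpos.ne'
    simp only [hγ, one_div]
    refine e3.congr_deriv ?_
    simp only [id]
    field_simp
    try ring
  have bW : ∀ τ ∈ Icc τ0 T, ‖W τ‖ ≤ ρ * As * γ τ * N τ := by
    intro τ hτ
    have hb := barrier (f := W) (f' := fun τ => (l - Rw a (zl x τ)) * pw a (zl x τ) ^ 2 * U τ * I)
      (B := fun τ => ρ * As * (γ τ * N τ))
      (B' := fun τ => ρ * As * (-((ks (zl x τ) + τ / (8 * ks (zl x τ))) * γ τ ^ 2) * N τ +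
        γ τ * (-(2 * (qw a (zl x τ)).im * N τ)))) hτ.2
      (cW.mono (Icc_subset_Icc_left hτ.1))
      (fun t ht => (((dγ t (hτ.1.trans ht.1)).fun_mul (dN t (hτ.1.trans ht.1))).const_mul _).continuousAt.continuousWithinAt)
      (fun t ht => dW t (hτ.1.trans ht.1.le))
      (fun t ht => (((dγ t (hτ.1.trans ht.1.le)).fun_mul (dN t (hτ.1.trans ht.1.le))).const_mul _))
      ?_
    · rw [hWT, sub_zero] at hb
      have : 0 ≤ ρ * As * (γ T * N T) := by
        have := (hγ0 T hT).le
        have : 0 ≤ N T := normSq_nonneg _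
        positivity
      linarith
    · intro t ht
      have htt : τ0 ≤ t := hτ.1.trans ht.1.le
      have ht0 : 0 ≤ t := hτ0.trans htt
      have hk' := hk1 t htt
      have f := facts t htt
      have hq := qw_im (a := a) ha (z := zl x t) (by simpa using hx) (by simpa using ht0) f.2.1
      rw [zl_im] at hq
      have hN0 : 0 ≤ N t := normSq_nonneg _
      have hg : γ t * (1 + ks (zl x t) * t) = 1 := by
        have : 0 < 1 + ks (zl x t) * t := by positivity
        simp only [hγ]; field_simp
      have hR : ‖l - Rw a (zl x t)‖ ≤ ρ :=
        (norm_sub_le _ _).trans (by have := Rw_norm ha f.2.2.1; linarith)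
      have hnorm : ‖(l - Rw a (zl x t)) * pw a (zl x t) ^ 2 * U t * I‖ ≤ ρ * N t * As := by
        rw [norm_mul, norm_mul, norm_mul, norm_I, mul_one, norm_pow]
        simp only [hN, normSq_eq_norm_sq]
        gcongr
        exact hA t ⟨htt, ht.2.le⟩
      refine hnorm.trans ?_
      have hk0 : 0 ≤ t / (8 * ks (zl x t)) := by positivity
      have hγt := hγ0 t htt
      have key : 1 ≤ (ks (zl x t) + t / (8 * ks (zl x t))) * γ t ^ 2 + γ t * (2 * (qw a (zl x t)).im) := by
        have a1 : γ t * (2 * (ks (zl x t) * t)) ≤ γ t * (2 * (qw a (zl x t)).im) := by gcongr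
        have a2 : (1:ℝ) * γ t ^ 2 ≤ (ks (zl x t) + t / (8 * ks (zl x t))) * γ t ^ 2 := by
          gcongr; linarith
        have a3 : γ t * (2 * (ks (zl x t) * t)) = 2 - 2 * γ t := by linear_combination 2 * hg
        nlinarith [sq_nonneg (1 - γ t)]
      have : 0 ≤ ρ * As * N t := by positivity
      have := mul_le_mul_of_nonneg_left key this
      linarith
  -- bound on U
  set k0 := ks (zl x τ0) with hk0
  have hκ : 48 * ρ ≤ Real.sqrt k0 := Real.le_sqrt_of_sq_le hk
  have hκ1 : 1 ≤ Real.sqrt k0 := by linarith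
  have hκ2 : Real.sqrt k0 ^ 2 = k0 := Real.sq_sqrt (by have := hk1 τ0 le_rfl; linarith)
  have bU : ∀ τ ∈ Icc τ0 T, ‖U τ - 1‖ ≤ ρ * As * (16 / Real.sqrt k0) := by
    intro τ hτ
    have cG : Continuous (fun τ => 16 / Real.sqrt k0 / Real.sqrt (1 + Real.sqrt τ)) := by
      refine Continuous.div continuous_const (by fun_prop) (fun τ => ?_)
      have : 0 ≤ Real.sqrt τ := Real.sqrt_nonneg _
      exact (Real.sqrt_pos.2 (by linarith)).ne'
    have hb := barrier (f := U) (f' := fun τ => W τ / pw a (zl x τ) ^ 2 * I)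
      (B := fun τ => ρ * As * (16 / Real.sqrt k0 / Real.sqrt (1 + Real.sqrt τ)))
      (B' := fun τ => ρ * As * (-(16 / Real.sqrt k0 / (4 * Real.sqrt τ * ((1 + Real.sqrt τ) * Real.sqrt (1 + Real.sqrt τ))))))
      hτ.2 (cU.mono (Icc_subset_Icc_left hτ.1)) (continuous_const.mul cG).continuousOn
      (fun t ht => dU t (hτ.1.trans ht.1.le))
      (fun t ht => (G_deriv ((hτ0.trans hτ.1).trans_lt ht.1)).const_mul _) ?_
    · rw [hUT] at hb
      refine hb.trans ?_
      have e1 : 0 ≤ ρ * As * (16 / Real.sqrt k0 / Real.sqrt (1 + Real.sqrt T)) := by positivity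
      have e2 : 16 / Real.sqrt k0 / Real.sqrt (1 + Real.sqrt τ) ≤ 16 / Real.sqrt k0 := by
        apply div_le_self (by positivity)
        rw [Real.one_le_sqrt]
        have := Real.sqrt_nonneg τ; linarith
      have e3 : ρ * As * (16 / Real.sqrt k0 / Real.sqrt (1 + Real.sqrt τ)) ≤ ρ * As * (16 / Real.sqrt k0) := by gcongr
      linarith
    · intro t ht
      have htt : τ0 ≤ t := hτ.1.trans ht.1.le
      have ht0 : 0 < t := (hτ0.trans hτ.1).trans_lt ht.1
      have f := facts t htt
      have hs : 0 < Real.sqrt t := Real.sqrt_pos.2 ht0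
      have hG := G_ineq (k := ks (zl x t)) hs hκ1 (by rw [hκ2]; exact ks_mono htt) f.2.2.2.2
      have hw := bW t ⟨htt, ht.2.le⟩
      have hNe : N t = ‖pw a (zl x t)‖ ^ 2 := normSq_eq_norm_sq _
      have hNpos : 0 < ‖pw a (zl x t)‖ ^ 2 := by have := norm_pos_iff.2 (pw_ne a (zl x t)); positivity
      rw [norm_mul, norm_I, mul_one, norm_div, norm_pow]
      have e1 : ‖W t‖ / ‖pw a (zl x t)‖ ^ 2 ≤ ρ * As * γ t := by
        rw [div_le_iff₀ hNpos, ← hNe]; exact hw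
      refine e1.trans ?_
      rw [mul_neg, neg_neg]
      gcongr
      have hm : 0 < Real.sqrt (1 + Real.sqrt t) := Real.sqrt_pos.2 (by positivity)
      have hk' := hk1 t htt
      simp only [hγ]
      rw [Real.sq_sqrt ht0.le] at hG
      rw [div_div, div_le_div_iff₀ (by positivity) (by positivity)]
      linarith
  have hρ16 : ρ * (16 / Real.sqrt k0) ≤ 1 / 3 := by
    rw [mul_div_assoc', div_le_iff₀ (by linarith)]; linarith
  have hA32 : As ≤ 3 / 2 := by
    have h1 := bU τm hτm
    have h2 : As ≤ ‖U τm - 1‖ + 1 := by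
      have := norm_add_le (U τm - 1) 1
      simp at this; exact this
    have h3 : ρ * As * (16 / Real.sqrt k0) = As * (ρ * (16 / Real.sqrt k0)) := by ring
    have h4 : As * (ρ * (16 / Real.sqrt k0)) ≤ As * (1 / 3) := by gcongr
    linarith
  have m0 : τ0 ∈ Icc τ0 T := ⟨le_rfl, hT⟩
  constructor
  · refine (bU τ0 m0).trans ?_
    calc ρ * As * (16 / Real.sqrt k0) ≤ ρ * (3 / 2) * (16 / Real.sqrt k0) := by gcongr
      _ = 24 * ρ / Real.sqrt k0 := by ring
  · have hw := bW τ0 m0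
    have hNe : N τ0 = ‖pw a (zl x τ0)‖ ^ 2 := normSq_eq_norm_sq _
    have hp : 0 < ‖pw a (zl x τ0)‖ := norm_pos_iff.2 (pw_ne a (zl x τ0))
    simp only [hW, norm_mul] at hw
    rw [hNe] at hw
    rw [norm_div, div_le_iff₀ hp]
    have hg := hγ0 τ0 le_rfl
    have e1 : ‖y1 (zl x τ0) - qw a (zl x τ0) * y (zl x τ0)‖ ≤ ρ * As * γ τ0 * ‖pw a (zl x τ0)‖ := by
      refine le_of_mul_le_mul_left ?_ hp
      linarith
    refine e1.trans ?_
    have : 3 / 2 * ρ / (1 + k0 * τ0) = ρ * (3 / 2) * γ τ0 := by simp only [hγ, hk0]; ring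
    rw [this]
    gcongr

end CubicPT

namespace CubicPT
open Topology Set

/-- WKB bound at a point -/
def Bnd (a ρ : ℝ) (y y1 : ℂ) (z : ℂ) : Prop :=
  ‖y / pw a z - 1‖ ≤ 24 * ρ / Real.sqrt (ks z) ∧
    ‖(y1 - qw a z * y) / pw a z‖ ≤ 3 / 2 * ρ / (1 + ks z * z.im)

lemma Bnd.closed {a ρ : ℝ} {z : ℂ} {y y1 : ℕ → ℂ} {w w1 : ℂ} (h : ∀ᶠ n in atTop, Bnd a ρ (y n) (y1 n) z)
    (hy : Tendsto y atTop (𝓝 w)) (hy1 : Tendsto y1 atTop (𝓝 w1)) : Bnd a ρ w w1 z := by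
  constructor
  · exact le_of_tendsto ((hy.div_const _).sub_const 1).norm (h.mono fun n hn => hn.1)
  · exact le_of_tendsto ((hy1.sub (hy.const_mul _)).div_const _).norm (h.mono fun n hn => hn.2)

lemma Bnd.norm {a ρ : ℝ} {z y y1 : ℂ} (h : Bnd a ρ y y1 z) (hρ : 0 < ρ) (hk : (48 * ρ) ^ 2 ≤ ks z)
    (hz : 0 ≤ z.im) :
    ‖y / pw a z - 1‖ ≤ 1 / 2 ∧ ‖y‖ ≤ 2 * ‖pw a z‖ ∧ ‖y1‖ ≤ 2 * (‖qw a z‖ + ρ) * ‖pw a z‖ := by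
  have hκ : 48 * ρ ≤ Real.sqrt (ks z) := Real.le_sqrt_of_sq_le hk
  have h1 : ‖y / pw a z - 1‖ ≤ 1 / 2 := by
    refine h.1.trans ?_
    rw [div_le_iff₀ (by linarith)]; linarith
  have hp : 0 < ‖pw a z‖ := norm_pos_iff.2 (pw_ne a z)
  have h2 : ‖y‖ ≤ 2 * ‖pw a z‖ := by
    have e := norm_add_le (y / pw a z - 1) 1
    simp only [sub_add_cancel, norm_one, norm_div] at e
    have : ‖y‖ / ‖pw a z‖ ≤ 2 := by linarith
    rwa [div_le_iff₀ hp] at this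
  refine ⟨h1, h2, ?_⟩
  have h3 : ‖(y1 - qw a z * y) / pw a z‖ ≤ 3 / 2 * ρ := by
    refine h.2.trans (div_le_self (by linarith) ?_)
    have : 0 ≤ ks z := by unfold ks; positivity
    have : 0 ≤ ks z * z.im := by positivity
    linarith
  rw [norm_div, div_le_iff₀ hp] at h3
  have h4 := norm_add_le (y1 - qw a z * y) (qw a z * y)
  rw [sub_add_cancel, norm_mul] at h4
  have h5 : ‖qw a z‖ * ‖y‖ ≤ ‖qw a z‖ * (2 * ‖pw a z‖) := by gcongr
  nlinarith [mul_pos hρ hp]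

lemma exists_start (ρ x : ℝ) (hx : 0 ≤ x) (hρ : 0 < ρ) :
    ∃ τ0 : ℝ, 0 ≤ τ0 ∧ (48 * ρ) ^ 2 ≤ ks (zl x τ0) := by
  refine ⟨(2 * (48 * ρ) ^ 2) ^ 2, by positivity, ?_⟩
  unfold ks
  simp only [zl_re, zl_im]
  rw [le_div_iff₀ (by norm_num)]
  apply Real.le_sqrt_of_sq_le
  nlinarith

/-- coefficient bound from a bound at one point -/
lemma coeff_bound (a ρ K : ℝ) (z : ℂ) (hρ : 0 < ρ) (hk : (48 * ρ) ^ 2 ≤ ks z) (hz : 0 ≤ z.im) :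
    ∃ M : ℝ, ∀ l α β : ℂ, ‖l‖ ≤ K → Bnd a ρ (sol a l α β z) (sol' a l α β z) z → ‖(α, β)‖ ≤ M := by
  have hc : IsCompact (Metric.closedBall (0:ℂ) K) := isCompact_closedBall 0 K
  have bd : ∀ F : ℂ → ℂ, Continuous F → ∃ M : ℝ, 0 ≤ M ∧ ∀ l, ‖l‖ ≤ K → ‖F l‖ ≤ M := by
    intro F hF
    obtain ⟨M, hM⟩ := hc.exists_bound_of_continuousOn hF.continuousOn
    exact ⟨max M 0, le_max_right _ _, fun l hl => (hM l (by simpa using hl)).trans (le_max_left _ _)⟩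
  have c1 : ∀ A B : ℂ, ‖A‖ ≤ 1 → ‖B‖ ≤ 1 → Continuous (fun l => ph a A B l z) := fun A B hA hB =>
    (ph_cont (a := a) hA hB).comp (f := fun l : ℂ => (l, z)) (by fun_prop)
  have c2 : ∀ A B : ℂ, ‖A‖ ≤ 1 → ‖B‖ ≤ 1 → Continuous (fun l => ph' a A B l z) := fun A B hA hB =>
    (ph'_cont (a := a) hA hB).comp (f := fun l : ℂ => (l, z)) (by fun_prop)
  obtain ⟨M1, p1, h1⟩ := bd _ (c1 1 0 (by simp) (by simp))
  obtain ⟨M2, p2, h2⟩ := bd _ (c1 0 1 (by simp) (by simp))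
  obtain ⟨M3, p3, h3⟩ := bd _ (c2 1 0 (by simp) (by simp))
  obtain ⟨M4, p4, h4⟩ := bd _ (c2 0 1 (by simp) (by simp))
  set Y := 2 * ‖pw a z‖
  set Z := 2 * (‖qw a z‖ + ρ) * ‖pw a z‖
  refine ⟨max (Y * M4 + Z * M2) (Y * M3 + Z * M1), ?_⟩
  intro l α β hl hB
  obtain ⟨-, b1, b2⟩ := hB.norm hρ hk hz
  have hw := ph_wronsk a l z
  have e1 : α = sol a l α β z * ph' a 0 1 l z - sol' a l α β z * ph a 0 1 l z := by
    unfold sol sol'; linear_combination -α * hw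
  have e2 : β = sol' a l α β z * ph a 1 0 l z - sol a l α β z * ph' a 1 0 l z := by
    unfold sol sol'; linear_combination -β * hw
  have hY : 0 ≤ Y := by positivity
  have hZ : 0 ≤ Z := by positivity
  rw [Prod.norm_def]
  refine max_le_max ?_ ?_
  · dsimp only
    rw [e1]
    refine (norm_sub_le _ _).trans ?_
    rw [norm_mul, norm_mul]
    gcongr
    · exact h4 l hl
    · exact h2 l hl
  · dsimp only
    rw [e2]
    refine (norm_sub_le _ _).trans ?_
    rw [norm_mul, norm_mul, add_comm]
    gcongr
    · exact h3 l hl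
    · exact h1 l hl

/-- canonical solution on the line `Re z = x` -/
lemma canon {a x ρ : ℝ} {l : ℂ} (ha : 0 ≤ a) (hx : 0 ≤ x) (hρ : ‖l‖ + (a ^ 2 + a + 2) ≤ ρ) :
    ∃ y y1, IsSol a l y y1 ∧ ∀ τ, 0 ≤ τ → (48 * ρ) ^ 2 ≤ ks (zl x τ) →
      Bnd a ρ (y (zl x τ)) (y1 (zl x τ)) (zl x τ) := by
  have hρ2 : 0 < ρ := by have := norm_nonneg l; nlinarith
  obtain ⟨τ0, h0, hk0⟩ := exists_start ρ x hx hρ2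
  choose y y1 hy e1 e2 using fun n : ℕ => exists_sol a l (zl x (τ0 + n)) (pw a (zl x (τ0 + n)))
    (qw a (zl x (τ0 + n)) * pw a (zl x (τ0 + n)))
  have key : ∀ n : ℕ, ∀ τ, 0 ≤ τ → τ ≤ τ0 + n → (48 * ρ) ^ 2 ≤ ks (zl x τ) →
      Bnd a ρ (y n (zl x τ)) (y1 n (zl x τ)) (zl x τ) := by
    intro n τ h1 h2 h3
    have := wkb_T ha hx hρ h1 h2 h3 (hy n) (e1 n) (e2 n)
    unfold Bnd
    simpa only [zl_im] using this
  obtain ⟨M, hM⟩ := coeff_bound a ρ ‖l‖ (zl x τ0) hρ2 hk0 (by simpa using h0)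
  have hb : ∀ n, ((y n 0, y1 n 0) : ℂ × ℂ) ∈ Metric.closedBall (0 : ℂ × ℂ) M := by
    intro n
    rw [mem_closedBall_zero_iff]
    refine hM l _ _ le_rfl ?_
    rw [← ((hy n).eq_sol _).1, ← ((hy n).eq_sol _).2]
    exact key n τ0 h0 (by have : (0:ℝ) ≤ n := Nat.cast_nonneg n; linarith) hk0
  obtain ⟨⟨α, β⟩, -, φ, hφ, hlim⟩ := tendsto_subseq_of_bounded Metric.isBounded_closedBall hb
  refine ⟨_, _, sol_isSol a l α β, ?_⟩
  intro τ hτ hk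
  have t1 : Tendsto (fun n => y (φ n) (zl x τ)) atTop (𝓝 (sol a l α β (zl x τ))) := by
    have hc := (sol_cont a).comp (f := fun q : ℂ × ℂ => (l, q.1, q.2, zl x τ)) (by fun_prop)
    have := (hc.tendsto (α, β)).comp hlim
    refine this.congr (fun n => ?_)
    exact (((hy (φ n)).eq_sol _).1).symm
  have t2 : Tendsto (fun n => y1 (φ n) (zl x τ)) atTop (𝓝 (sol' a l α β (zl x τ))) := by
    have hc := (sol'_cont a).comp (f := fun q : ℂ × ℂ => (l, q.1, q.2, zl x τ)) (by fun_prop)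
    have := (hc.tendsto (α, β)).comp hlim
    refine this.congr (fun n => ?_)
    exact (((hy (φ n)).eq_sol _).2).symm
  refine Bnd.closed ?_ t1 t2
  have hn : Tendsto (fun n => τ0 + ((φ n : ℕ) : ℝ)) atTop atTop :=
    tendsto_atTop_add_const_left _ _ (tendsto_natCast_atTop_atTop.comp hφ.tendsto_atTop)
  filter_upwards [hn.eventually_ge_atTop τ] with n h
  exact key _ τ hτ h hk

/-- rapidly decaying -/
def Rap (f : ℝ → ℂ) : Prop := ∀ C : ℝ, ∀ᶠ t in atTop, ‖f t‖ ≤ Real.exp (-(C * (t * Real.sqrt t)))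
/-- moderate growth -/
def Modr (f : ℝ → ℂ) : Prop := ∃ C : ℝ, ∀ᶠ t in atTop, ‖f t‖ ≤ Real.exp (C * (t * Real.sqrt t))

lemma tsqrt_atTop : Tendsto (fun t : ℝ => t * Real.sqrt t) atTop atTop := by
  refine tendsto_atTop_mono' atTop ?_ tendsto_id
  filter_upwards [eventually_ge_atTop 1] with t ht
  have : 1 ≤ Real.sqrt t := Real.one_le_sqrt.2 ht
  simp only [id]; nlinarith

lemma Rap.mul {f g : ℝ → ℂ} (hf : Rap f) (hg : Modr g) : Rap (fun t => f t * g t) := by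
  intro C
  obtain ⟨D, hD⟩ := hg
  filter_upwards [hf (C + D), hD] with t h1 h2
  rw [norm_mul]
  calc _ ≤ Real.exp (-((C + D) * (t * Real.sqrt t))) * Real.exp (D * (t * Real.sqrt t)) := by gcongr
    _ = _ := by rw [← Real.exp_add]; congr 1; ring

lemma Rap.modr {f : ℝ → ℂ} (hf : Rap f) : Modr f := ⟨0, by simpa using hf 0⟩

lemma Rap.tendsto {f : ℝ → ℂ} (hf : Rap f) : Tendsto f atTop (𝓝 0) := by
  rw [tendsto_zero_iff_norm_tendsto_zero]
  have h1 : Tendsto (fun t : ℝ => Real.exp (-(1 * (t * Real.sqrt t)))) atTop (𝓝 0) := by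
    simp only [one_mul]
    exact Real.tendsto_exp_neg_atTop_nhds_zero.comp tsqrt_atTop
  exact squeeze_zero' (Eventually.of_forall fun t => norm_nonneg _) (hf 1) h1

lemma Rap.add {f g : ℝ → ℂ} (hf : Rap f) (hg : Rap g) : Rap (fun t => f t + g t) := by
  intro C
  filter_upwards [hf (C + 1), hg (C + 1), tsqrt_atTop.eventually_ge_atTop 1] with t h1 h2 h3
  have h4 : Real.exp (-((C + 1) * (t * Real.sqrt t))) ≤ Real.exp (-(C * (t * Real.sqrt t))) * (1 / 2) := by
    have e1 : Real.exp (-((C + 1) * (t * Real.sqrt t))) = Real.exp (-(C * (t * Real.sqrt t))) * Real.exp (-(t * Real.sqrt t)) := by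
      rw [← Real.exp_add]; congr 1; ring
    rw [e1]
    gcongr
    rw [Real.exp_neg, one_div]
    gcongr
    have := Real.add_one_le_exp (t * Real.sqrt t)
    linarith
  have := norm_add_le (f t) (g t)
  linarith

lemma Modr.of_le {f : ℝ → ℂ} (K : ℝ) (h : ∀ᶠ t in atTop, ‖f t‖ ≤ K * t ^ 3) : Modr f := by
  refine ⟨|K| + 3, ?_⟩
  filter_upwards [h, eventually_ge_atTop 1] with t h1 h2
  have hs : 1 ≤ Real.sqrt t := Real.one_le_sqrt.2 h2
  have hE : t ≤ t * Real.sqrt t := by nlinarith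
  have e1 : t ^ 3 ≤ Real.exp (3 * (t * Real.sqrt t)) := by
    have e2 : t ≤ Real.exp (t * Real.sqrt t) := by
      have := Real.add_one_le_exp (t * Real.sqrt t); linarith
    calc t ^ 3 ≤ (Real.exp (t * Real.sqrt t)) ^ 3 := by gcongr
      _ = _ := by rw [← Real.exp_nat_mul]; norm_num
  have e3 : |K| ≤ Real.exp (|K| * (t * Real.sqrt t)) := by
    have a1 := Real.add_one_le_exp (|K| * (t * Real.sqrt t))
    have a2 : |K| * 1 ≤ |K| * (t * Real.sqrt t) := by gcongr; linarith
    linarith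
  calc ‖f t‖ ≤ K * t ^ 3 := h1
    _ ≤ |K| * t ^ 3 := by gcongr; exact le_abs_self K
    _ ≤ Real.exp (|K| * (t * Real.sqrt t)) * Real.exp (3 * (t * Real.sqrt t)) := by gcongr
    _ = _ := by rw [← Real.exp_add]; congr 1; ring

lemma zl_norm_le {x t : ℝ} (ht : 1 ≤ t) : ‖zl x t‖ ≤ (|x| + 1) * t := by
  have := norm_add_le (x : ℂ) (t * I)
  simp only [norm_mul, Complex.norm_real, norm_I, mul_one, Real.norm_eq_abs, abs_of_nonneg (by linarith : 0 ≤ t)] at this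
  unfold zl
  have := abs_nonneg x
  nlinarith

lemma pw_rap {a x : ℝ} (ha : 0 ≤ a) (hx : 0 ≤ x) : Rap (fun t => pw a (zl x t)) := by
  -- N(t) exp(2/5 t^2 sqrt t) antitone on t>=1
  set N : ℝ → ℝ := fun t => normSq (pw a (zl x t)) * Real.exp (2 / 5 * (t ^ 2 * Real.sqrt t)) with hN
  have dN : ∀ t : ℝ, 0 < t → HasDerivAt N ((-2 * (qw a (zl x t)).im + t * Real.sqrt t) * N t) t := by
    intro t ht
    have hz : zl x t ≠ 0 := fun h => by have := congrArg Complex.im h; simp at this; linarith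
    have hs : 0 < Real.sqrt t := Real.sqrt_pos.2 ht
    have d1 := hd_normSq (hd_vert (pw_hasDeriv a (slit_of (z := zl x t) (by simpa using hx) hz)))
    have d2 := (((hasDerivAt_pow 2 t).fun_mul (Real.hasDerivAt_sqrt ht.ne')).const_mul (2 / 5)).exp
    refine (d1.fun_mul d2).congr_deriv ?_
    rw [show qw a (zl x t) * pw a (zl x t) * I * (starRingEnd ℂ) (pw a (zl x t)) =
      (pw a (zl x t) * (starRingEnd ℂ) (pw a (zl x t))) * (qw a (zl x t) * I) by ring,
      Complex.mul_conj, Complex.re_ofReal_mul]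
    simp only [hN, Complex.mul_I_re]
    have e : t ^ 2 * (1 / (2 * Real.sqrt t)) = t * Real.sqrt t / 2 := by
      have := Real.sq_sqrt ht.le
      field_simp
      nlinarith
    rw [e]
    push_cast
    ring
  have anti : AntitoneOn N (Ici 1) := by
    refine antitoneOn_of_hasDerivWithinAt_nonpos (convex_Ici 1)
      (fun t ht => (dN t (by have : (1:ℝ) ≤ t := ht; linarith)).continuousAt.continuousWithinAt)
      (fun t ht => (dN t (by rw [interior_Ici] at ht; have : (1:ℝ) < t := ht; linarith)).hasDerivWithinAt) ?_
    intro t ht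
    rw [interior_Ici] at ht
    have ht1 : (1:ℝ) < t := ht
    have hz : zl x t ≠ 0 := fun h => by have := congrArg Complex.im h; simp at this; linarith
    have hq := qw_im (a := a) ha (z := zl x t) (by simpa using hx) (by simp; linarith) hz
    rw [zl_im] at hq
    have hk : Real.sqrt t / 2 ≤ ks (zl x t) := by
      unfold ks; simp only [zl_re, zl_im]; gcongr; linarith
    have : 0 ≤ N t := mul_nonneg (normSq_nonneg _) (Real.exp_pos _).le
    have h2 : Real.sqrt t / 2 * t ≤ ks (zl x t) * t := by gcongr
    nlinarith
  intro C
  set D := 2 * (|C| + |Real.log (N 1)|) with hD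
  have hD0 : 0 ≤ D := by positivity
  have hev : ∀ᶠ t : ℝ in atTop, 5 * D ≤ t := eventually_ge_atTop _
  filter_upwards [hev, eventually_ge_atTop 1] with t h1 h2
  have h3 := anti (mem_Ici.2 le_rfl) (mem_Ici.2 h2) h2
  have hN1 : 0 < N 1 := mul_pos (normSq_pos.2 (pw_ne _ _)) (Real.exp_pos _)
  have h4 : N 1 ≤ Real.exp |Real.log (N 1)| := by
    conv_lhs => rw [← Real.exp_log hN1]
    exact Real.exp_le_exp.2 (le_abs_self _)
  have hs : 1 ≤ Real.sqrt t := Real.one_le_sqrt.2 h2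
  set E := t * Real.sqrt t with hE
  have hE1 : 1 ≤ E := by nlinarith
  have h5 : normSq (pw a (zl x t)) ≤ Real.exp (-(2 * (C * E))) := by
    have e1 : normSq (pw a (zl x t)) = N t * Real.exp (-(2 / 5 * (t ^ 2 * Real.sqrt t))) := by
      simp only [hN]; rw [mul_assoc, ← Real.exp_add]; simp
    rw [e1]
    calc N t * Real.exp (-(2 / 5 * (t ^ 2 * Real.sqrt t))) ≤
        Real.exp |Real.log (N 1)| * Real.exp (-(2 / 5 * (t ^ 2 * Real.sqrt t))) := by gcongr; linarith
      _ = Real.exp (|Real.log (N 1)| - 2 / 5 * (t * E)) := by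
        rw [← Real.exp_add]; congr 1; simp only [hE]; ring
      _ ≤ _ := by
        apply Real.exp_le_exp.2
        have b1 : 5 * D * E ≤ t * E := by gcongr
        have b2 : C * E ≤ |C| * E := by gcongr; exact le_abs_self C
        have b3 : |Real.log (N 1)| * 1 ≤ |Real.log (N 1)| * E := by gcongr
        have b4 : 0 ≤ |C| * E := by positivity
        have b5 := abs_nonneg (Real.log (N 1))
        rw [hD] at b1
        linarith
  rw [normSq_eq_norm_sq] at h5
  have h6 : Real.exp (-(2 * (C * E))) = (Real.exp (-(C * E))) ^ 2 := by
    rw [← Real.exp_nat_mul]; congr 1; push_cast; ring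
  rw [h6] at h5
  exact le_of_sq_le_sq h5 (Real.exp_pos _).le

lemma qw_modr (a x : ℝ) : Modr (fun t => qw a (zl x t)) := by
  refine Modr.of_le ((|x| + 1) ^ 3 + |a| + 3) ?_
  filter_upwards [eventually_ge_atTop 1] with t ht
  have hz1 : 1 ≤ ‖zl x t‖ := by
    have := Complex.abs_im_le_norm (zl x t)
    simp only [zl_im, abs_of_nonneg (by linarith : 0 ≤ t)] at this; linarith
  have hz : zl x t ≠ 0 := by intro h; rw [h] at hz1; simp at hz1; linarith
  have hr := rt_norm hz
  have hr1 : 1 ≤ ‖rt (zl x t)‖ := by nlinarith [norm_nonneg (rt (zl x t))]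
  have hle := zl_norm_le (x := x) ht
  unfold qw
  have t3 : 1 ≤ t ^ 3 := one_le_pow₀ ht
  have e1 : ‖rt (zl x t) ^ 3‖ ≤ (|x| + 1) ^ 3 * t ^ 3 := by
    rw [norm_pow, ← mul_pow]
    have : ‖rt (zl x t)‖ ≤ (|x| + 1) * t := by nlinarith
    gcongr
  have e2 : ‖(a:ℂ) / (2 * rt (zl x t))‖ ≤ |a| * t ^ 3 := by
    rw [norm_div, norm_mul, Complex.norm_real, Complex.norm_ofNat, Real.norm_eq_abs]
    refine (div_le_self (abs_nonneg a) (by linarith)).trans ?_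
    exact le_mul_of_one_le_right (abs_nonneg a) t3
  have e3 : ‖(3:ℂ) / (4 * rt (zl x t) ^ 2)‖ ≤ 3 * t ^ 3 := by
    rw [norm_div, norm_mul, norm_pow, Complex.norm_ofNat, Complex.norm_ofNat]
    refine (div_le_self (by norm_num) (by nlinarith)).trans (by linarith)
  have := norm_sub_le (rt (zl x t) ^ 3 - a / (2 * rt (zl x t))) (3 / (4 * rt (zl x t) ^ 2))
  have := norm_sub_le (rt (zl x t) ^ 3) (a / (2 * rt (zl x t)))
  linarith

lemma ks_atTop (x : ℝ) : Tendsto (fun t => ks (zl x t)) atTop atTop := by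
  unfold ks
  simp only [zl_re, zl_im]
  exact (Real.tendsto_sqrt_atTop.comp (tendsto_atTop_add_const_left _ x tendsto_id)).atTop_div_const (by norm_num)

lemma Modr.const (c : ℂ) : Modr (fun _ => c) := by
  refine Modr.of_le ‖c‖ ?_
  filter_upwards [eventually_ge_atTop 1] with t ht
  exact le_mul_of_one_le_right (norm_nonneg _) (one_le_pow₀ ht)

lemma Rap.of_le {f g : ℝ → ℂ} (hg : Rap g) (h : ∀ᶠ t in atTop, ‖f t‖ ≤ ‖g t‖) : Rap f := by
  intro C; filter_upwards [h, hg C] with t h1 h2 using h1.trans h2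

lemma canon_rap {a x ρ : ℝ} (ha : 0 ≤ a) (hx : 0 ≤ x) (hρ : 0 < ρ) {y y1 : ℂ → ℂ}
    (h : ∀ τ, 0 ≤ τ → (48 * ρ) ^ 2 ≤ ks (zl x τ) → Bnd a ρ (y (zl x τ)) (y1 (zl x τ)) (zl x τ)) :
    Rap (fun t => y (zl x t)) ∧ Rap (fun t => y1 (zl x t)) := by
  have hp := pw_rap (a := a) ha hx
  have hp2 : Rap (fun t => pw a (zl x t) * 2) := hp.mul (Modr.const 2)
  have hpq : Rap (fun t => (pw a (zl x t) * 2) * qw a (zl x t)) := hp2.mul (qw_modr a x)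
  have hpr : Rap (fun t => (pw a (zl x t) * 2) * (ρ : ℂ)) := hp2.mul (Modr.const _)
  constructor
  · refine hp2.of_le ?_
    filter_upwards [eventually_ge_atTop 0, (ks_atTop x).eventually_ge_atTop ((48 * ρ) ^ 2)] with t h1 h2
    obtain ⟨-, b1, b2⟩ := (h t h1 h2).norm hρ h2 (by simpa using h1)
    rw [norm_mul, Complex.norm_ofNat]; linarith
  · intro C
    filter_upwards [eventually_ge_atTop 0, (ks_atTop x).eventually_ge_atTop ((48 * ρ) ^ 2),
      hpq (C + 1), hpr (C + 1), tsqrt_atTop.eventually_ge_atTop 1] with t h1 h2 h3 h4 h5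
    obtain ⟨-, b1, b2⟩ := (h t h1 h2).norm hρ h2 (by simpa using h1)
    rw [norm_mul, norm_mul, Complex.norm_ofNat] at h3 h4
    rw [Complex.norm_real, Real.norm_eq_abs, abs_of_pos hρ] at h4
    have h4' : Real.exp (-((C + 1) * (t * Real.sqrt t))) ≤ Real.exp (-(C * (t * Real.sqrt t))) * (1 / 2) := by
      have e1 : Real.exp (-((C + 1) * (t * Real.sqrt t))) = Real.exp (-(C * (t * Real.sqrt t))) * Real.exp (-(t * Real.sqrt t)) := by
        rw [← Real.exp_add]; congr 1; ring
      rw [e1]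
      gcongr
      rw [Real.exp_neg, one_div]
      gcongr
      have := Real.add_one_le_exp (t * Real.sqrt t)
      linarith
    linarith

end CubicPT

namespace CubicPT
open Topology Set

lemma V_norm_le {a : ℝ} {l : ℂ} {x X t : ℝ} (hX : |x| ≤ X) (ht : 1 ≤ t) :
    ‖V a l (zl x t)‖ ≤ ((X + 1) ^ 3 + |a| * (X + 1) + ‖l‖) * t ^ 3 := by
  have h0 := zl_norm_le (x := x) ht
  have h1 : ‖zl x t‖ ≤ (X + 1) * t := h0.trans (by gcongr)
  have hX0 : 0 ≤ X := (abs_nonneg x).trans hX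
  unfold V
  have t3 : 1 ≤ t ^ 3 := one_le_pow₀ ht
  have t13 : t ≤ t ^ 3 := by nlinarith [mul_nonneg (by linarith : 0 ≤ t) (by nlinarith : 0 ≤ t^2 - 1)]
  calc ‖zl x t ^ 3 - a * zl x t + l‖ ≤ ‖zl x t ^ 3‖ + ‖(a:ℂ) * zl x t‖ + ‖l‖ :=
        (norm_add_le _ _).trans (by gcongr; exact norm_sub_le _ _)
    _ = ‖zl x t‖ ^ 3 + |a| * ‖zl x t‖ + ‖l‖ := by
        rw [norm_pow, norm_mul, Complex.norm_real, Real.norm_eq_abs]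
    _ ≤ ((X + 1) * t) ^ 3 + |a| * ((X + 1) * t) + ‖l‖ := by gcongr
    _ ≤ ((X + 1) * t) ^ 3 + |a| * ((X + 1) * t ^ 3) + ‖l‖ * t ^ 3 := by
        gcongr
        exact le_mul_of_one_le_right (norm_nonneg _) t3
    _ = _ := by ring

/-- horizontal Gronwall -/
lemma hgron {a : ℝ} {l : ℂ} {y y1 : ℂ → ℂ} (hy : IsSol a l y y1) (x0 x : ℝ) : ∃ K : ℝ, ∀ t : ℝ, 1 ≤ t →
    t ^ 3 * normSq (y (zl x t)) + normSq (y1 (zl x t)) ≤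
      (t ^ 3 * normSq (y (zl x0 t)) + normSq (y1 (zl x0 t))) * Real.exp (K * (t * Real.sqrt t)) := by
  set X := max |x0| |x| with hXd
  set C := (X + 1) ^ 3 + |a| * (X + 1) + ‖l‖ with hC
  have hX0 : 0 ≤ X := le_max_of_le_left (abs_nonneg _)
  have hC0 : 0 ≤ C := by positivity
  refine ⟨(1 + C) * |x - x0|, ?_⟩
  intro t ht
  set E := t * Real.sqrt t with hE
  have hE2 : E ^ 2 = t ^ 3 := by
    rw [hE, mul_pow, Real.sq_sqrt (by linarith)]; ring
  have hE0 : 0 ≤ E := by positivity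
  set N : ℝ → ℝ := fun u => t ^ 3 * normSq (y (zl u t)) + normSq (y1 (zl u t)) with hN
  set N' : ℝ → ℝ := fun u => t ^ 3 * (2 * (y1 (zl u t) * (starRingEnd ℂ) (y (zl u t))).re) +
    2 * (V a l (zl u t) * y (zl u t) * (starRingEnd ℂ) (y1 (zl u t))).re with hN'
  have dN : ∀ u, HasDerivAt N (N' u) u := fun u =>
    ((hd_normSq (hd_horiz (hy.1 (zl u t)))).const_mul (t ^ 3)).fun_add (hd_normSq (hd_horiz (hy.2 (zl u t))))
  have bN : ∀ u, |u| ≤ X → |N' u| ≤ (1 + C) * E * N u := by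
    intro u hu
    have hV : ‖V a l (zl u t)‖ ≤ C * t ^ 3 := V_norm_le hu ht
    have b1 : |(y1 (zl u t) * (starRingEnd ℂ) (y (zl u t))).re| ≤ ‖y1 (zl u t)‖ * ‖y (zl u t)‖ := by
      refine (Complex.abs_re_le_norm _).trans ?_
      rw [norm_mul, RCLike.norm_conj]
    have b2 : |(V a l (zl u t) * y (zl u t) * (starRingEnd ℂ) (y1 (zl u t))).re| ≤
        C * t ^ 3 * (‖y1 (zl u t)‖ * ‖y (zl u t)‖) := by
      refine (Complex.abs_re_le_norm _).trans ?_
      rw [norm_mul, norm_mul, RCLike.norm_conj, mul_assoc, mul_comm ‖y (zl u t)‖]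
      gcongr
    have b3 : |N' u| ≤ t ^ 3 * (2 * (‖y1 (zl u t)‖ * ‖y (zl u t)‖)) + 2 * (C * t ^ 3 * (‖y1 (zl u t)‖ * ‖y (zl u t)‖)) := by
      refine (abs_add_le _ _).trans ?_
      rw [abs_mul, abs_mul, abs_mul, abs_of_nonneg (by positivity : 0 ≤ t ^ 3), abs_of_pos (by norm_num : (0:ℝ) < 2)]
      gcongr
    refine b3.trans ?_
    simp only [hN, normSq_eq_norm_sq]
    rw [← hE2]
    have := sq_nonneg (E * ‖y (zl u t)‖ - ‖y1 (zl u t)‖)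
    have h2 : 2 * E * (‖y1 (zl u t)‖ * ‖y (zl u t)‖) ≤ E ^ 2 * ‖y (zl u t)‖ ^ 2 + ‖y1 (zl u t)‖ ^ 2 := by nlinarith
    have h3 : (1 + C) * E * (2 * E * (‖y1 (zl u t)‖ * ‖y (zl u t)‖)) ≤ (1 + C) * E * (E ^ 2 * ‖y (zl u t)‖ ^ 2 + ‖y1 (zl u t)‖ ^ 2) := by gcongr
    linarith
  set L := (1 + C) * E with hL
  change N x ≤ N x0 * Real.exp ((1 + C) * |x - x0| * E)
  rw [show (1 + C) * |x - x0| * E = L * |x - x0| by rw [hL]; ring]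
  rcases le_total x0 x with h | h
  · have anti : AntitoneOn (fun u => N u * Real.exp (-(L * u))) (Icc x0 x) := by
      refine antitoneOn_of_hasDerivWithinAt_nonpos (f' := fun u => (N' u - L * N u) * Real.exp (-(L * u)))
        (convex_Icc x0 x) ?_ ?_ ?_
      · intro u hu
        exact (((dN u).fun_mul (((hasDerivAt_id u).const_mul L).fun_neg.exp)).continuousAt).continuousWithinAt
      · intro u hu
        refine (((dN u).fun_mul (((hasDerivAt_id u).const_mul L).fun_neg.exp)).congr_deriv ?_).hasDerivWithinAt
        simp only [id]; ring
      · intro u hu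
        rw [interior_Icc] at hu
        have hb := bN u (by rw [hXd, abs_le]; constructor
                            · have := neg_abs_le x0; have := le_max_left |x0| |x|; linarith [hu.1]
                            · have := le_abs_self x; have := le_max_right |x0| |x|; linarith [hu.2])
        have := le_abs_self (N' u)
        exact mul_nonpos_of_nonpos_of_nonneg (by linarith) (Real.exp_pos _).le
    have := anti (left_mem_Icc.2 h) (right_mem_Icc.2 h) h
    dsimp only at this
    rw [abs_of_nonneg (by linarith)]
    have e1 : N x = N x * Real.exp (-(L * x)) * Real.exp (L * x) := by
      rw [mul_assoc, ← Real.exp_add]; simp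
    rw [e1]
    calc _ ≤ N x0 * Real.exp (-(L * x0)) * Real.exp (L * x) := by gcongr
      _ = _ := by rw [mul_assoc, ← Real.exp_add]; congr 2; ring
  · have mono : MonotoneOn (fun u => N u * Real.exp (L * u)) (Icc x x0) := by
      refine monotoneOn_of_hasDerivWithinAt_nonneg (f' := fun u => (N' u + L * N u) * Real.exp (L * u))
        (convex_Icc x x0) ?_ ?_ ?_
      · intro u hu
        exact (((dN u).fun_mul (((hasDerivAt_id u).const_mul L).exp)).continuousAt).continuousWithinAt
      · intro u hu
        refine (((dN u).fun_mul (((hasDerivAt_id u).const_mul L).exp)).congr_deriv ?_).hasDerivWithinAt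
        simp only [id]; ring
      · intro u hu
        rw [interior_Icc] at hu
        have hb := bN u (by rw [hXd, abs_le]; constructor
                            · have := neg_abs_le x; have := le_max_right |x0| |x|; linarith [hu.1]
                            · have := le_abs_self x0; have := le_max_left |x0| |x|; linarith [hu.2])
        have := neg_abs_le (N' u)
        exact mul_nonneg (by linarith) (Real.exp_pos _).le
    have := mono (left_mem_Icc.2 h) (right_mem_Icc.2 h) h
    dsimp only at this
    rw [abs_of_nonpos (by linarith)]
    have e1 : N x = N x * Real.exp (L * x) * Real.exp (-(L * x)) := by
      rw [mul_assoc, ← Real.exp_add]; simp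
    rw [e1]
    calc _ ≤ N x0 * Real.exp (L * x0) * Real.exp (-(L * x)) := by gcongr
      _ = _ := by rw [mul_assoc, ← Real.exp_add]; congr 2; ring

lemma hshift {a : ℝ} {l : ℂ} {y y1 : ℂ → ℂ} (hy : IsSol a l y y1) {x0 : ℝ}
    (h0 : Rap (fun t => y (zl x0 t))) (h1 : Rap (fun t => y1 (zl x0 t))) (x : ℝ) :
    Rap (fun t => y (zl x t)) ∧ Rap (fun t => y1 (zl x t)) := by
  obtain ⟨K, hK⟩ := hgron hy x0 x
  have key : ∀ C : ℝ, ∀ᶠ t : ℝ in atTop, t ^ 3 * normSq (y (zl x t)) + normSq (y1 (zl x t)) ≤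
      (Real.exp (-(C * (t * Real.sqrt t)))) ^ 2 := by
    intro C
    have h0' : Rap (fun t => y (zl x0 t) * ((t:ℂ) ^ 3)) := h0.mul (Modr.of_le 1 (by
      filter_upwards [eventually_ge_atTop 0] with t ht
      rw [norm_pow, Complex.norm_real, Real.norm_eq_abs, abs_of_nonneg ht, one_mul]))
    filter_upwards [h0' (C + |K| + 1), h1 (C + |K| + 1), eventually_ge_atTop 1,
      tsqrt_atTop.eventually_ge_atTop 1] with t a0 a1 ht hE
    set E := t * Real.sqrt t with hEd
    have t3 : 1 ≤ t ^ 3 := one_le_pow₀ ht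
    rw [norm_mul, norm_pow, Complex.norm_real, Real.norm_eq_abs, abs_of_nonneg (by linarith)] at a0
    have e1 : t ^ 3 * normSq (y (zl x0 t)) + normSq (y1 (zl x0 t)) ≤ 2 * (Real.exp (-((C + |K| + 1) * E))) ^ 2 := by
      rw [normSq_eq_norm_sq, normSq_eq_norm_sq]
      have b1 : t ^ 3 * ‖y (zl x0 t)‖ ^ 2 ≤ (‖y (zl x0 t)‖ * t ^ 3) ^ 2 := by
        rw [mul_pow, mul_comm]; gcongr
        exact le_self_pow₀ t3 (by norm_num)
      have b2 : (‖y (zl x0 t)‖ * t ^ 3) ^ 2 ≤ (Real.exp (-((C + |K| + 1) * E))) ^ 2 := by gcongr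
      have b3 : ‖y1 (zl x0 t)‖ ^ 2 ≤ (Real.exp (-((C + |K| + 1) * E))) ^ 2 := by gcongr
      linarith
    refine (hK t ht).trans ((mul_le_mul_of_nonneg_right e1 (Real.exp_pos _).le).trans ?_)
    rw [← Real.exp_nat_mul, ← Real.exp_nat_mul]
    push_cast
    have e2 : (2:ℝ) ≤ Real.exp E := by have := Real.add_one_le_exp E; linarith
    calc 2 * Real.exp (2 * (-((C + |K| + 1) * E))) * Real.exp (K * E) ≤
        Real.exp E * Real.exp (2 * (-((C + |K| + 1) * E))) * Real.exp (K * E) := by gcongr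
      _ = Real.exp (E + 2 * (-((C + |K| + 1) * E)) + K * E) := by rw [← Real.exp_add, ← Real.exp_add]
      _ ≤ _ := by
        apply Real.exp_le_exp.2
        have c1 : K * E ≤ |K| * E := by gcongr; exact le_abs_self K
        have c2 : 0 ≤ |K| * E := by positivity
        nlinarith
  constructor
  · intro C
    filter_upwards [key C, eventually_ge_atTop 1] with t h ht
    have t3 : 1 ≤ t ^ 3 := one_le_pow₀ ht
    refine le_of_sq_le_sq ?_ (Real.exp_pos _).le
    rw [normSq_eq_norm_sq, normSq_eq_norm_sq] at h
    have : ‖y (zl x t)‖ ^ 2 ≤ t ^ 3 * ‖y (zl x t)‖ ^ 2 := le_mul_of_one_le_left (by positivity) t3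
    have := sq_nonneg ‖y1 (zl x t)‖
    linarith
  · intro C
    filter_upwards [key C, eventually_ge_atTop 1] with t h ht
    refine le_of_sq_le_sq ?_ (Real.exp_pos _).le
    rw [normSq_eq_norm_sq, normSq_eq_norm_sq] at h
    have : 0 ≤ t ^ 3 * ‖y (zl x t)‖ ^ 2 := by positivity
    linarith

/-- bounded solution has moderate derivative -/
lemma bdd_deriv_modr {a : ℝ} {l : ℂ} {y y1 : ℂ → ℂ} (hy : IsSol a l y y1) {x : ℝ}
    (h : Tendsto (fun t => y (zl x t)) atTop (𝓝 0)) : Modr (fun t => y1 (zl x t)) := by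
  set C := (|x| + 1) ^ 3 + |a| * (|x| + 1) + ‖l‖ with hC
  have hC0 : 0 ≤ C := by positivity
  have h1 : ∀ᶠ t in atTop, ‖y (zl x t)‖ ≤ 1 := by
    have := h.norm; rw [norm_zero] at this
    exact (this.eventually (gt_mem_nhds one_pos)).mono fun t ht => le_of_lt ht
  obtain ⟨t0, ht0⟩ := eventually_atTop.1 h1
  refine Modr.of_le (2 + 8 * C) ?_
  filter_upwards [eventually_ge_atTop (max t0 1)] with t ht
  have htt0 : t0 ≤ t := (le_max_left _ _).trans ht
  have ht1 : 1 ≤ t := (le_max_right _ _).trans ht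
  have b2 : ∀ s ∈ Icc t (t + 1), ‖y1 (zl x s) - y1 (zl x t)‖ ≤ 8 * C * t ^ 3 * (s - t) := by
    refine norm_image_sub_le_of_norm_deriv_le_segment' (f' := fun s => V a l (zl x s) * y (zl x s) * I)
      (fun s hs => (hd_vert (hy.2 (zl x s))).hasDerivWithinAt) ?_
    intro s hs
    rw [norm_mul, norm_mul, norm_I, mul_one]
    have hv := V_norm_le (a := a) (l := l) (x := x) (X := |x|) le_rfl (t := s) (by linarith [hs.1])
    rw [← hC] at hv
    have hs0 : 0 ≤ s := by linarith [hs.1]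
    calc ‖V a l (zl x s)‖ * ‖y (zl x s)‖ ≤ (C * s ^ 3) * 1 :=
          mul_le_mul hv (ht0 s (htt0.trans hs.1)) (norm_nonneg _) (by positivity)
      _ ≤ (C * (2 * t) ^ 3) * 1 := by
          have h1 : s ≤ 2 * t := by linarith [hs.2]
          have h2 : 0 ≤ s := by linarith [hs.1]
          gcongr
      _ = _ := by ring
  have b3 : ∀ s ∈ Icc t (t + 1), ‖(y (zl x s) - y1 (zl x t) * I * s) - (y (zl x t) - y1 (zl x t) * I * t)‖ ≤ 8 * C * t ^ 3 * (s - t) := by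
    refine norm_image_sub_le_of_norm_deriv_le_segment' (f := fun s : ℝ => y (zl x s) - y1 (zl x t) * I * s)
      (f' := fun s => y1 (zl x s) * I - y1 (zl x t) * I)
      (fun s hs => ?_) ?_
    · have := ((hasDerivAt_id (s:ℂ)).const_mul (y1 (zl x t) * I)).comp_ofReal
      simp only [id, mul_one] at this
      exact ((hd_vert (hy.1 (zl x s))).fun_sub this).hasDerivWithinAt
    · intro s hs
      rw [← sub_mul, norm_mul, norm_I, mul_one]
      refine (b2 s ⟨hs.1, hs.2.le⟩).trans ?_
      have : s - t ≤ 1 := by linarith [hs.2]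
      exact mul_le_of_le_one_right (by positivity) this
  have b4 := b3 (t + 1) ⟨by linarith, le_rfl⟩
  have e1 : y1 (zl x t) * I = (y (zl x (t + 1)) - y (zl x t)) - ((y (zl x (t+1)) - y1 (zl x t) * I * ((t + 1 : ℝ):ℂ)) - (y (zl x t) - y1 (zl x t) * I * t)) := by
    push_cast; ring
  have e2 : ‖y1 (zl x t)‖ = ‖y1 (zl x t) * I‖ := by rw [norm_mul, norm_I, mul_one]
  have t3 : 1 ≤ t ^ 3 := one_le_pow₀ ht1
  rw [e2, e1]
  refine (norm_sub_le _ _).trans ?_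
  have := norm_sub_le (y (zl x (t + 1))) (y (zl x t))
  have := ht0 t htt0
  have := ht0 (t + 1) (by linarith)
  have e3 : 8 * C * t ^ 3 * (t + 1 - t) = 8 * C * t ^ 3 := by ring
  rw [e3] at b4
  linarith

/-- uniqueness of decaying solutions: Wronskian vanishes -/
lemma decay_wronsk {a : ℝ} {l : ℂ} {y y1 w w1 : ℂ → ℂ} (hy : IsSol a l y y1) (hw : IsSol a l w w1) {x : ℝ}
    (h0 : Rap (fun t => y (zl x t))) (h1 : Rap (fun t => y1 (zl x t)))
    (h : Tendsto (fun t => w (zl x t)) atTop (𝓝 0)) (z : ℂ) : y z * w1 z - y1 z * w z = 0 := by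
  have hm := bdd_deriv_modr hw h
  have t1 : Tendsto (fun t => y (zl x t) * w1 (zl x t) - y1 (zl x t) * w (zl x t)) atTop (𝓝 0) := by
    simpa using (h0.mul hm).tendsto.sub (h1.tendsto.mul h)
  have t2 : Tendsto (fun t => y (zl x t) * w1 (zl x t) - y1 (zl x t) * w (zl x t)) atTop
      (𝓝 (y z * w1 z - y1 z * w z)) := by
    refine tendsto_const_nhds.congr (fun t => ?_)
    exact hy.wronsk hw z (zl x t)
  exact tendsto_nhds_unique t2 t1

lemma prop_of_wronsk {a l : ℂ} {y y1 w w1 : ℂ → ℂ} (hy : IsSol a l y y1) (hw : IsSol a l w w1) {z0 : ℂ}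
    (h0 : y z0 ≠ 0) (h : ∀ z, y z * w1 z - y1 z * w z = 0) :
    (∀ z, w z = w z0 / y z0 * y z) ∧ ∀ z, w1 z = w z0 / y z0 * y1 z := by
  have := hw.eq_of_data (hy.lin hy (w z0 / y z0) 0) z0 (by field_simp; ring) (by
    have := h z0
    field_simp; linear_combination this)
  simpa using this

end CubicPT

namespace CubicPT
open Topology Set

lemma Bnd.mono {a ρ ρ' : ℝ} {y y1 z : ℂ} (h : Bnd a ρ y y1 z) (hr : ρ ≤ ρ') (hz : 0 ≤ z.im) :
    Bnd a ρ' y y1 z := by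
  have hk : 0 ≤ ks z := by unfold ks; positivity
  constructor
  · exact h.1.trans (by gcongr)
  · exact h.2.trans (by gcongr)

lemma Bnd.ne {a ρ : ℝ} {z y y1 : ℂ} (h : Bnd a ρ y y1 z) (hρ : 0 < ρ) (hk : (48 * ρ) ^ 2 ≤ ks z)
    (hz : 0 ≤ z.im) : y ≠ 0 := by
  intro h0
  have := (h.norm hρ hk hz).1
  rw [h0] at this
  norm_num at this

lemma bnd_tendsto {a x ρ : ℝ} {y y1 : ℂ → ℂ}
    (h : ∀ τ, 0 ≤ τ → (48 * ρ) ^ 2 ≤ ks (zl x τ) → Bnd a ρ (y (zl x τ)) (y1 (zl x τ)) (zl x τ)) :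
    Tendsto (fun t => y (zl x t) / pw a (zl x t)) atTop (𝓝 1) := by
  rw [tendsto_iff_norm_sub_tendsto_zero]
  have h1 : Tendsto (fun t => 24 * ρ / Real.sqrt (ks (zl x t))) atTop (𝓝 0) :=
    (Real.tendsto_sqrt_atTop.comp (ks_atTop x)).const_div_atTop _
  refine squeeze_zero' (Eventually.of_forall fun t => norm_nonneg _) ?_ h1
  filter_upwards [eventually_ge_atTop 0, (ks_atTop x).eventually_ge_atTop ((48 * ρ) ^ 2)] with t h2 h3
  exact (h t h2 h3).1

lemma canon_unique {a x ρ : ℝ} {l : ℂ} (ha : 0 ≤ a) (hx : 0 ≤ x) (hρ : 0 < ρ) {y y1 w w1 : ℂ → ℂ}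
    (hy : IsSol a l y y1) (hw : IsSol a l w w1)
    (h : ∀ τ, 0 ≤ τ → (48 * ρ) ^ 2 ≤ ks (zl x τ) → Bnd a ρ (y (zl x τ)) (y1 (zl x τ)) (zl x τ))
    (h' : ∀ τ, 0 ≤ τ → (48 * ρ) ^ 2 ≤ ks (zl x τ) → Bnd a ρ (w (zl x τ)) (w1 (zl x τ)) (zl x τ)) :
    (∀ z, w z = y z) ∧ ∀ z, w1 z = y1 z := by
  obtain ⟨r1, r2⟩ := canon_rap ha hx hρ h
  obtain ⟨s1, s2⟩ := canon_rap ha hx hρ h'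
  obtain ⟨τ0, h0, hk0⟩ := exists_start ρ x hx hρ
  have hne := (h τ0 h0 hk0).ne hρ hk0 (by simpa using h0)
  obtain ⟨p1, p2⟩ := prop_of_wronsk hy hw hne (decay_wronsk hy hw r1 r2 s1.tendsto)
  set k := w (zl x τ0) / y (zl x τ0)
  have t1 := bnd_tendsto h
  have t2 := bnd_tendsto h'
  have t3 : Tendsto (fun t => w (zl x t) / pw a (zl x t)) atTop (𝓝 (k * 1)) := by
    refine (t1.const_mul k).congr (fun t => ?_)
    rw [p1 (zl x t), mul_div_assoc]
  have hk : k = 1 := by simpa using tendsto_nhds_unique t3 t2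
  rw [hk] at p1 p2
  simpa using And.intro p1 p2

lemma link {a X ρ : ℝ} {l : ℂ} (ha : 0 ≤ a) (hX : 0 ≤ X) (hρ : ‖l‖ + (a ^ 2 + a + 2) ≤ ρ) {y y1 : ℂ → ℂ}
    (hy : IsSol a l y y1)
    (h : ∀ τ, 0 ≤ τ → (48 * ρ) ^ 2 ≤ ks (zl 0 τ) → Bnd a ρ (y (zl 0 τ)) (y1 (zl 0 τ)) (zl 0 τ)) :
    ∀ τ, 0 ≤ τ → (48 * ρ) ^ 2 ≤ ks (zl X τ) → Bnd a ρ (y (zl X τ)) (y1 (zl X τ)) (zl X τ) := by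
  have hρ2 : 2 ≤ ρ := by have := norm_nonneg l; nlinarith
  have hρ0 : 0 < ρ := by linarith
  obtain ⟨r1, r2⟩ := canon_rap ha le_rfl hρ0 h
  -- proportionality on every line
  have prop : ∀ x : ℝ, 0 ≤ x → ∃ (k : ℂ) (w w1 : ℂ → ℂ), (∀ z, y z = k * w z) ∧ (∀ z, y1 z = k * w1 z) ∧
      ∀ τ, 0 ≤ τ → (48 * ρ) ^ 2 ≤ ks (zl x τ) → Bnd a ρ (w (zl x τ)) (w1 (zl x τ)) (zl x τ) := by
    intro x hx
    obtain ⟨w, w1, hw, hb⟩ := canon (l := l) ha hx hρ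
    obtain ⟨s1, s2⟩ := canon_rap ha hx hρ0 hb
    obtain ⟨τ0, h0, hk0⟩ := exists_start ρ x hx hρ0
    have hne := (hb τ0 h0 hk0).ne hρ0 hk0 (by simpa using h0)
    have hr := hshift hy r1 r2 x
    obtain ⟨p1, p2⟩ := prop_of_wronsk hw hy hne (decay_wronsk hw hy s1 s2 hr.1.tendsto)
    exact ⟨_, w, w1, p1, p2, hb⟩
  obtain ⟨k, w, w1, e1, e2, hb⟩ := prop X hX
  suffices hk : k = 1 by
    intro τ h1 h2
    rw [e1, e2, hk]
    simpa using hb τ h1 h2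
  have t0 := bnd_tendsto h
  have tX := bnd_tendsto hb
  have tk : Tendsto (fun t => y (zl X t) / pw a (zl X t)) atTop (𝓝 k) := by
    have := (tX.const_mul k).congr (f₂ := fun t => y (zl X t) / pw a (zl X t)) (fun t => by
      rw [e1 (zl X t), mul_div_assoc])
    simpa using this
  have hdiff : Tendsto (fun t => y (zl X t) / pw a (zl X t) - y (zl 0 t) / pw a (zl 0 t)) atTop (𝓝 0) := by
    rw [tendsto_zero_iff_norm_tendsto_zero]
    have lim : Tendsto (fun t : ℝ => 3 * ρ / (1 + t) * (3 / 2 * Real.exp (3 * ρ * X)) * X) atTop (𝓝 0) := by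
      have : Tendsto (fun t : ℝ => 3 * ρ / (1 + t)) atTop (𝓝 0) :=
        (tendsto_atTop_add_const_left _ 1 tendsto_id).const_div_atTop _
      simpa using (this.mul_const (3 / 2 * Real.exp (3 * ρ * X))).mul_const X
    refine squeeze_zero' (Eventually.of_forall fun t => norm_nonneg _) ?_ lim
    filter_upwards [eventually_ge_atTop 1, (ks_atTop 0).eventually_ge_atTop ((48 * ρ) ^ 2)] with t h1 h2
    have ht0 : 0 ≤ t := by linarith
    set Q : ℝ → ℂ := fun u => y (zl u t) / pw a (zl u t) with hQ
    set Q' : ℝ → ℂ := fun u => (y1 (zl u t) - qw a (zl u t) * y (zl u t)) / pw a (zl u t) with hQ'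
    have hne0 : ∀ u, zl u t ≠ 0 := fun u h => by have := congrArg Complex.im h; simp at this; linarith
    have dQ : ∀ u, 0 ≤ u → HasDerivAt Q (Q' u) u := by
      intro u hu
      have hp := pw_ne a (zl u t)
      have e1 := (hy.1 (zl u t)).fun_div (pw_hasDeriv a (slit_of (z := zl u t) (by simpa using hu) (hne0 u))) hp
      refine (hd_horiz e1).congr_deriv ?_
      simp only [hQ']
      field_simp
    have hkk : ∀ u, 0 ≤ u → (48 * ρ) ^ 2 ≤ ks (zl u t) := fun u hu => h2.trans (by
      unfold ks; simp only [zl_re, zl_im]; gcongr)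
    set ε := 3 * ρ / (1 + t) with hε
    have hε0 : 0 ≤ ε := by positivity
    have bQ : ∀ u, 0 ≤ u → ‖Q' u‖ ≤ ε * ‖Q u‖ := by
      intro u hu
      obtain ⟨κ, v, v1, f1, f2, hv⟩ := prop u hu
      have hb1 := hv t ht0 (hkk u hu)
      have hb2 := (hb1.norm hρ0 (hkk u hu) (by simpa using ht0)).1
      have g1 : Q u = κ * (v (zl u t) / pw a (zl u t)) := by simp only [hQ]; rw [f1]; ring
      have g2 : Q' u = κ * ((v1 (zl u t) - qw a (zl u t) * v (zl u t)) / pw a (zl u t)) := by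
        simp only [hQ']; rw [f1, f2]; ring
      rw [g1, g2, norm_mul, norm_mul]
      have g3 : 1 / 2 ≤ ‖v (zl u t) / pw a (zl u t)‖ := by
        have := norm_sub_norm_le (1:ℂ) (1 - v (zl u t) / pw a (zl u t))
        rw [norm_one, sub_sub_cancel, norm_sub_rev] at this
        linarith
      have g4 := hb1.2
      rw [zl_im] at g4
      have hk1 : 1 ≤ ks (zl u t) := by have := hkk u hu; nlinarith
      have g5 : 3 / 2 * ρ / (1 + ks (zl u t) * t) ≤ ε * (1 / 2) := by
        have h7 : ε * (1 / 2) = 3 / 2 * ρ / (1 + t) := by rw [hε]; ring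
        rw [h7]
        gcongr
        nlinarith
      have g6 : ε * (1 / 2) ≤ ε * ‖v (zl u t) / pw a (zl u t)‖ := by gcongr
      have := mul_le_mul_of_nonneg_left (g4.trans (g5.trans g6)) (norm_nonneg κ)
      linarith
    have cQ : ContinuousOn Q (Icc 0 X) := fun u hu => (dQ u hu.1).continuousAt.continuousWithinAt
    have hQ0 : ‖Q 0‖ ≤ 3 / 2 := by
      have := ((h t ht0 h2).norm hρ0 h2 (by simpa using ht0)).1
      have h3 := norm_add_le (y (zl 0 t) / pw a (zl 0 t) - 1) 1
      rw [sub_add_cancel, norm_one] at h3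
      simp only [hQ]; linarith
    have gr := norm_le_gronwallBound_of_norm_deriv_right_le (f := Q) (f' := Q') (δ := 3 / 2) (K := ε) (ε := 0)
      cQ (fun u hu => (dQ u hu.1).hasDerivWithinAt) hQ0 (fun u hu => by simpa using bQ u hu.1)
    have hεle : ε ≤ 3 * ρ := div_le_self (by positivity) (by linarith)
    have gr2 : ∀ u ∈ Icc 0 X, ‖Q u‖ ≤ 3 / 2 * Real.exp (3 * ρ * X) := by
      intro u hu
      have := gr u hu
      rw [gronwallBound_ε0] at this
      refine this.trans ?_
      gcongr
      · have := hu.1; linarith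
      · have := hu.2; linarith
    have := norm_image_sub_le_of_norm_deriv_le_segment' (f := Q) (f' := Q') (a := 0) (b := X)
      (C := ε * (3 / 2 * Real.exp (3 * ρ * X)))
      (fun u hu => (dQ u hu.1).hasDerivWithinAt) (fun u hu => (bQ u hu.1).trans (by
        gcongr; exact gr2 u ⟨hu.1, hu.2.le⟩)) X ⟨hX, le_rfl⟩
    simpa using this
  have t1 : Tendsto (fun t => y (zl X t) / pw a (zl X t)) atTop (𝓝 1) := by
    simpa using hdiff.add t0
  exact tendsto_nhds_unique tk t1

/-- the canonical family -/
structure Canon (c : ℝ) (Y Y1 : ℝ → ℂ → ℂ) : Prop where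
  hc : 0 ≤ c
  sol : ∀ μ : ℝ, IsSol ((3 * c ^ 2 : ℝ) : ℂ) ((μ + 2 * c ^ 3 : ℝ) : ℂ) (Y μ) (Y1 μ)
  rap : ∀ μ x, Rap (fun t => Y μ (zl x t)) ∧ Rap (fun t => Y1 μ (zl x t))
  bnd : ∀ μ ρ : ℝ, |μ + 2 * c ^ 3| + ((3 * c ^ 2) ^ 2 + 3 * c ^ 2 + 2) ≤ ρ → ∀ z : ℂ, 0 ≤ z.re → 0 ≤ z.im →
    (48 * ρ) ^ 2 ≤ ks z → Bnd (3 * c ^ 2) ρ (Y μ z) (Y1 μ z) z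
  cont : Continuous (fun q : ℝ × ℂ => Y q.1 q.2)
  cont1 : Continuous (fun q : ℝ × ℂ => Y1 q.1 q.2)

lemma exists_canon_aux {a : ℝ} (ha : 0 ≤ a) : ∃ Y Y1 : ℂ → ℂ → ℂ, (∀ l, IsSol a l (Y l) (Y1 l)) ∧
    (∀ (l : ℂ) (ρ : ℝ), ‖l‖ + (a ^ 2 + a + 2) ≤ ρ → ∀ x τ, 0 ≤ x → 0 ≤ τ → (48 * ρ) ^ 2 ≤ ks (zl x τ) →
      Bnd a ρ (Y l (zl x τ)) (Y1 l (zl x τ)) (zl x τ)) := by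
  choose Y Y1 h1 h2 using fun l : ℂ => canon (l := l) (x := 0) ha le_rfl (le_refl (‖l‖ + (a ^ 2 + a + 2)))
  refine ⟨Y, Y1, h1, ?_⟩
  intro l ρ hρ x τ hx hτ hk
  refine Bnd.mono (link ha hx le_rfl (h1 l) (h2 l) τ hτ (le_trans ?_ hk)) hρ (by simpa using hτ)
  have := norm_nonneg l
  gcongr

lemma exists_canon {c : ℝ} (hc : 0 ≤ c) : ∃ Y Y1 : ℝ → ℂ → ℂ, Canon c Y Y1 := by
  set a : ℝ := 3 * c ^ 2 with ha'
  have ha : 0 ≤ a := by positivity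
  obtain ⟨Y, Y1, hs, hb⟩ := exists_canon_aux ha
  have coef : Continuous (fun l => (Y l 0, Y1 l 0)) := by
    rw [continuous_iff_seqContinuous]
    intro ls l hl
    refine tendsto_of_subseq_tendsto (fun ns hns => ?_)
    obtain ⟨K, hK⟩ := (Metric.isBounded_range_of_tendsto ls hl).exists_norm_le
    have hK' : ∀ n, ‖ls n‖ ≤ K := fun n => hK _ ⟨n, rfl⟩
    have hlK : ‖l‖ ≤ K := le_of_tendsto hl.norm (Eventually.of_forall hK')
    set ρ := K + (a ^ 2 + a + 2) with hρ
    have hKn : 0 ≤ K := (norm_nonneg l).trans hlK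
    have hρ0 : 0 < ρ := by rw [hρ]; positivity
    obtain ⟨τ0, h0, hk0⟩ := exists_start ρ 0 le_rfl hρ0
    obtain ⟨M, hM⟩ := coeff_bound a ρ K (zl 0 τ0) hρ0 hk0 (by simpa using h0)
    have hbd : ∀ n, ((Y (ls (ns n)) 0, Y1 (ls (ns n)) 0) : ℂ × ℂ) ∈ Metric.closedBall (0 : ℂ × ℂ) M := by
      intro n
      rw [mem_closedBall_zero_iff]
      refine hM (ls (ns n)) _ _ (hK' _) ?_
      rw [← ((hs _).eq_sol _).1, ← ((hs _).eq_sol _).2]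
      exact hb _ ρ (by have := hK' (ns n); linarith) 0 τ0 le_rfl h0 hk0
    obtain ⟨⟨α, β⟩, -, φ, hφ, hlim⟩ := tendsto_subseq_of_bounded Metric.isBounded_closedBall hbd
    refine ⟨φ, ?_⟩
    have hl2 : Tendsto (fun n => ls (ns (φ n))) atTop (𝓝 l) := hl.comp (hns.comp hφ.tendsto_atTop)
    have hall : Tendsto (fun n => (ls (ns (φ n)), (Y (ls (ns (φ n))) 0, Y1 (ls (ns (φ n))) 0))) atTop
        (𝓝 (l, (α, β))) := hl2.prodMk_nhds hlim
    have hB : ∀ τ, 0 ≤ τ → (48 * ρ) ^ 2 ≤ ks (zl 0 τ) →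
        Bnd a ρ (sol a l α β (zl 0 τ)) (sol' a l α β (zl 0 τ)) (zl 0 τ) := by
      intro τ hτ hk
      have t1 : Tendsto (fun n => Y (ls (ns (φ n))) (zl 0 τ)) atTop (𝓝 (sol a l α β (zl 0 τ))) := by
        have hcc := (sol_cont a).comp (f := fun q : ℂ × ℂ × ℂ => (q.1, q.2.1, q.2.2, zl 0 τ)) (by fun_prop)
        have := (hcc.tendsto (l, (α, β))).comp hall
        refine this.congr (fun n => ?_)
        exact (((hs _).eq_sol _).1).symm
      have t2 : Tendsto (fun n => Y1 (ls (ns (φ n))) (zl 0 τ)) atTop (𝓝 (sol' a l α β (zl 0 τ))) := by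
        have hcc := (sol'_cont a).comp (f := fun q : ℂ × ℂ × ℂ => (q.1, q.2.1, q.2.2, zl 0 τ)) (by fun_prop)
        have := (hcc.tendsto (l, (α, β))).comp hall
        refine this.congr (fun n => ?_)
        exact (((hs _).eq_sol _).2).symm
      refine Bnd.closed (Eventually.of_forall fun n => ?_) t1 t2
      exact hb _ ρ (by have := hK' (ns (φ n)); linarith) 0 τ le_rfl hτ hk
    have hu := canon_unique ha le_rfl hρ0 (hs l) (sol_isSol a l α β)
      (fun τ h1 h2 => hb l ρ (by linarith) 0 τ le_rfl h1 h2) hB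
    have e1 := hu.1 0
    have e2 := hu.2 0
    rw [sol_zero] at e1
    rw [sol'_zero] at e2
    change Tendsto _ atTop (𝓝 (Y l 0, Y1 l 0))
    rw [← e1, ← e2]
    exact hlim
  have coef1 : Continuous (fun l => Y l 0) := continuous_fst.comp coef
  have coef2 : Continuous (fun l => Y1 l 0) := continuous_snd.comp coef
  refine ⟨fun μ => Y ((μ + 2 * c ^ 3 : ℝ) : ℂ), fun μ => Y1 ((μ + 2 * c ^ 3 : ℝ) : ℂ), hc, fun μ => hs _, ?_, ?_, ?_, ?_⟩
  · intro μ x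
    refine hshift (hs _) (x0 := 0) ?_ ?_ x
    · exact (canon_rap ha le_rfl (by positivity) (fun τ h1 h2 => hb _ _ le_rfl 0 τ le_rfl h1 h2)).1
    · exact (canon_rap ha le_rfl (by positivity) (fun τ h1 h2 => hb _ _ le_rfl 0 τ le_rfl h1 h2)).2
  · intro μ ρ hρ z h1 h2 hk
    have := hb ((μ + 2 * c ^ 3 : ℝ) : ℂ) ρ (by rw [Complex.norm_real, Real.norm_eq_abs]; exact hρ) z.re z.im h1 h2
      (by rw [zl_eta]; exact hk)
    rwa [zl_eta] at this
  · have : Continuous (fun q : ℝ × ℂ => sol a ((q.1 + 2 * c ^ 3 : ℝ) : ℂ) (Y ((q.1 + 2 * c ^ 3 : ℝ) : ℂ) 0)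
        (Y1 ((q.1 + 2 * c ^ 3 : ℝ) : ℂ) 0) q.2) :=
      (sol_cont a).comp (f := fun q : ℝ × ℂ => (((q.1 + 2 * c ^ 3 : ℝ) : ℂ), Y ((q.1 + 2 * c ^ 3 : ℝ) : ℂ) 0,
        Y1 ((q.1 + 2 * c ^ 3 : ℝ) : ℂ) 0, q.2)) (by fun_prop)
    refine this.congr (fun q => ?_)
    exact (((hs _).eq_sol _).1).symm
  · have : Continuous (fun q : ℝ × ℂ => sol' a ((q.1 + 2 * c ^ 3 : ℝ) : ℂ) (Y ((q.1 + 2 * c ^ 3 : ℝ) : ℂ) 0)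
        (Y1 ((q.1 + 2 * c ^ 3 : ℝ) : ℂ) 0) q.2) :=
      (sol'_cont a).comp (f := fun q : ℝ × ℂ => (((q.1 + 2 * c ^ 3 : ℝ) : ℂ), Y ((q.1 + 2 * c ^ 3 : ℝ) : ℂ) 0,
        Y1 ((q.1 + 2 * c ^ 3 : ℝ) : ℂ) 0, q.2)) (by fun_prop)
    refine this.congr (fun q => ?_)
    exact (((hs _).eq_sol _).2).symm

end CubicPT

namespace CubicPT
open Topology Set

lemma mono_neg {g g' : ℝ → ℝ} {t0 : ℝ} (hg : ∀ t, t0 ≤ t → HasDerivAt g (g' t) t)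
    (hn : ∀ t, t0 ≤ t → 0 ≤ g' t) (hl : Tendsto g atTop (𝓝 0)) (hne : ¬ ∀ t, t0 < t → g' t = 0) : g t0 < 0 := by
  have hm : MonotoneOn g (Ici t0) := by
    refine monotoneOn_of_hasDerivWithinAt_nonneg (convex_Ici t0)
      (fun t ht => (hg t ht).continuousAt.continuousWithinAt)
      (f' := g') (fun t ht => (hg t (by rw [interior_Ici] at ht; exact le_of_lt ht)).hasDerivWithinAt)
      (fun t ht => hn t (by rw [interior_Ici] at ht; exact le_of_lt ht))
  have hle : ∀ t, t0 ≤ t → g t ≤ 0 := by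
    intro t ht
    refine ge_of_tendsto hl ?_
    filter_upwards [eventually_ge_atTop t] with s hs
    exact hm ht (ht.trans hs) hs
  by_contra! hc
  apply hne
  have hz : ∀ t, t0 ≤ t → g t = 0 := fun t ht =>
    le_antisymm (hle t ht) (hc.trans (hm (mem_Ici.2 le_rfl) ht ht))
  intro t ht
  have h1 : HasDerivAt g 0 t := by
    refine (hasDerivAt_const t (0:ℝ)).congr_of_eventuallyEq ?_
    filter_upwards [lt_mem_nhds ht] with s hs
    exact hz s hs.le
  exact (hg t ht.le).unique h1

/-- energy -/
noncomputable def fe (y y1 : ℂ → ℂ) (z : ℂ) : ℂ := y1 z * (starRingEnd ℂ) (y z)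

lemma fe_vert {a l : ℂ} {y y1 : ℂ → ℂ} (h : IsSol a l y y1) (x t : ℝ) :
    HasDerivAt (fun t => fe y y1 (zl x t)) (I * (V a l (zl x t) * (normSq (y (zl x t)) : ℝ) - (normSq (y1 (zl x t)) : ℝ))) t := by
  have := (hd_vert (h.2 (zl x t))).fun_mul (hd_conj (hd_vert (h.1 (zl x t))))
  refine this.congr_deriv ?_
  rw [← mul_conj, ← mul_conj, map_mul, conj_I]; ring

lemma fe_horiz {a l : ℂ} {y y1 : ℂ → ℂ} (h : IsSol a l y y1) (x t : ℝ) :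
    HasDerivAt (fun x => fe y y1 (zl x t)) (V a l (zl x t) * (normSq (y (zl x t)) : ℝ) + (normSq (y1 (zl x t)) : ℝ)) x := by
  have := (hd_horiz (h.2 (zl x t))).fun_mul (hd_conj (hd_horiz (h.1 (zl x t))))
  refine this.congr_deriv ?_
  rw [← mul_conj, ← mul_conj]; ring

/-- the potential in our coordinates -/
noncomputable def VV (c μ : ℝ) (z : ℂ) : ℂ := V ((3 * c ^ 2 : ℝ) : ℂ) ((μ + 2 * c ^ 3 : ℝ) : ℂ) z

lemma VV_re (c μ X t : ℝ) : (VV c μ (zl (c + X) t)).re = X ^ 3 + 3 * c * X ^ 2 + μ - 3 * (X + c) * t ^ 2 := by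
  unfold VV V zl
  simp [pow_succ]; ring
lemma VV_im (c μ X t : ℝ) : (VV c μ (zl (c + X) t)).im = t * (3 * X * (X + 2 * c) - t ^ 2) := by
  unfold VV V zl
  simp [pow_succ]; ring

variable {c : ℝ} {Y Y1 : ℝ → ℂ → ℂ}

lemma IsSol.zero_of {a l : ℂ} {y y1 : ℂ → ℂ} (h : IsSol a l y y1) {z : ℂ} (h0 : y z = 0) (h1 : y1 z = 0) (w : ℂ) :
    y w = 0 := by
  have := (h.eq_of_data (h.lin h 0 0) z (by simpa using h0) (by simpa using h1)).1 w
  simpa using this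

lemma Canon.far (H : Canon c Y Y1) (Λ : ℝ) : ∃ R : ℝ, 0 < R ∧ ∀ μ, |μ| ≤ Λ → ∀ z : ℂ, 0 ≤ z.re → 0 ≤ z.im → R ≤ z.re + z.im →
    Y μ z ≠ 0 := by
  have hc := H.hc
  set ρ := |Λ| + 2 * c ^ 3 + ((3 * c ^ 2) ^ 2 + 3 * c ^ 2 + 2) with hρ
  have hρ0 : 0 < ρ := by positivity
  refine ⟨(2 * (48 * ρ) ^ 2) ^ 2, by positivity, ?_⟩
  intro μ hμ z h1 h2 h3
  have hk : (48 * ρ) ^ 2 ≤ ks z := by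
    unfold ks
    rw [le_div_iff₀ (by norm_num)]
    apply Real.le_sqrt_of_sq_le
    linarith
  have hb := H.bnd μ ρ (by
    have e1 := abs_add_le μ (2 * c ^ 3)
    have e2 : |2 * c ^ 3| = 2 * c ^ 3 := abs_of_nonneg (by positivity)
    have e3 := le_abs_self Λ
    rw [hρ]; linarith) z h1 h2 hk
  intro h0
  have := (hb.norm hρ0 hk h2).1
  rw [h0] at this
  norm_num at this

lemma Canon.nz (H : Canon c Y Y1) (μ : ℝ) (z : ℂ) : ¬ (Y μ z = 0 ∧ Y1 μ z = 0) := by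
  rintro ⟨h0, h1⟩
  obtain ⟨R, hR, h⟩ := H.far |μ|
  exact h μ le_rfl (R : ℂ) (by simpa using hR.le) (by simp) (by simp) ((H.sol μ).zero_of h0 h1 _)

lemma Canon.fe_lim (H : Canon c Y Y1) (μ x : ℝ) : Tendsto (fun t => fe (Y μ) (Y1 μ) (zl x t)) atTop (𝓝 0) := by
  have h := H.rap μ x
  have h1 : Tendsto (fun t => (starRingEnd ℂ) (Y μ (zl x t))) atTop (𝓝 0) := by
    have := (Complex.continuous_conj.tendsto _).comp h.1.tendsto
    rw [map_zero] at this
    exact this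
  simpa [fe] using h.2.tendsto.mul h1

lemma Canon.e5a (H : Canon c Y Y1) {μ X t : ℝ} (ht : 0 ≤ t) (hX : 3 * X * (X + 2 * c) ≤ t ^ 2) :
    (fe (Y μ) (Y1 μ) (zl (c + X) t)).re < 0 := by
  have hl := (Complex.continuous_re.tendsto _).comp (H.fe_lim μ (c + X))
  refine mono_neg (g := fun t => (fe (Y μ) (Y1 μ) (zl (c + X) t)).re)
    (g' := fun t => -((t * (3 * X * (X + 2 * c) - t ^ 2)) * normSq (Y μ (zl (c + X) t)))) ?_ ?_ hl ?_
  · intro s hs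
    refine (hd_re (fe_vert (H.sol μ) (c + X) s)).congr_deriv ?_
    rw [← VV_im c μ, VV]
    simp
  · intro s hs
    have h1 : 3 * X * (X + 2 * c) - s ^ 2 ≤ 0 := by nlinarith
    have h2 := mul_nonneg (mul_nonneg (ht.trans hs) (neg_nonneg.2 h1)) (normSq_nonneg (Y μ (zl (c + X) s)))
    nlinarith
  · intro h
    have h0 : ∀ s, t < s → Y μ (zl (c + X) s) = 0 := by
      intro s hs
      have h1 : 3 * X * (X + 2 * c) - s ^ 2 < 0 := by nlinarith
      have h2 := h s hs
      rw [neg_eq_zero, mul_eq_zero, mul_eq_zero, normSq_eq_zero] at h2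
      rcases h2 with (h2 | h2) | h2
      · linarith
      · linarith
      · exact h2
    have hd := hd_vert ((H.sol μ).1 (zl (c + X) (t + 1)))
    have hd0 : HasDerivAt (fun s => Y μ (zl (c + X) s)) 0 (t + 1) := by
      refine (hasDerivAt_const (t + 1) (0:ℂ)).congr_of_eventuallyEq ?_
      filter_upwards [lt_mem_nhds (show t < t + 1 by linarith)] with s hs using h0 s hs
    have := hd.unique hd0
    refine H.nz μ _ ⟨h0 (t + 1) (by linarith), ?_⟩
    simpa using this

lemma Canon.e5b (H : Canon c Y Y1) {μ X t : ℝ} (ht : 0 ≤ t) (hX : 0 ≤ X + c)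
    (hV : X ^ 3 + 3 * c * X ^ 2 + μ - 3 * (X + c) * t ^ 2 ≤ 0) :
    0 < (fe (Y μ) (Y1 μ) (zl (c + X) t)).im := by
  have hl := ((Complex.continuous_im.tendsto _).comp (H.fe_lim μ (c + X))).neg
  simp only [Complex.zero_im, neg_zero] at hl
  have hVs : ∀ s, t ≤ s → X ^ 3 + 3 * c * X ^ 2 + μ - 3 * (X + c) * s ^ 2 ≤ 0 := by
    intro s hs
    have := mul_le_mul_of_nonneg_left (pow_le_pow_left₀ ht hs 2) hX
    linarith
  have := mono_neg (g := fun t => -(fe (Y μ) (Y1 μ) (zl (c + X) t)).im) (t0 := t)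
    (g' := fun t => -((X ^ 3 + 3 * c * X ^ 2 + μ - 3 * (X + c) * t ^ 2) * normSq (Y μ (zl (c + X) t)) - normSq (Y1 μ (zl (c + X) t)))) ?_ ?_ hl ?_
  · linarith
  · intro s hs
    refine (hd_im (fe_vert (H.sol μ) (c + X) s)).fun_neg.congr_deriv ?_
    rw [← VV_re c μ, VV]
    simp
  · intro s hs
    have h1 := mul_nonneg (neg_nonneg.2 (hVs s hs)) (normSq_nonneg (Y μ (zl (c + X) s)))
    have h2 := normSq_nonneg (Y1 μ (zl (c + X) s))
    linarith
  · intro h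
    have h0 : ∀ s, t < s → Y1 μ (zl (c + X) s) = 0 := by
      intro s hs
      have h1 := mul_nonneg (neg_nonneg.2 (hVs s hs.le)) (normSq_nonneg (Y μ (zl (c + X) s)))
      have h2 := normSq_nonneg (Y1 μ (zl (c + X) s))
      have h3 := h s hs
      rw [← normSq_eq_zero]; linarith
    have hV0 : ∀ s, t < s → VV c μ (zl (c + X) s) = 0 := by
      intro s hs
      have hd := hd_vert ((H.sol μ).2 (zl (c + X) s))
      have hd0 : HasDerivAt (fun s => Y1 μ (zl (c + X) s)) 0 s := by
        refine (hasDerivAt_const s (0:ℂ)).congr_of_eventuallyEq ?_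
        filter_upwards [lt_mem_nhds hs] with s hs using h0 s hs
      have := hd.unique hd0
      have h5 : Y μ (zl (c + X) s) ≠ 0 := fun h6 => H.nz μ _ ⟨h6, h0 s hs⟩
      simpa [h5, VV] using this
    have i1 := congrArg Complex.im (hV0 (t + 1) (by linarith))
    have i2 := congrArg Complex.im (hV0 (t + 2) (by linarith))
    rw [VV_im, Complex.zero_im, mul_eq_zero] at i1 i2
    rcases i1 with i1 | i1
    · linarith
    rcases i2 with i2 | i2
    · linarith
    nlinarith

lemma Canon.im_mono (H : Canon c Y Y1) {μ t X X' : ℝ} (ht : 0 ≤ t) (h0 : 0 ≤ X) (hX : X ≤ X') (h : t ^ 2 ≤ 3 * X * (X + 2 * c)) :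
    (fe (Y μ) (Y1 μ) (zl (c + X) t)).im ≤ (fe (Y μ) (Y1 μ) (zl (c + X') t)).im := by
  have hc := H.hc
  have hm : MonotoneOn (fun x => (fe (Y μ) (Y1 μ) (zl x t)).im) (Icc (c + X) (c + X')) := by
    refine monotoneOn_of_hasDerivWithinAt_nonneg (convex_Icc _ _)
      (fun x hx => (hd_im (fe_horiz (H.sol μ) x t)).continuousAt.continuousWithinAt)
      (fun x hx => (hd_im (fe_horiz (H.sol μ) x t)).hasDerivWithinAt) ?_
    intro x hx
    rw [interior_Icc] at hx
    have e := VV_im c μ (x - c) t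
    rw [show c + (x - c) = x by ring, VV] at e
    simp only [add_im, im_mul_ofReal, ofReal_im, add_zero]
    rw [e]
    have h1 := hx.1
    have : 0 ≤ 3 * (x - c) * ((x - c) + 2 * c) - t ^ 2 := by
      have : 3 * X * (X + 2 * c) ≤ 3 * (x - c) * ((x - c) + 2 * c) := by
        gcongr <;> linarith
      linarith
    have := normSq_nonneg (Y μ (zl x t))
    positivity
  exact hm ⟨le_rfl, by linarith⟩ ⟨by linarith, le_rfl⟩ (by linarith)

lemma fe_ne {y y1 : ℂ → ℂ} {z : ℂ} (h : fe y y1 z ≠ 0) : y z ≠ 0 := by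
  intro h0; apply h; simp [fe, h0]

lemma Canon.e5c (H : Canon c Y Y1) {μ X t : ℝ} (hμ : μ ≤ 0) (hX : 0 ≤ X) (ht : 0 ≤ t) : Y μ (zl (c + X) t) ≠ 0 := by
  have hc := H.hc
  apply fe_ne (y1 := Y1 μ)
  intro hz
  by_cases h : 3 * X * (X + 2 * c) ≤ t ^ 2
  · have := H.e5a (μ := μ) ht h
    rw [hz] at this; simp at this
  push Not at h
  set s := Real.sqrt (c ^ 2 + t ^ 2 / 3) with hs
  have hs2 : s ^ 2 = c ^ 2 + t ^ 2 / 3 := Real.sq_sqrt (by positivity)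
  have hs0 : 0 ≤ s := Real.sqrt_nonneg _
  have hsc : c ≤ s := by apply Real.le_sqrt_of_sq_le; nlinarith
  have hsX : s - c ≤ X := by
    have : s < X + c := by
      apply lt_of_pow_lt_pow_left₀ 2 (by linarith); nlinarith
    linarith
  have e1 : 3 * (s - c) * ((s - c) + 2 * c) = t ^ 2 := by nlinarith
  have i1 : 0 < (fe (Y μ) (Y1 μ) (zl (c + (s - c)) t)).im := by
    refine H.e5b ht (by linarith) ?_
    rw [← e1]
    have : (s - c) ^ 3 + 3 * c * (s - c) ^ 2 + μ - 3 * ((s - c) + c) * (3 * (s - c) * ((s - c) + 2 * c)) =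
      μ - 2 * (s - c) * (2 * (s - c) + 3 * c) ^ 2 := by ring
    rw [this]
    have : 0 ≤ 2 * (s - c) * (2 * (s - c) + 3 * c) ^ 2 := by
      have : 0 ≤ s - c := by linarith
      positivity
    linarith
  have i2 := H.im_mono (μ := μ) ht (by linarith) hsX e1.ge
  rw [hz, Complex.zero_im] at i2; linarith

/-- flux on the real axis -/
lemma Canon.flux (H : Canon c Y Y1) (μ x x' : ℝ) :
    (fe (Y μ) (Y1 μ) (zl x 0)).im = (fe (Y μ) (Y1 μ) (zl x' 0)).im := by
  refine is_const_of_deriv_eq_zero (f := fun x => (fe (Y μ) (Y1 μ) (zl x 0)).im)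
    (fun x => (hd_im (fe_horiz (H.sol μ) x 0)).differentiableAt) (fun x => ?_) x x'
  rw [(hd_im (fe_horiz (H.sol μ) x 0)).deriv]
  have e := VV_im c μ (x - c) 0
  rw [show c + (x - c) = x by ring, VV] at e
  simp only [add_im, im_mul_ofReal, ofReal_im, add_zero]
  rw [e]; simp

lemma Canon.e5d (H : Canon c Y Y1) {μ X t : ℝ} (hμ : 0 ≤ μ) (hκ : ∀ x, (fe (Y μ) (Y1 μ) (zl x 0)).im = 0) (hX : X ≤ 0) (ht : 0 < t) :
    Y μ (zl (c + X) t) ≠ 0 := by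
  have hc := H.hc
  by_cases h : 3 * X * (X + 2 * c) ≤ t ^ 2
  · apply fe_ne (y1 := Y1 μ)
    intro hz
    have := H.e5a (μ := μ) ht.le h
    rw [hz] at this; simp at this
  push Not at h
  have hX2 : X < - 2 * c := by
    by_contra! h2
    nlinarith [mul_nonneg (neg_nonneg.2 hX) (by linarith : 0 ≤ X + 2 * c)]
  by_cases hV : X ^ 3 + 3 * c * X ^ 2 + μ - 3 * (X + c) * t ^ 2 ≤ 0
  · intro hz
    have hVs : ∀ s, 0 ≤ s → s ≤ t → X ^ 3 + 3 * c * X ^ 2 + μ - 3 * (X + c) * s ^ 2 ≤ 0 := by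
      intro s h0 hs
      have := mul_le_mul_of_nonneg_left (pow_le_pow_left₀ h0 hs 2) (by linarith : 0 ≤ -(X + c))
      linarith
    have hd : ∀ s, HasDerivAt (fun s => (fe (Y μ) (Y1 μ) (zl (c + X) s)).im)
        ((X ^ 3 + 3 * c * X ^ 2 + μ - 3 * (X + c) * s ^ 2) * normSq (Y μ (zl (c + X) s)) - normSq (Y1 μ (zl (c + X) s))) s := by
      intro s
      refine (hd_im (fe_vert (H.sol μ) (c + X) s)).congr_deriv ?_
      rw [← VV_re c μ, VV]
      simp
    have ha : AntitoneOn (fun s => (fe (Y μ) (Y1 μ) (zl (c + X) s)).im) (Icc 0 t) := by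
      refine antitoneOn_of_hasDerivWithinAt_nonpos (convex_Icc _ _)
        (fun x hx => (hd x).continuousAt.continuousWithinAt)
        (fun x hx => (hd x).hasDerivWithinAt) ?_
      intro s hs
      rw [interior_Icc] at hs
      have h1 := mul_nonneg (neg_nonneg.2 (hVs s hs.1.le hs.2.le)) (normSq_nonneg (Y μ (zl (c + X) s)))
      have h2 := normSq_nonneg (Y1 μ (zl (c + X) s))
      linarith
    have ht0 : (fe (Y μ) (Y1 μ) (zl (c + X) t)).im = 0 := by simp [fe, hz]
    have hz0 : ∀ s ∈ Icc 0 t, (fe (Y μ) (Y1 μ) (zl (c + X) s)).im = 0 := by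
      intro s hs
      have h1 := ha ⟨le_rfl, ht.le⟩ hs hs.1
      have h2 := ha hs ⟨ht.le, le_rfl⟩ hs.2
      simp only at h1 h2
      rw [hκ] at h1
      rw [ht0] at h2
      linarith
    have h10 : ∀ s ∈ Ioo 0 t, Y1 μ (zl (c + X) s) = 0 := by
      intro s hs
      have hd0 : HasDerivAt (fun s => (fe (Y μ) (Y1 μ) (zl (c + X) s)).im) 0 s := by
        refine (hasDerivAt_const s (0:ℝ)).congr_of_eventuallyEq ?_
        filter_upwards [Ioo_mem_nhds hs.1 hs.2] with u hu using hz0 u ⟨hu.1.le, hu.2.le⟩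
      have h3 := (hd s).unique hd0
      have h1 := mul_nonneg (neg_nonneg.2 (hVs s hs.1.le hs.2.le)) (normSq_nonneg (Y μ (zl (c + X) s)))
      have h2 := normSq_nonneg (Y1 μ (zl (c + X) s))
      rw [← normSq_eq_zero]; linarith
    have hcont : Continuous (fun s => Y1 μ (zl (c + X) s)) :=
      continuous_iff_continuousAt.2 fun s => (hd_vert ((H.sol μ).2 (zl (c + X) s))).continuousAt
    have hY1 : Y1 μ (zl (c + X) t) = 0 := by
      have hcl : IsClosed {s | Y1 μ (zl (c + X) s) = 0} := isClosed_eq hcont continuous_const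
      have hsub : closure (Ioo 0 t) ⊆ {s | Y1 μ (zl (c + X) s) = 0} := closure_minimal h10 hcl
      rw [closure_Ioo ht.ne] at hsub
      exact hsub ⟨ht.le, le_rfl⟩
    exact H.nz μ _ ⟨hz, hY1⟩
  · push Not at hV
    apply fe_ne (y1 := Y1 μ)
    intro hz
    set s := Real.sqrt (c ^ 2 + t ^ 2 / 3) with hs
    have hs2 : s ^ 2 = c ^ 2 + t ^ 2 / 3 := Real.sq_sqrt (by positivity)
    have hs0 : 0 ≤ s := Real.sqrt_nonneg _
    have hsc : c ≤ s := by apply Real.le_sqrt_of_sq_le; nlinarith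
    have hsX : X ≤ - s - c := by
      have : s < -(X + c) := by
        apply lt_of_pow_lt_pow_left₀ 2 (by linarith); nlinarith
      linarith
    set X' := - s - c with hX'
    have e1 : 3 * X' * (X' + 2 * c) = t ^ 2 := by rw [hX']; nlinarith
    have r1 := H.e5a (μ := μ) ht.le e1.le
    have hV' : ∀ x, X ≤ x → x ≤ X' → 0 ≤ x ^ 3 + 3 * c * x ^ 2 + μ - 3 * (x + c) * t ^ 2 := by
      intro x h1 h2
      rcases eq_or_lt_of_le hsX with heq | hlt
      · have : x = X := by linarith
        rw [this]; exact hV.le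
      have hP : 0 ≤ X' ^ 3 + 3 * c * X' ^ 2 + μ - 3 * (X' + c) * t ^ 2 := by
        rw [← e1]
        have e2 : X' ^ 3 + 3 * c * X' ^ 2 + μ - 3 * (X' + c) * (3 * X' * (X' + 2 * c)) =
          μ + 2 * (- X') * (2 * X' + 3 * c) ^ 2 := by ring
        have : 0 ≤ - X' := by linarith
        rw [e2]; positivity
      have key : (X' - X) * (x ^ 3 + 3 * c * x ^ 2 + μ - 3 * (x + c) * t ^ 2) =
        (x - X) * (X' ^ 3 + 3 * c * X' ^ 2 + μ - 3 * (X' + c) * t ^ 2) +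
        (X' - x) * (X ^ 3 + 3 * c * X ^ 2 + μ - 3 * (X + c) * t ^ 2) +
        (X' - x) * (x - X) * (X' - X) * (-(x + X + X') - 3 * c) := by ring
      have k1 : 0 ≤ X' - x := by linarith
      have k2 : 0 ≤ x - X := by linarith
      have k3 : 0 < X' - X := by linarith
      have k4 : 0 ≤ -(x + X + X') - 3 * c := by linarith
      have : 0 ≤ (X' - X) * (x ^ 3 + 3 * c * x ^ 2 + μ - 3 * (x + c) * t ^ 2) := by
        rw [key]
        have := mul_nonneg k2 hP
        have := mul_nonneg k1 hV.le
        have := mul_nonneg (mul_nonneg (mul_nonneg k1 k2) k3.le) k4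
        linarith
      exact nonneg_of_mul_nonneg_right this k3
    have hm : MonotoneOn (fun x => (fe (Y μ) (Y1 μ) (zl x t)).re) (Icc (c + X) (c + X')) := by
      refine monotoneOn_of_hasDerivWithinAt_nonneg (convex_Icc _ _)
        (fun x hx => (hd_re (fe_horiz (H.sol μ) x t)).continuousAt.continuousWithinAt)
        (fun x hx => (hd_re (fe_horiz (H.sol μ) x t)).hasDerivWithinAt) ?_
      intro x hx
      rw [interior_Icc] at hx
      have e := VV_re c μ (x - c) t
      rw [show c + (x - c) = x by ring, VV] at e
      simp only [add_re, re_mul_ofReal, ofReal_re]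
      rw [e]
      have h1 := hV' (x - c) (by linarith [hx.1]) (by linarith [hx.2])
      have := normSq_nonneg (Y μ (zl x t))
      have := normSq_nonneg (Y1 μ (zl x t))
      positivity
    have := hm ⟨le_rfl, by linarith⟩ ⟨by linarith, le_rfl⟩ (by linarith : c + X ≤ c + X')
    simp only at this
    rw [hz, Complex.zero_re] at this
    linarith

end CubicPT

namespace CubicPT
open Topology Set

variable {c : ℝ} {Y Y1 : ℝ → ℂ → ℂ}

lemma IsSol.star {a l : ℝ} {y y1 : ℂ → ℂ} (h : IsSol (a : ℂ) (l : ℂ) y y1) :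
    IsSol (a : ℂ) (l : ℂ) (fun z => (starRingEnd ℂ) (y ((starRingEnd ℂ) z))) (fun z => (starRingEnd ℂ) (y1 ((starRingEnd ℂ) z))) := by
  constructor
  · intro z
    have := (h.1 ((starRingEnd ℂ) z)).conj_conj
    rw [Complex.conj_conj] at this
    exact this
  · intro z
    have := (h.2 ((starRingEnd ℂ) z)).conj_conj
    rw [Complex.conj_conj] at this
    refine this.congr_deriv ?_
    rw [map_mul]
    congr 1
    unfold V
    simp

/-- flux constant -/
noncomputable def kap (c : ℝ) (Y Y1 : ℝ → ℂ → ℂ) (μ : ℝ) : ℝ := (fe (Y μ) (Y1 μ) (zl c 0)).im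

lemma Canon.kap_eq (H : Canon c Y Y1) (μ x : ℝ) : (fe (Y μ) (Y1 μ) (zl x 0)).im = kap c Y Y1 μ := H.flux μ x c

lemma Canon.kap_pos (H : Canon c Y Y1) {μ : ℝ} (hμ : μ ≤ 0) : 0 < kap c Y Y1 μ := by
  have := H.e5b (μ := μ) (X := 0) (t := 0) le_rfl (by simpa using H.hc) (by simpa using hμ)
  simpa [kap] using this

lemma zl_zero (x : ℝ) : zl x 0 = x := by simp [zl]

lemma rt_real {x : ℝ} (hx : 0 < x) : ∃ r : ℝ, rt (x : ℂ) = r := by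
  refine ⟨Real.exp (Real.log x / 2), ?_⟩
  unfold rt
  rw [← Complex.ofReal_log hx.le]
  push_cast
  rfl

lemma pw_real {a x : ℝ} (hx : 0 < x) : ∃ r : ℝ, 0 < r ∧ pw a (x : ℂ) = r := by
  obtain ⟨r, hr⟩ := rt_real hx
  refine ⟨Real.exp (2 / 5 * r ^ 5 - a * r - 3 / 4 * Real.log x), Real.exp_pos _, ?_⟩
  unfold pw
  rw [hr, ← Complex.ofReal_log hx.le]
  push_cast
  rfl

lemma ks_real_atTop : Tendsto (fun x : ℝ => ks (x : ℂ)) atTop atTop := by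
  unfold ks
  simp only [ofReal_re, ofReal_im, add_zero]
  exact Real.tendsto_sqrt_atTop.atTop_div_const (by norm_num)

/-- asymptotics on the positive real axis -/
lemma Canon.real_asym (H : Canon c Y Y1) (μ : ℝ) :
    Tendsto (fun x : ℝ => Y μ x / pw (3 * c ^ 2) x) atTop (𝓝 1) := by
  have hc := H.hc
  rw [tendsto_iff_norm_sub_tendsto_zero]
  set ρ := |μ + 2 * c ^ 3| + ((3 * c ^ 2) ^ 2 + 3 * c ^ 2 + 2) with hρ
  have h1 : Tendsto (fun x : ℝ => 24 * ρ / Real.sqrt (ks (x : ℂ))) atTop (𝓝 0) :=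
    (Real.tendsto_sqrt_atTop.comp ks_real_atTop).const_div_atTop _
  refine squeeze_zero' (Eventually.of_forall fun _ => norm_nonneg _) ?_ h1
  filter_upwards [ks_real_atTop.eventually_ge_atTop ((48 * ρ) ^ 2), eventually_ge_atTop 0] with x h2 h3
  exact (H.bnd μ ρ le_rfl x (by simpa using h3) (by simp) h2).1

lemma Canon.sym (H : Canon c Y Y1) {μ : ℝ} (hκ : kap c Y Y1 μ = 0) (z : ℂ) :
    Y μ ((starRingEnd ℂ) z) = (starRingEnd ℂ) (Y μ z) := by
  have hs := (H.sol μ).star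
  have hw : ∀ z, Y μ z * (starRingEnd ℂ) (Y1 μ ((starRingEnd ℂ) z)) - Y1 μ z * (starRingEnd ℂ) (Y μ ((starRingEnd ℂ) z)) = 0 := by
    intro z
    rw [(H.sol μ).wronsk hs z (zl c 0)]
    have h1 : (starRingEnd ℂ) (zl c 0) = zl c 0 := by rw [zl_zero, conj_ofReal]
    rw [h1]
    unfold kap fe at hκ
    set A := Y μ (zl c 0)
    set B := Y1 μ (zl c 0)
    have h2 : A * (starRingEnd ℂ) B = (starRingEnd ℂ) (B * (starRingEnd ℂ) A) := by
      rw [map_mul, Complex.conj_conj]; ring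
    rw [h2, conj_eq_iff_im.2 hκ, sub_self]
  obtain ⟨R, hR, hn⟩ := H.far |μ|
  have h0 : Y μ (R : ℂ) ≠ 0 := hn μ le_rfl R (by simpa using hR.le) (by simp) (by simp)
  have hp := (prop_of_wronsk (H.sol μ) hs h0 hw).1
  set k := (starRingEnd ℂ) (Y μ ((starRingEnd ℂ) (R:ℂ))) / Y μ (R:ℂ) with hk
  have hk1 : k = 1 := by
    have t1 := (H.real_asym μ).const_mul k
    have t2 : Tendsto (fun x : ℝ => (starRingEnd ℂ) (Y μ x / pw (3 * c ^ 2) x)) atTop (𝓝 1) := by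
      have := (Complex.continuous_conj.tendsto _).comp (H.real_asym μ)
      rw [map_one] at this
      exact this
    rw [mul_one] at t1
    refine tendsto_nhds_unique t1 (t2.congr' ?_)
    filter_upwards [eventually_gt_atTop 0] with x hx
    obtain ⟨r, hr, e⟩ := pw_real (a := 3 * c ^ 2) hx
    have := hp x
    rw [conj_ofReal] at this
    rw [e, map_div₀, conj_ofReal, this]; ring
  have := hp z
  rw [hk1, one_mul] at this
  rw [← this, Complex.conj_conj]

lemma Canon.eig_of (H : Canon c Y Y1) {μ : ℝ} (hκ : kap c Y Y1 μ = 0) :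
    IsCubicEigenfunction ((3 * c ^ 2 : ℝ) : ℂ) ((μ + 2 * c ^ 3 : ℝ) : ℂ) (Y μ) := by
  have hd : deriv (Y μ) = Y1 μ := funext fun z => ((H.sol μ).1 z).deriv
  have hup : Tendsto (fun t : ℝ => Y μ (I * t)) atTop (𝓝 0) := by
    refine (H.rap μ 0).1.tendsto.congr (fun t => ?_)
    simp [zl, mul_comm]
  refine ⟨fun z => ((H.sol μ).1 z).differentiableAt, ?_, ?_, hup, ?_⟩
  · intro h
    obtain ⟨R, hR, hn⟩ := H.far |μ|
    exact hn μ le_rfl R (by simpa using hR.le) (by simp) (by simp) (by rw [h]; rfl)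
  · intro z
    rw [hd, ((H.sol μ).2 z).deriv]
    unfold V; ring
  · have h2 := (Complex.continuous_conj.tendsto _).comp (hup.comp tendsto_neg_atBot_atTop)
    rw [map_zero] at h2
    refine h2.congr (fun t => ?_)
    simp only [Function.comp]
    rw [← H.sym hκ]
    congr 1
    simp

lemma Canon.eig_imp (H : Canon c Y Y1) {μ : ℝ} {y : ℂ → ℂ}
    (hy : IsCubicEigenfunction ((3 * c ^ 2 : ℝ) : ℂ) ((μ + 2 * c ^ 3 : ℝ) : ℂ) y) :
    kap c Y Y1 μ = 0 ∧ ∃ k : ℂ, k ≠ 0 ∧ ∀ z, y z = k * Y μ z := by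
  obtain ⟨h1, h2, h3, h4, h5⟩ := hy
  have hs : IsSol ((3 * c ^ 2 : ℝ) : ℂ) ((μ + 2 * c ^ 3 : ℝ) : ℂ) y (deriv y) := by
    refine ⟨fun z => (h1 z).hasDerivAt, fun z => ?_⟩
    have hd : Differentiable ℂ (deriv y) :=
      (h1.contDiff (n := 2)).differentiable_deriv_two
    refine (hd z).hasDerivAt.congr_deriv ?_
    have := h3 z
    unfold V
    linear_combination -this
  have t1 : Tendsto (fun t => y (zl 0 t)) atTop (𝓝 0) := h4.congr (fun t => by simp [zl, mul_comm])
  obtain ⟨R, hR, hn⟩ := H.far |μ|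
  have h0 : Y μ (R : ℂ) ≠ 0 := hn μ le_rfl R (by simpa using hR.le) (by simp) (by simp)
  have p1 := prop_of_wronsk (H.sol μ) hs h0 (decay_wronsk (H.sol μ) hs (H.rap μ 0).1 (H.rap μ 0).2 t1)
  set k := y R / Y μ R with hk
  have hk0 : k ≠ 0 := by
    intro h
    apply h2
    funext z
    have := p1.1 z
    rw [h, zero_mul] at this
    exact this
  have t2 : Tendsto (fun t => (starRingEnd ℂ) (y ((starRingEnd ℂ) (zl 0 t)))) atTop (𝓝 0) := by
    have := (Complex.continuous_conj.tendsto _).comp (h5.comp tendsto_neg_atTop_atBot)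
    rw [map_zero] at this
    refine this.congr (fun t => ?_)
    simp only [Function.comp]
    congr 2
    simp [zl, mul_comm]
  have w2 := decay_wronsk (H.sol μ) hs.star (H.rap μ 0).1 (H.rap μ 0).2 t2
  refine ⟨?_, k, hk0, p1.1⟩
  have := w2 (zl c 0)
  have e : (starRingEnd ℂ) (zl c 0) = zl c 0 := by rw [zl_zero, conj_ofReal]
  rw [e, p1.1, p1.2, map_mul, map_mul] at this
  unfold kap fe
  set A := Y μ (zl c 0)
  set B := Y1 μ (zl c 0)
  rw [← conj_eq_iff_im, map_mul, Complex.conj_conj]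
  have hk' : (starRingEnd ℂ) k ≠ 0 := by simpa using hk0
  apply mul_left_cancel₀ hk'
  linear_combination this

def Zq (c : ℝ) (Y : ℝ → ℂ → ℂ) (μ : ℝ) : Set ℂ := {z | c < z.re ∧ 0 < z.im ∧ Y μ z = 0}

lemma Canon.gamma_iff (H : Canon c Y Y1) {μ : ℝ} (hfin : (Zq c Y μ).Finite) (n : ℕ) :
    (3 * c ^ 2, μ + 2 * c ^ 3) ∈ cubicGamma n ↔ kap c Y Y1 μ = 0 ∧ (Zq c Y μ).ncard = n := by
  have key : kap c Y Y1 μ = 0 → nonrealZeros (Y μ) = Zq c Y μ ∪ (starRingEnd ℂ) '' Zq c Y μ := by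
    intro hκ
    have hμ : 0 ≤ μ := by
      by_contra! h
      have := H.kap_pos h.le
      linarith
    have up : ∀ z : ℂ, Y μ z = 0 → 0 < z.im → z ∈ Zq c Y μ := by
      intro z hz h1
      refine ⟨?_, h1, hz⟩
      by_contra! h2
      refine H.e5d (X := z.re - c) (t := z.im) hμ (fun x => (H.kap_eq μ x).trans hκ) (by linarith) h1 ?_
      rw [add_sub_cancel, zl_eta]; exact hz
    ext z
    constructor
    · rintro ⟨hz, hi⟩
      rcases lt_or_gt_of_ne hi with h | h
      · refine Or.inr ⟨(starRingEnd ℂ) z, up _ ?_ ?_, Complex.conj_conj z⟩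
        · rw [H.sym hκ, hz, map_zero]
        · simpa using h
      · exact Or.inl (up z hz h)
    · rintro (⟨_, h1, h2⟩ | ⟨w, ⟨_, h1, h2⟩, rfl⟩)
      · exact ⟨h2, h1.ne'⟩
      · refine ⟨?_, ?_⟩
        · rw [H.sym hκ, h2, map_zero]
        · simpa using h1.ne'
  have hcard : (Zq c Y μ ∪ (starRingEnd ℂ) '' Zq c Y μ).ncard = 2 * (Zq c Y μ).ncard := by
    rw [ncard_union_eq ?_ hfin (hfin.image _), ncard_image_of_injective _ (starRingEnd ℂ).injective]
    · ring
    · rw [Set.disjoint_left]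
      rintro z ⟨_, h1, _⟩ ⟨w, ⟨_, h2, _⟩, rfl⟩
      simp at h1; linarith
  constructor
  · rintro ⟨y, hy, hf, hn⟩
    obtain ⟨hκ, k, hk, hyk⟩ := H.eig_imp hy
    have e : nonrealZeros y = nonrealZeros (Y μ) := by
      ext z; simp [nonrealZeros, hyk, hk]
    rw [e, key hκ, hcard] at hn
    exact ⟨hκ, by omega⟩
  · rintro ⟨hκ, hn⟩
    refine ⟨Y μ, H.eig_of hκ, ?_, ?_⟩
    · rw [key hκ]; exact hfin.union (hfin.image _)
    · rw [key hκ, hcard, hn]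

end CubicPT

namespace CubicPT
open Topology Set MeasureTheory

variable {c : ℝ} {Y Y1 : ℝ → ℂ → ℂ}

lemma Canon.line (H : Canon c Y Y1) (μ1 b : ℝ) : ∃ ρ T0 : ℝ, 0 < ρ ∧ 2 ≤ T0 ∧ b ≤ T0 ∧ ∀ μ, |μ - μ1| ≤ 1 → ∀ t, T0 ≤ t →
    ‖pw (3 * c ^ 2) (zl c t)‖ ≤ 2 * ‖Y μ (zl c t)‖ ∧ ‖Y μ (zl c t)‖ ≤ 2 * ‖pw (3 * c ^ 2) (zl c t)‖ ∧
    ‖Y1 μ (zl c t) - qw (3 * c ^ 2) (zl c t) * Y μ (zl c t)‖ ≤ 2 * ρ * ‖pw (3 * c ^ 2) (zl c t)‖ := by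
  have hc := H.hc
  set ρ := |μ1| + 1 + 2 * c ^ 3 + ((3 * c ^ 2) ^ 2 + 3 * c ^ 2 + 2) with hρ
  have hρ0 : 0 < ρ := by positivity
  obtain ⟨τ0, h0, hk0⟩ := exists_start ρ c hc hρ0
  refine ⟨ρ, max τ0 (max 2 b), hρ0, (le_max_left _ _).trans (le_max_right _ _), (le_max_right _ _).trans (le_max_right _ _), ?_⟩
  intro μ hμ t ht
  have ht1 : τ0 ≤ t := (le_max_left _ _).trans ht
  have hk : (48 * ρ) ^ 2 ≤ ks (zl c t) := hk0.trans (ks_mono ht1)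
  have ht0 : 0 ≤ (zl c t).im := by simpa using h0.trans ht1
  have hb := H.bnd μ ρ (by
    have e1 := abs_add_le μ (2 * c ^ 3)
    have e2 : |2 * c ^ 3| = 2 * c ^ 3 := abs_of_nonneg (by positivity)
    have e3 := abs_add_le (μ - μ1) μ1
    rw [sub_add_cancel] at e3
    rw [hρ]; linarith) (zl c t) (by simpa using hc) ht0 hk
  have hn := hb.norm hρ0 hk ht0
  have hp : 0 < ‖pw (3 * c ^ 2) (zl c t)‖ := norm_pos_iff.2 (pw_ne _ _)
  refine ⟨?_, hn.2.1, ?_⟩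
  · have := norm_sub_norm_le (1:ℂ) (1 - Y μ (zl c t) / pw (3 * c ^ 2) (zl c t))
    rw [norm_one, sub_sub_cancel, norm_sub_rev] at this
    have h3 : 1 / 2 ≤ ‖Y μ (zl c t) / pw (3 * c ^ 2) (zl c t)‖ := by linarith [hn.1]
    rw [norm_div, le_div_iff₀ hp] at h3
    linarith
  · have h4 := hb.2
    rw [norm_div, div_le_iff₀ hp] at h4
    refine h4.trans ?_
    gcongr
    have hkn : 0 ≤ ks (zl c t) := le_trans (by positivity) hk
    rw [div_le_iff₀ (by positivity)]
    have : 0 ≤ ks (zl c t) * (zl c t).im := by positivity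
    nlinarith

lemma pw_grow (hc : 0 ≤ c) : ∀ t : ℝ, 2 ≤ t → ∃ F', HasDerivAt (fun t : ℝ => t ^ (-3 / 2 : ℝ) / normSq (pw (3 * c ^ 2) (zl c t))) F' t ∧
    1 / 2 / normSq (pw (3 * c ^ 2) (zl c t)) ≤ F' := by
  intro t ht
  have hz : zl c t ≠ 0 := fun h => by have := congrArg Complex.im h; simp at this; linarith
  have hs := slit_of (z := zl c t) (by simpa using hc) hz
  have hN := hd_normSq (hd_vert (pw_hasDeriv (3 * c ^ 2) hs))
  have hNp : 0 < normSq (pw (3 * c ^ 2) (zl c t)) := normSq_pos.2 (pw_ne _ _)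
  have hR := Real.hasDerivAt_rpow_const (x := t) (p := (-3 / 2 : ℝ)) (Or.inl (by linarith))
  refine ⟨_, hR.fun_div hN hNp.ne', ?_⟩
  have e1 : (qw (3 * c ^ 2) (zl c t) * pw (3 * c ^ 2) (zl c t) * I * (starRingEnd ℂ) (pw (3 * c ^ 2) (zl c t))).re =
      - (qw (3 * c ^ 2) (zl c t)).im * normSq (pw (3 * c ^ 2) (zl c t)) := by
    rw [show qw (3 * c ^ 2) (zl c t) * pw (3 * c ^ 2) (zl c t) * I * (starRingEnd ℂ) (pw (3 * c ^ 2) (zl c t)) =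
      qw (3 * c ^ 2) (zl c t) * I * (pw (3 * c ^ 2) (zl c t) * (starRingEnd ℂ) (pw (3 * c ^ 2) (zl c t))) by ring, mul_conj]
    simp
  rw [e1]
  set N := normSq (pw (3 * c ^ 2) (zl c t))
  set q := (qw (3 * c ^ 2) (zl c t)).im with hq
  have hq1 : t ^ (3 / 2 : ℝ) / 2 ≤ q := by
    have h1 := qw_im (a := 3 * c ^ 2) (by positivity) (z := zl c t) (by simpa using hc) (by simp; linarith) hz
    rw [zl_im] at h1
    refine le_trans ?_ h1
    have h2 : Real.sqrt t / 2 ≤ ks (zl c t) := by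
      unfold ks; simp only [zl_re, zl_im]; gcongr; linarith
    have h3 : t ^ (3 / 2 : ℝ) = Real.sqrt t * t := by
      rw [Real.sqrt_eq_rpow, show (3 / 2 : ℝ) = 1 / 2 + 1 by norm_num, Real.rpow_add (by linarith), Real.rpow_one]
    rw [h3]
    have := mul_le_mul_of_nonneg_right h2 (by linarith : 0 ≤ t)
    linarith
  have hs1 : t ^ (-3 / 2 : ℝ) * t ^ (3 / 2 : ℝ) = 1 := by
    rw [← Real.rpow_add (by linarith)]; norm_num
  have hs2 : t ^ (-3 / 2 - 1 : ℝ) ≤ 1 / 4 := by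
    have h1 : t ^ (-3 / 2 - 1 : ℝ) ≤ t ^ (-2 : ℝ) := Real.rpow_le_rpow_of_exponent_le (by linarith) (by norm_num)
    refine h1.trans ?_
    rw [Real.rpow_neg (by linarith), one_div]
    apply inv_anti₀ (by norm_num)
    have : t ^ (2:ℝ) = t ^ 2 := by exact_mod_cast Real.rpow_natCast t 2
    rw [this]; nlinarith
  have hs3 : 0 < t ^ (-3 / 2 : ℝ) := by positivity
  have h4 : 1 ≤ 2 * q * t ^ (-3 / 2 : ℝ) := by nlinarith
  have e2 : (-3 / 2 * t ^ (-3 / 2 - 1 : ℝ) * N - t ^ (-3 / 2 : ℝ) * (2 * (-q * N))) / N ^ 2 =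
    (-3 / 2 * t ^ (-3 / 2 - 1 : ℝ) + 2 * q * t ^ (-3 / 2 : ℝ)) / N := by
    field_simp; ring
  rw [e2]
  gcongr
  linarith

lemma Canon.phi_bound (H : Canon c Y Y1) {μ1 T0 : ℝ} (hT : 2 ≤ T0) (hb : ∀ t, T0 ≤ t → ‖pw (3 * c ^ 2) (zl c t)‖ ≤ 2 * ‖Y μ1 (zl c t)‖)
    (hb2 : ∀ t, T0 ≤ t → ‖Y μ1 (zl c t)‖ ≤ 2 * ‖pw (3 * c ^ 2) (zl c t)‖)
    {φ φ1 : ℂ → ℂ} (hφ : IsSol ((3 * c ^ 2 : ℝ) : ℂ) ((μ1 + 2 * c ^ 3 : ℝ) : ℂ) φ φ1) :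
    ∃ C : ℝ, 0 ≤ C ∧ ∀ t, T0 ≤ t → ‖φ (zl c t)‖ * ‖pw (3 * c ^ 2) (zl c t)‖ ≤ C * t ^ (-3 / 2 : ℝ) := by
  have hc := H.hc
  set p := fun t : ℝ => pw (3 * c ^ 2) (zl c t) with hp
  have hpn : ∀ t, 0 < ‖p t‖ := fun t => norm_pos_iff.2 (pw_ne _ _)
  have hy0 : ∀ t, T0 ≤ t → Y μ1 (zl c t) ≠ 0 := by
    intro t ht h
    have := hb t ht
    rw [h, norm_zero, mul_zero] at this
    exact absurd this (not_le.2 (hpn t))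
  set K := φ 0 * Y1 μ1 0 - φ1 0 * Y μ1 0 with hK
  set h : ℝ → ℂ := fun t => φ (zl c t) / Y μ1 (zl c t) with hh
  have dh : ∀ t, T0 ≤ t → HasDerivAt h (-I * K / Y μ1 (zl c t) ^ 2) t := by
    intro t ht
    refine ((hd_vert (hφ.1 (zl c t))).fun_div (hd_vert ((H.sol μ1).1 (zl c t))) (hy0 t ht)).congr_deriv ?_
    rw [hK, hφ.wronsk (H.sol μ1) 0 (zl c t)]
    congr 1; ring
  set F : ℝ → ℝ := fun t => t ^ (-3 / 2 : ℝ) / normSq (p t) with hF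
  have hF' := pw_grow hc
  choose! F' hF1 hF2 using hF'
  have hFpos : ∀ t, 2 ≤ t → 0 < F t := by
    intro t ht
    have := normSq_pos.2 (pw_ne (3 * c ^ 2) (zl c t))
    simp only [hF, hp]
    positivity
  have bar : ∀ t, T0 ≤ t → ‖h T0 - h t‖ ≤ 8 * ‖K‖ * F t - 8 * ‖K‖ * F T0 := by
    intro t ht
    have := barrier (f := h) (B := fun t => -(8 * ‖K‖ * F t)) (f' := fun t => -I * K / Y μ1 (zl c t) ^ 2)
      (B' := fun t => -(8 * ‖K‖ * F' t)) ht
      (fun s hs => (dh s hs.1).continuousAt.continuousWithinAt)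
      (fun s hs => (((hF1 s (hT.trans hs.1)).const_mul _).fun_neg).continuousAt.continuousWithinAt)
      (fun s hs => dh s hs.1.le) (fun s hs => ((hF1 s (hT.trans hs.1.le)).const_mul _).fun_neg) ?_
    · simpa [sub_eq_add_neg, add_comm] using this
    · intro s hs
      have h1 := hF2 s (hT.trans hs.1.le)
      have h2 := hb s hs.1.le
      rw [neg_neg, norm_div, norm_mul, norm_neg, norm_I, one_mul, norm_pow]
      have h3 : ‖K‖ / ‖Y μ1 (zl c s)‖ ^ 2 ≤ 8 * ‖K‖ * (1 / 2 / normSq (pw (3 * c ^ 2) (zl c s))) := by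
        rw [normSq_eq_norm_sq]
        have h4 : 0 < ‖Y μ1 (zl c s)‖ := norm_pos_iff.2 (hy0 s hs.1.le)
        have h5 := hpn s
        simp only [hp] at h5
        rw [show 8 * ‖K‖ * (1 / 2 / ‖pw (3 * c ^ 2) (zl c s)‖ ^ 2) = ‖K‖ * 4 / ‖pw (3 * c ^ 2) (zl c s)‖ ^ 2 by ring,
          div_le_div_iff₀ (by positivity) (by positivity)]
        have : ‖pw (3 * c ^ 2) (zl c s)‖ ^ 2 ≤ (2 * ‖Y μ1 (zl c s)‖) ^ 2 := by gcongr
        nlinarith [norm_nonneg K]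
      refine h3.trans ?_
      gcongr
  have hFm : ∀ t, T0 ≤ t → F T0 ≤ F t := by
    intro t ht
    have hm : MonotoneOn F (Ici T0) := by
      refine monotoneOn_of_hasDerivWithinAt_nonneg (convex_Ici T0)
        (fun s hs => (hF1 s (hT.trans hs)).continuousAt.continuousWithinAt)
        (f' := F') (fun s hs => (hF1 s (hT.trans (by rw [interior_Ici] at hs; exact le_of_lt hs))).hasDerivWithinAt) ?_
      intro s hs
      rw [interior_Ici] at hs
      refine le_trans ?_ (hF2 s (hT.trans (le_of_lt hs)))
      have := normSq_nonneg (pw (3 * c ^ 2) (zl c s))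
      positivity
    exact hm (mem_Ici.2 le_rfl) ht ht
  have hFT := hFpos T0 hT
  refine ⟨2 * (‖h T0‖ / F T0 + 8 * ‖K‖), by positivity, ?_⟩
  intro t ht
  have h1 : ‖h t‖ ≤ (‖h T0‖ / F T0 + 8 * ‖K‖) * F t := by
    have h2 := bar t ht
    have h3 := norm_sub_norm_le (h t) (h T0)
    rw [norm_sub_rev] at h3
    have h4 : ‖h T0‖ ≤ ‖h T0‖ / F T0 * F t := by
      rw [div_mul_eq_mul_div, le_div_iff₀ hFT]
      have := hFm t ht
      gcongr
    have h5 : 0 ≤ 8 * ‖K‖ * F T0 := by positivity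
    nlinarith
  have e1 : φ (zl c t) = h t * Y μ1 (zl c t) := by simp only [hh]; rw [div_mul_cancel₀ _ (hy0 t ht)]
  rw [e1, norm_mul]
  have h6 := hb2 t ht
  have h7 := hpn t
  have hC0 : 0 ≤ ‖h T0‖ / F T0 + 8 * ‖K‖ := by positivity
  calc ‖h t‖ * ‖Y μ1 (zl c t)‖ * ‖pw (3 * c ^ 2) (zl c t)‖ ≤ (‖h T0‖ / F T0 + 8 * ‖K‖) * F t * (2 * ‖p t‖) * ‖p t‖ := by
        have := hFpos t (hT.trans ht)
        gcongr
    _ = _ := by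
        have eF : F t * ‖p t‖ ^ 2 = t ^ (-3 / 2 : ℝ) := by
          simp only [hF]
          rw [normSq_eq_norm_sq]
          field_simp
        rw [← eF]; ring

end CubicPT

namespace CubicPT
open Topology Set MeasureTheory

variable {c : ℝ} {Y Y1 : ℝ → ℂ → ℂ}

lemma Canon.tend_line (H : Canon c Y Y1) (μ : ℝ) :
    Tendsto (fun t => Y μ (zl c t) / pw (3 * c ^ 2) (zl c t)) atTop (𝓝 1) :=
  bnd_tendsto (y1 := Y1 μ) (ρ := |μ + 2 * c ^ 3| + ((3 * c ^ 2) ^ 2 + 3 * c ^ 2 + 2)) (fun τ h1 h2 =>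
    H.bnd μ _ le_rfl _ (by simpa using H.hc) (by simpa using h1) h2)

lemma Canon.deriv_formula (H : Canon c Y Y1) (μ1 b : ℝ)
    {φ φ1 : ℂ → ℂ} (hφ : IsSol ((3 * c ^ 2 : ℝ) : ℂ) ((μ1 + 2 * c ^ 3 : ℝ) : ℂ) φ φ1)
    (h0 : φ (zl c b) = 0) (h1 : φ1 (zl c b) = -I) :
    IntegrableOn (fun t => φ (zl c t) * Y μ1 (zl c t)) (Ioi b) ∧
    HasDerivAt (fun μ => Y μ (zl c b)) (-∫ t in Ioi b, φ (zl c t) * Y μ1 (zl c t)) μ1 := by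
  obtain ⟨ρ, T0, hρ, hT2, hbT, hl⟩ := H.line μ1 b
  have hl1 := hl μ1 (by simp)
  obtain ⟨C, hC0, hC⟩ := H.phi_bound hT2 (fun t ht => (hl1 t ht).1) (fun t ht => (hl1 t ht).2.1) hφ
  have cφ : Continuous φ := continuous_iff_continuousAt.2 fun z => (hφ.1 z).continuousAt
  have czl : Continuous (fun t : ℝ => zl c t) := by unfold zl; fun_prop
  have cF : Continuous (fun q : ℝ × ℝ => φ (zl c q.2) * Y q.1 (zl c q.2)) :=
    (cφ.comp (czl.comp continuous_snd)).mul (H.cont.comp (continuous_fst.prodMk (czl.comp continuous_snd)))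
  have cFm : ∀ μ, Continuous (fun t : ℝ => φ (zl c t) * Y μ (zl c t)) := fun μ =>
    cF.comp (Continuous.prodMk continuous_const continuous_id)
  obtain ⟨D, hD⟩ := ((isCompact_Icc (a := μ1 - 1) (b := μ1 + 1)).prod (isCompact_Icc (a := b) (b := T0))).exists_bound_of_continuousOn
    cF.continuousOn
  set g : ℝ → ℝ := fun t => if t ≤ T0 then D else 2 * C * t ^ (-3 / 2 : ℝ) with hg
  have hgi : IntegrableOn g (Ioi b) := by
    rw [← Ioc_union_Ioi_eq_Ioi hbT]
    refine IntegrableOn.union ?_ ?_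
    · have : IntegrableOn (fun _ : ℝ => D) (Ioc b T0) := by
        exact integrableOn_const (by simp) (by simp)
      refine this.congr_fun (fun t ht => ?_) measurableSet_Ioc
      simp only [hg]; rw [if_pos ht.2]
    · have := (integrableOn_Ioi_rpow_of_lt (a := (-3 / 2 : ℝ)) (c := T0) (by norm_num) (by linarith)).const_mul (2 * C)
      refine IntegrableOn.congr_fun (f := fun t => 2 * C * t ^ (-3 / 2 : ℝ)) this (fun t ht => ?_) measurableSet_Ioi
      simp only [hg]; rw [if_neg (not_le.2 ht)]
  have bd : ∀ μ, |μ - μ1| ≤ 1 → ∀ t ∈ Ioi b, ‖φ (zl c t) * Y μ (zl c t)‖ ≤ g t := by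
    intro μ hμ t ht
    by_cases htT : t ≤ T0
    · simp only [hg]; rw [if_pos htT]
      have := abs_le.1 hμ
      exact hD (μ, t) ⟨⟨by linarith, by linarith⟩, ⟨le_of_lt ht, htT⟩⟩
    · simp only [hg]; rw [if_neg htT]
      push Not at htT
      have e1 := (hl μ hμ t htT.le).2.1
      have e2 := hC t htT.le
      rw [norm_mul]
      calc _ ≤ ‖φ (zl c t)‖ * (2 * ‖pw (3 * c ^ 2) (zl c t)‖) := by gcongr
        _ ≤ _ := by linarith
  have hintg : ∀ μ, |μ - μ1| ≤ 1 → IntegrableOn (fun t => φ (zl c t) * Y μ (zl c t)) (Ioi b) := by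
    intro μ hμ
    refine Integrable.mono' hgi (cFm μ).aestronglyMeasurable ?_
    exact (ae_restrict_iff' measurableSet_Ioi).2 (Eventually.of_forall fun t ht => bd μ hμ t ht)
  refine ⟨hintg μ1 (by simp), ?_⟩
  -- Wronskian constant
  have hKc : ∀ t, φ (zl c t) * Y1 μ1 (zl c t) - φ1 (zl c t) * Y μ1 (zl c t) = I * Y μ1 (zl c b) := by
    intro t
    rw [hφ.wronsk (H.sol μ1) (zl c t) (zl c b), h0, h1]; ring
  have main : ∀ μ, |μ - μ1| ≤ 1 → Y μ (zl c b) - Y μ1 (zl c b) = -((μ - μ1 : ℝ) : ℂ) * ∫ t in Ioi b, φ (zl c t) * Y μ (zl c t) := by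
    intro μ hμ
    set G : ℝ → ℂ := fun t => φ (zl c t) * Y1 μ (zl c t) - φ1 (zl c t) * Y μ (zl c t) with hG
    have dG : ∀ t, HasDerivAt G (I * ((μ - μ1 : ℝ) : ℂ) * (φ (zl c t) * Y μ (zl c t))) t := by
      intro t
      refine (((hd_vert (hφ.1 (zl c t))).fun_mul (hd_vert ((H.sol μ).2 (zl c t)))).fun_sub
        ((hd_vert (hφ.2 (zl c t))).fun_mul (hd_vert ((H.sol μ).1 (zl c t))))).congr_deriv ?_
      unfold V; push_cast; ring
    have lG : Tendsto G atTop (𝓝 (I * Y μ1 (zl c b))) := by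
      have r1 := (H.tend_line μ).div (H.tend_line μ1) one_ne_zero
      have r2 : Tendsto (fun t => I * Y μ1 (zl c b) * (Y μ (zl c t) / pw (3 * c ^ 2) (zl c t) / (Y μ1 (zl c t) / pw (3 * c ^ 2) (zl c t)))) atTop
          (𝓝 (I * Y μ1 (zl c b) * (1 / 1))) := r1.const_mul _
      have r3 : Tendsto (fun t : ℝ => 16 * ρ * (C * t ^ (-3 / 2 : ℝ))) atTop (𝓝 0) := by
        have := ((tendsto_rpow_neg_atTop (y := (3 / 2 : ℝ)) (by norm_num)).const_mul C).const_mul (16 * ρ)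
        simp only [mul_zero] at this
        rw [show (-3 / 2 : ℝ) = -(3 / 2) by norm_num]; exact this
      have r4 : Tendsto (fun t => φ (zl c t) * ((Y1 μ (zl c t) * Y μ1 (zl c t) - Y μ (zl c t) * Y1 μ1 (zl c t)) / Y μ1 (zl c t))) atTop (𝓝 0) := by
        rw [tendsto_zero_iff_norm_tendsto_zero]
        refine squeeze_zero' (Eventually.of_forall fun _ => norm_nonneg _) ?_ r3
        filter_upwards [eventually_ge_atTop T0] with t ht
        obtain ⟨a1, a2, a3⟩ := hl μ hμ t ht
        obtain ⟨b1, b2, b3⟩ := hl1 t ht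
        have hcc := hC t ht
        set P := ‖pw (3 * c ^ 2) (zl c t)‖ with hP
        have hPp : 0 < P := norm_pos_iff.2 (pw_ne _ _)
        have hy : 0 < ‖Y μ1 (zl c t)‖ := by linarith
        rw [norm_mul, norm_div]
        have e1 : Y1 μ (zl c t) * Y μ1 (zl c t) - Y μ (zl c t) * Y1 μ1 (zl c t) =
          (Y1 μ (zl c t) - qw (3 * c ^ 2) (zl c t) * Y μ (zl c t)) * Y μ1 (zl c t) -
            Y μ (zl c t) * (Y1 μ1 (zl c t) - qw (3 * c ^ 2) (zl c t) * Y μ1 (zl c t)) := by ring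
        have e2 : ‖Y1 μ (zl c t) * Y μ1 (zl c t) - Y μ (zl c t) * Y1 μ1 (zl c t)‖ ≤ 8 * ρ * P ^ 2 := by
          rw [e1]
          refine (norm_sub_le _ _).trans ?_
          rw [norm_mul, norm_mul]
          have := mul_le_mul a3 b2 (norm_nonneg _) (by positivity)
          have := mul_le_mul a2 b3 (norm_nonneg _) (by positivity)
          nlinarith
        have e3 : ‖Y1 μ (zl c t) * Y μ1 (zl c t) - Y μ (zl c t) * Y1 μ1 (zl c t)‖ / ‖Y μ1 (zl c t)‖ ≤ 16 * ρ * P := by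
          rw [div_le_iff₀ hy]
          refine e2.trans ?_
          have := mul_le_mul_of_nonneg_left b1 (by positivity : 0 ≤ 8 * ρ * P)
          nlinarith
        calc _ ≤ ‖φ (zl c t)‖ * (16 * ρ * P) := by gcongr
          _ = 16 * ρ * (‖φ (zl c t)‖ * P) := by ring
          _ ≤ _ := by gcongr
      have r5 := r4.add r2
      simp only [div_one, mul_one, zero_add] at r5
      refine r5.congr' ?_
      filter_upwards [eventually_ge_atTop T0] with t ht
      have hPp : pw (3 * c ^ 2) (zl c t) ≠ 0 := pw_ne _ _
      have hy : Y μ1 (zl c t) ≠ 0 := by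
        have := (hl1 t ht).1
        have := norm_pos_iff.2 hPp
        rw [← norm_pos_iff]; linarith
      simp only [hG]
      have := hKc t
      rw [← this]
      field_simp
      ring
    have hI := integral_Ioi_of_hasDerivAt_of_tendsto (f := G) (a := b) (dG b).continuousAt.continuousWithinAt
      (fun t _ => dG t) ((hintg μ hμ).const_mul _) lG
    rw [integral_const_mul] at hI
    have e3 : G b = I * Y μ (zl c b) := by simp only [hG]; rw [h0, h1]; ring
    rw [e3] at hI
    apply mul_left_cancel₀ I_ne_zero
    linear_combination hI
  rw [hasDerivAt_iff_tendsto_slope]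
  have hev : ∀ᶠ μ in 𝓝[≠] μ1, |μ - μ1| ≤ 1 := by
    apply mem_nhdsWithin_of_mem_nhds
    filter_upwards [Metric.closedBall_mem_nhds μ1 one_pos] with μ hμ
    simpa [Real.dist_eq] using hμ
  have dc : Tendsto (fun μ => ∫ t in Ioi b, φ (zl c t) * Y μ (zl c t)) (𝓝[≠] μ1) (𝓝 (∫ t in Ioi b, φ (zl c t) * Y μ1 (zl c t))) := by
    refine tendsto_integral_filter_of_dominated_convergence g ?_ ?_ hgi ?_
    · exact Eventually.of_forall fun μ => (cFm μ).aestronglyMeasurable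
    · filter_upwards [hev] with μ hμ
      exact (ae_restrict_iff' measurableSet_Ioi).2 (Eventually.of_forall fun t ht => bd μ hμ t ht)
    · refine Eventually.of_forall fun t => ?_
      have : Continuous (fun μ => φ (zl c t) * Y μ (zl c t)) := cF.comp (continuous_id.prodMk continuous_const)
      exact (this.tendsto μ1).mono_left nhdsWithin_le_nhds
  refine dc.neg.congr' ?_
  filter_upwards [hev, self_mem_nhdsWithin] with μ hμ hne
  have hne' : ((μ - μ1 : ℝ) : ℂ) ≠ 0 := by
    rw [Ne, ofReal_eq_zero, sub_eq_zero]; exact hne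
  rw [slope_def_module, main μ hμ, Complex.real_smul, ofReal_inv]
  field_simp

lemma Canon.phase (H : Canon c Y Y1) (μ : ℝ) {b : ℝ} (hb : 0 ≤ b) :
    ∃ E', HasDerivAt (fun μ => Y μ (zl c b)) E' μ ∧ 0 < (E' / Y μ (zl c b)).im := by
  obtain ⟨φ, φ1, hφ, h0, h1⟩ := exists_sol ((3 * c ^ 2 : ℝ) : ℂ) ((μ + 2 * c ^ 3 : ℝ) : ℂ) (zl c b) 0 (-I)
  obtain ⟨hi, hd⟩ := H.deriv_formula μ b hφ h0 h1
  refine ⟨_, hd, ?_⟩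
  have hY : ∀ t, 0 ≤ t → (fe (Y μ) (Y1 μ) (zl c t)).re < 0 := by
    intro t ht
    have := H.e5a (μ := μ) (X := 0) ht (by simp; positivity)
    simpa using this
  have hYb : Y μ (zl c b) ≠ 0 := fe_ne (y1 := Y1 μ) (fun h => by have := hY b hb; rw [h] at this; simp at this)
  have hKc : ∀ t, φ (zl c t) * Y1 μ (zl c t) - φ1 (zl c t) * Y μ (zl c t) = I * Y μ (zl c b) := by
    intro t
    rw [hφ.wronsk (H.sol μ) (zl c t) (zl c b), h0, h1]; ring
  have hφm : ∀ t, b ≤ t → 0 ≤ (fe φ φ1 (zl c t)).re := by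
    intro t ht
    have hm : MonotoneOn (fun t => (fe φ φ1 (zl c t)).re) (Ici b) := by
      refine monotoneOn_of_hasDerivWithinAt_nonneg (convex_Ici b)
        (fun s hs => (hd_re (fe_vert hφ c s)).continuousAt.continuousWithinAt)
        (fun s hs => (hd_re (fe_vert hφ c s)).hasDerivWithinAt) ?_
      intro s hs
      rw [interior_Ici] at hs
      have hs' : b < s := hs
      have e := VV_im c μ 0 s
      rw [add_zero, VV] at e
      simp only [mul_re, I_re, I_im, sub_im, im_mul_ofReal, ofReal_im, e, zero_mul, one_mul, sub_zero, zero_sub]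
      have : 0 < s := by linarith
      have := normSq_nonneg (φ (zl c s))
      have : 0 ≤ s ^ 3 * normSq (φ (zl c s)) := by positivity
      nlinarith
    have := hm (mem_Ici.2 le_rfl) ht ht
    have e0 : (fe φ φ1 (zl c b)).re = 0 := by simp [fe, h0]
    simp only [e0] at this
    exact this
  set u : ℝ → ℝ := fun t => -((φ (zl c t) * Y μ (zl c t)) * (starRingEnd ℂ) (Y μ (zl c b))).im with hu
  have huv : ∀ t, u t = normSq (Y μ (zl c t)) * (fe φ φ1 (zl c t)).re - normSq (φ (zl c t)) * (fe (Y μ) (Y1 μ) (zl c t)).re := by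
    intro t
    have e1 : (starRingEnd ℂ) (Y μ (zl c b)) = (starRingEnd ℂ) (-I * (φ (zl c t) * Y1 μ (zl c t) - φ1 (zl c t) * Y μ (zl c t))) := by
      congr 1
      rw [hKc]; ring_nf; simp
    simp only [hu]
    rw [e1]
    unfold fe
    simp only [normSq_apply, mul_re, mul_im, conj_re, conj_im, sub_re, sub_im, neg_re, neg_im, I_re, I_im]
    ring
  have hup : ∀ t, b < t → 0 ≤ u t := by
    intro t ht
    rw [huv]
    have a1 := mul_nonneg (normSq_nonneg (Y μ (zl c t))) (hφm t ht.le)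
    have a2 := mul_nonneg (normSq_nonneg (φ (zl c t))) (neg_nonneg.2 (hY t (hb.trans ht.le)).le)
    linarith
  have hui : IntegrableOn u (Ioi b) := by
    have := (hi.mul_const ((starRingEnd ℂ) (Y μ (zl c b)))).im.neg
    exact this
  have hpos : 0 < ∫ t in Ioi b, u t := by
    rw [setIntegral_pos_iff_support_of_nonneg_ae ((ae_restrict_iff' measurableSet_Ioi).2 (Eventually.of_forall hup)) hui]
    have hne : ∀ᶠ t in 𝓝[≠] b, φ (zl c t) ≠ 0 := (hd_vert (hφ.1 (zl c b))).eventually_ne (by rw [h1]; simp)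
    have hne2 : ∀ᶠ t in 𝓝[>] b, φ (zl c t) ≠ 0 := hne.filter_mono (nhdsWithin_mono _ (fun t ht => ne_of_gt ht))
    obtain ⟨d, hd1, hd2⟩ := (mem_nhdsGT_iff_exists_Ioo_subset).1 hne2
    have hsub : Ioo b d ⊆ Function.support u ∩ Ioi b := by
      intro t ht
      refine ⟨?_, ht.1⟩
      have a0 := hd2 ht
      have a1 := mul_nonneg (normSq_nonneg (Y μ (zl c t))) (hφm t ht.1.le)
      have a2 := mul_pos (normSq_pos.2 a0) (neg_pos.2 (hY t (hb.trans ht.1.le)))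
      rw [Function.mem_support, huv]
      intro h; linarith
    refine lt_of_lt_of_le ?_ (measure_mono hsub)
    rw [Real.volume_Ioo]
    simpa using hd1
  have e5 : ∫ t in Ioi b, u t = ((-∫ t in Ioi b, φ (zl c t) * Y μ (zl c t)) * (starRingEnd ℂ) (Y μ (zl c b))).im := by
    rw [neg_mul, ← integral_mul_const, Complex.neg_im]
    simp only [hu]
    rw [integral_neg]
    congr 1
    exact integral_im (𝕜 := ℂ) (hi.mul_const ((starRingEnd ℂ) (Y μ (zl c b))))
  rw [e5] at hpos
  rw [div_eq_mul_inv, Complex.inv_def, ← mul_assoc, im_mul_ofReal]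
  have := normSq_pos.2 hYb
  positivity

end CubicPT

namespace CubicPT
open Topology Set

variable {c : ℝ} {Y Y1 : ℝ → ℂ → ℂ}

lemma lift_deriv {L E : ℝ → ℂ} {t0 : ℝ} {E' : ℂ} (hL : ContinuousAt L t0) (hE : ∀ᶠ t in 𝓝 t0, exp (L t) = E t)
    (hd : HasDerivAt E E' t0) : HasDerivAt L (E' / E t0) t0 := by
  have h0 : exp (L t0) = E t0 := hE.self_of_nhds
  have hE0 : E t0 ≠ 0 := by rw [← h0]; exact exp_ne_zero _
  have h1 : HasDerivAt (fun t => E t / E t0) (E' / E t0) t0 := hd.div_const _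
  have h2 := h1.clog_real (by rw [div_self hE0]; exact one_mem_slitPlane)
  rw [div_self hE0, div_one] at h2
  have h3 := h2.const_add (L t0)
  refine h3.congr_of_eventuallyEq ?_
  have hc : Tendsto (fun t => (L t - L t0).im) (𝓝 t0) (𝓝 0) := by
    have h5 : Tendsto (fun t => L t - L t0) (𝓝 t0) (𝓝 (L t0 - L t0)) := Tendsto.sub hL tendsto_const_nhds
    have h6 := (Complex.continuous_im.tendsto _).comp h5
    rw [sub_self, Complex.zero_im] at h6
    exact h6
  filter_upwards [hE, hc.eventually (Ioo_mem_nhds (neg_lt_zero.2 Real.pi_pos) Real.pi_pos)] with t e1 e2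
  rw [← e1, ← h0, ← Complex.exp_sub, Complex.log_exp e2.1 e2.2.le]
  ring

lemma Canon.line_re (H : Canon c Y Y1) (μ : ℝ) {t : ℝ} (ht : 0 ≤ t) : (fe (Y μ) (Y1 μ) (zl c t)).re < 0 := by
  have := H.e5a (μ := μ) (X := 0) ht (by simp; positivity)
  simpa using this

lemma Canon.line_ne (H : Canon c Y Y1) (μ : ℝ) {t : ℝ} (ht : 0 ≤ t) : Y μ (zl c t) ≠ 0 :=
  fe_ne (y1 := Y1 μ) (fun h => by have := H.line_re μ ht; rw [h] at this; simp at this)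

lemma Canon.exists_lift (H : Canon c Y Y1) : ∃ L : ℝ → ℝ → ℂ, Continuous (fun q : ℝ × ℝ => L q.1 q.2) ∧
    (∀ μ t, 0 ≤ t → exp (L μ t) = Y μ (zl c t)) ∧ L 0 0 = log (Y 0 (zl c 0)) := by
  have cf : Continuous (fun q : ℝ × ℝ => Y q.1 (zl c |q.2|)) := by
    have czl : Continuous (fun t : ℝ => zl c t) := by unfold zl; fun_prop
    exact H.cont.comp (continuous_fst.prodMk (czl.comp (continuous_abs.comp continuous_snd)))
  have hne : ∀ q : ℝ × ℝ, Y q.1 (zl c |q.2|) ≠ 0 := fun q => H.line_ne q.1 (abs_nonneg _)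
  obtain ⟨F, ⟨hF1, hF2⟩, -⟩ := isCoveringMapOn_exp.existsUnique_continuousMap_lifts (⟨_, cf⟩ : C(ℝ × ℝ, ℂ))
    (a₀ := (0, 0)) (e₀ := log (Y 0 (zl c 0))) (by simp [exp_log (H.line_ne 0 le_rfl)]) (fun q => by simpa using hne q)
  refine ⟨fun μ t => F (μ, t), F.continuous, ?_, hF1⟩
  intro μ t ht
  have := congrFun hF2 (μ, t)
  simpa [abs_of_nonneg ht] using this

lemma Canon.phase_drop (H : Canon c Y Y1) {L : ℝ → ℝ → ℂ} (hc : Continuous (fun q : ℝ × ℝ => L q.1 q.2))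
    (hL : ∀ μ t, 0 ≤ t → exp (L μ t) = Y μ (zl c t)) {ω : ℝ} (hω : 0 < ω) :
    ω - (3 * c + 1) / ω - Real.pi ≤ (L (ω ^ 2) 0).im - (L (ω ^ 2) 1).im := by
  have hc0 := H.hc
  set μ := ω ^ 2 with hμ
  set y : ℝ → ℂ := fun t => Y μ (zl c t) with hy
  set v : ℝ → ℂ := fun t => Y μ (zl c t) - Y1 μ (zl c t) / ω with hv
  have hωc : (ω : ℂ) ≠ 0 := by exact_mod_cast hω.ne'
  have dv : ∀ t, HasDerivAt v (-I * ω * v t - I * (VV c 0 (zl c t)) * y t / ω) t := by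
    intro t
    refine ((hd_vert ((H.sol μ).1 (zl c t))).fun_sub ((hd_vert ((H.sol μ).2 (zl c t))).div_const (ω : ℂ))).congr_deriv ?_
    simp only [hv, hy]
    have : V ((3 * c ^ 2 : ℝ) : ℂ) ((μ + 2 * c ^ 3 : ℝ) : ℂ) (zl c t) = (ω : ℂ) ^ 2 + VV c 0 (zl c t) := by
      unfold VV V; rw [hμ]; push_cast; ring
    rw [this]
    field_simp
    ring
  have f1 : ∀ t, 0 ≤ t → 0 < (y t * (starRingEnd ℂ) (v t)).re := by
    intro t ht
    have h1 := H.line_re μ ht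
    have h2 := normSq_pos.2 (H.line_ne μ ht)
    have e : (y t * (starRingEnd ℂ) (v t)).re = normSq (Y μ (zl c t)) - (fe (Y μ) (Y1 μ) (zl c t)).re / ω := by
      simp only [hy, hv, fe, map_sub, map_div₀, conj_ofReal, normSq_apply, mul_re, sub_re, sub_im, conj_re, conj_im, div_ofReal_re, div_ofReal_im]
      field_simp
      ring
    rw [e]
    have := div_neg_of_neg_of_pos h1 hω
    linarith
  have v0 : ∀ t, 0 ≤ t → v t ≠ 0 := by
    intro t ht h
    have := f1 t ht
    rw [h] at this; simp at this
  have f2 : ∀ t, 0 ≤ t → ‖y t‖ ≤ ‖v t‖ := by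
    intro t ht
    have h1 := H.line_re μ ht
    have e : normSq (v t) = normSq (y t) + normSq (Y1 μ (zl c t)) / ω ^ 2 - 2 * (fe (Y μ) (Y1 μ) (zl c t)).re / ω := by
      simp only [hy, hv, fe, normSq_apply, mul_re, sub_re, sub_im, conj_re, conj_im, div_ofReal_re, div_ofReal_im]
      field_simp
      ring
    have h3 := div_neg_of_neg_of_pos h1 hω
    have h4 : 0 ≤ normSq (Y1 μ (zl c t)) / ω ^ 2 := div_nonneg (normSq_nonneg _) (by positivity)
    have : normSq (y t) ≤ normSq (v t) := by rw [e, mul_div_assoc]; linarith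
    rw [normSq_eq_norm_sq, normSq_eq_norm_sq] at this
    exact le_of_sq_le_sq this (norm_nonneg _)
  have re0 : ∀ t, 0 ≤ t → 0 < (y t / v t).re := by
    intro t ht
    rw [div_eq_mul_inv, Complex.inv_def, ← mul_assoc, re_mul_ofReal]
    have := f1 t ht
    have := normSq_pos.2 (v0 t ht)
    positivity
  have dy : ∀ t, HasDerivAt y (Y1 μ (zl c t) * I) t := fun t => hd_vert ((H.sol μ).1 (zl c t))
  have cL : Continuous (fun t => L μ t) := hc.comp (continuous_const.prodMk continuous_id)
  set Λ : ℝ → ℂ := fun t => L μ t - log (y t / v t) with hΛ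
  have cΛ : ContinuousOn Λ (Icc 0 1) := by
    intro t ht
    have q1 : ContinuousAt (fun s => y s / v s) t := ContinuousAt.div (dy t).continuousAt (dv t).continuousAt (v0 t ht.1)
    have q2 : ContinuousAt (fun s => log (y s / v s)) t := q1.clog (Or.inl (re0 t ht.1))
    exact (ContinuousAt.sub cL.continuousAt q2).continuousWithinAt
  have dΛ : ∀ t ∈ Ioo (0:ℝ) 1, HasDerivAt Λ ((-I * ω * v t - I * (VV c 0 (zl c t)) * y t / ω) / v t) t := by
    intro t ht
    refine lift_deriv (cΛ.continuousAt (Icc_mem_nhds ht.1 ht.2)) ?_ (dv t)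
    filter_upwards [lt_mem_nhds ht.1] with s hs
    have hys : y s ≠ 0 := H.line_ne μ (le_of_lt hs)
    have hvs := v0 s (le_of_lt hs)
    simp only [hΛ]
    rw [Complex.exp_sub, hL μ s (le_of_lt hs), exp_log (div_ne_zero hys hvs)]
    change y s / _ = _
    field_simp
  have ha : AntitoneOn (fun t => (Λ t).im + (ω - (3 * c + 1) / ω) * t) (Icc 0 1) := by
    refine antitoneOn_of_hasDerivWithinAt_nonpos (convex_Icc _ _) ?_
      (f' := fun t => ((-I * ω * v t - I * (VV c 0 (zl c t)) * y t / ω) / v t).im + (ω - (3 * c + 1) / ω)) ?_ ?_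
    · exact (Complex.continuous_im.comp_continuousOn cΛ).add (by fun_prop)
    · intro t ht
      rw [interior_Icc] at ht
      have := (hd_im (dΛ t ht)).fun_add ((hasDerivAt_id t).const_mul (ω - (3 * c + 1) / ω))
      simp only [id, mul_one] at this
      exact this.hasDerivWithinAt
    · intro t ht
      rw [interior_Icc] at ht
      have hvt := v0 t ht.1.le
      have e1 : (-I * ω * v t - I * (VV c 0 (zl c t)) * y t / ω) / v t = -I * ω - I * (VV c 0 (zl c t)) * (y t / v t) / ω := by
        field_simp
      rw [e1]
      have n1 : ‖I * (VV c 0 (zl c t)) * (y t / v t) / ω‖ ≤ (3 * c + 1) / ω := by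
        rw [norm_div, norm_mul, norm_mul, norm_I, one_mul, norm_div, Complex.norm_real, Real.norm_eq_abs, abs_of_pos hω]
        have m1 : ‖VV c 0 (zl c t)‖ ≤ 3 * c + 1 := by
          refine (Complex.norm_le_abs_re_add_abs_im _).trans ?_
          have r1 := VV_re c 0 0 t
          have r2 := VV_im c 0 0 t
          rw [add_zero] at r1 r2
          rw [r1, r2]
          have ht2 : t ^ 2 ≤ 1 := pow_le_one₀ ht.1.le ht.2.le
          have ht3 : t ^ 3 ≤ 1 := pow_le_one₀ ht.1.le ht.2.le
          have ht30 : 0 ≤ t ^ 3 := pow_nonneg ht.1.le 3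
          rw [show (0:ℝ) ^ 3 + 3 * c * 0 ^ 2 + 0 - 3 * (0 + c) * t ^ 2 = -(3 * c * t ^ 2) by ring, abs_neg, abs_of_nonneg (by positivity),
            show t * (3 * 0 * (0 + 2 * c) - t ^ 2) = - t ^ 3 by ring, abs_neg, abs_of_nonneg ht30]
          nlinarith
        have m2 : ‖y t‖ / ‖v t‖ ≤ 1 := div_le_one_of_le₀ (f2 t ht.1.le) (norm_nonneg _)
        gcongr
        calc _ ≤ (3 * c + 1) * 1 := by gcongr
          _ = _ := mul_one _
      have n2 := (Complex.abs_im_le_norm (I * (VV c 0 (zl c t)) * (y t / v t) / ω)).trans n1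
      have n3 := (abs_le.1 n2).1
      rw [sub_im]
      have : (-I * (ω:ℂ)).im = -ω := by simp
      rw [this]
      linarith
  have h01 := ha ⟨le_rfl, zero_le_one⟩ ⟨zero_le_one, le_rfl⟩ zero_le_one
  simp only [hΛ, sub_im, mul_zero, add_zero, mul_one, log_im] at h01
  have a0 := Complex.abs_arg_le_pi_div_two_iff.2 (re0 0 le_rfl).le
  have a1 := Complex.abs_arg_le_pi_div_two_iff.2 (re0 1 zero_le_one).le
  have a0' := abs_le.1 a0
  have a1' := abs_le.1 a1
  linarith [a0'.1, a1'.2]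

/-- the phase function -/
lemma Canon.exists_phase (H : Canon c Y Y1) : ∃ ψ : ℝ → ℝ, StrictMono ψ ∧ Continuous ψ ∧ Tendsto ψ atTop atTop ∧
    (∀ μ, ∃ r : ℝ, 0 < r ∧ Y μ c = r * exp (ψ μ * I)) ∧ ψ 0 = arg (Y 0 c) := by
  obtain ⟨L, hc, hL, h0⟩ := H.exists_lift
  have mono : ∀ b, 0 ≤ b → StrictMono (fun μ => (L μ b).im) := by
    intro b hb
    have hcb : Continuous (fun μ => L μ b) := hc.comp (continuous_id.prodMk continuous_const)
    have hd : ∀ μ, ∃ d, HasDerivAt (fun μ => (L μ b).im) d μ ∧ 0 < d := by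
      intro μ
      obtain ⟨E', h1, h2⟩ := H.phase μ hb
      exact ⟨_, hd_im (lift_deriv hcb.continuousAt (Eventually.of_forall fun μ => hL μ b hb) h1), h2⟩
    choose d hd1 hd2 using hd
    refine strictMono_of_deriv_pos (fun μ => ?_)
    rw [(hd1 μ).deriv]; exact hd2 μ
  have hc0 : Continuous (fun μ => (L μ 0).im) := Complex.continuous_im.comp (hc.comp (continuous_id.prodMk continuous_const))
  refine ⟨fun μ => (L μ 0).im, mono 0 le_rfl, hc0, ?_, ?_, ?_⟩
  · have key : ∀ ω, 1 ≤ ω → ω + (-(3 * c + 1) - Real.pi + (L 0 1).im) ≤ (L (ω ^ 2) 0).im := by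
      intro ω hω
      have h1 := H.phase_drop hc hL (by linarith : 0 < ω)
      have h2 : (L 0 1).im ≤ (L (ω ^ 2) 1).im := (mono 1 zero_le_one).monotone (by positivity : (0:ℝ) ≤ ω ^ 2)
      have h3 : (3 * c + 1) / ω ≤ 3 * c + 1 := div_le_self (by have := H.hc; positivity) hω
      linarith
    refine tendsto_atTop_mono' atTop (f₁ := fun μ => Real.sqrt μ + (-(3 * c + 1) - Real.pi + (L 0 1).im)) ?_
      (tendsto_atTop_add_const_right _ _ Real.tendsto_sqrt_atTop)
    filter_upwards [eventually_ge_atTop 1] with μ hμ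
    have := key (Real.sqrt μ) (Real.one_le_sqrt.2 hμ)
    rwa [Real.sq_sqrt (by linarith)] at this
  · intro μ
    refine ⟨Real.exp (L μ 0).re, Real.exp_pos _, ?_⟩
    have := hL μ 0 le_rfl
    rw [zl_zero] at this
    rw [← this, Complex.ofReal_exp, ← Complex.exp_add, Complex.re_add_im]
  · simp only [h0, log_im, zl_zero]

end CubicPT

namespace CubicPT
open Topology Set

variable {c : ℝ} {Y Y1 : ℝ → ℂ → ℂ}

lemma real_bound {f f1 g g1 V : ℝ → ℝ} {κ x2 : ℝ} (hκ : 0 < κ) (hf : ∀ x, HasDerivAt f (f1 x) x)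
    (hf1 : ∀ x, HasDerivAt f1 (V x * f x) x) (hg : ∀ x, HasDerivAt g (g1 x) x)
    (hw : ∀ x, f1 x * g x - f x * g1 x = κ) (hV : ∀ x, x2 ≤ x → 0 ≤ V x) (h0 : f x2 = 0) :
    ∃ M : ℝ, ∀ x, x2 + 1 ≤ x → |g x| ≤ M * |f x| := by
  set d := f1 x2 with hd
  have d0 : 0 < d ^ 2 := by
    have := hw x2
    rw [h0, zero_mul, sub_zero] at this
    have : d ≠ 0 := by rintro h; rw [← hd, h] at this; simp at this; linarith
    positivity
  have cv : Convex ℝ (Ici x2) := convex_Ici _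
  have cf : Continuous f := continuous_iff_continuousAt.2 fun x => (hf x).continuousAt
  have cf1 : Continuous f1 := continuous_iff_continuousAt.2 fun x => (hf1 x).continuousAt
  have s1 : ∀ x, x2 ≤ x → 0 ≤ f x * f1 x := by
    have m : MonotoneOn (fun x => f x * f1 x) (Ici x2) := by
      refine monotoneOn_of_hasDerivWithinAt_nonneg cv (cf.mul cf1).continuousOn
        (fun x hx => ((hf x).fun_mul (hf1 x)).hasDerivWithinAt) ?_
      intro x hx
      rw [interior_Ici] at hx
      have := hV x (le_of_lt hx)
      have e : f1 x * f1 x + f x * (V x * f x) = f1 x ^ 2 + V x * f x ^ 2 := by ring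
      rw [e]; positivity
    intro x hx
    have := m (mem_Ici.2 le_rfl) hx hx
    simpa [h0] using this
  have s2 : ∀ x, x2 ≤ x → d ^ 2 ≤ f1 x ^ 2 := by
    have m : MonotoneOn (fun x => f1 x ^ 2) (Ici x2) := by
      refine monotoneOn_of_hasDerivWithinAt_nonneg cv (cf1.pow 2).continuousOn
        (fun x hx => ((hf1 x).fun_pow 2).hasDerivWithinAt) ?_
      intro x hx
      rw [interior_Ici] at hx
      have h1 := hV x (le_of_lt hx)
      have h2 := s1 x (le_of_lt hx)
      have := mul_nonneg h1 h2
      norm_num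
      nlinarith
    intro x hx
    exact m (mem_Ici.2 le_rfl) hx hx
  have s3 : ∀ x, x2 ≤ x → d ^ 2 * (x - x2) ≤ f x * f1 x := by
    have m : MonotoneOn (fun x => f x * f1 x - d ^ 2 * (x - x2)) (Ici x2) := by
      refine monotoneOn_of_hasDerivWithinAt_nonneg cv ((cf.mul cf1).sub (by fun_prop)).continuousOn
        (fun x hx => (((hf x).fun_mul (hf1 x)).fun_sub (((hasDerivAt_id x).sub_const x2).const_mul (d ^ 2))).hasDerivWithinAt) ?_
      intro x hx
      rw [interior_Ici] at hx
      have h1 := hV x (le_of_lt hx)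
      have h2 := s2 x (le_of_lt hx)
      have := mul_nonneg h1 (sq_nonneg (f x))
      nlinarith
    intro x hx
    have := m (mem_Ici.2 le_rfl) hx hx
    simp [h0] at this
    linarith
  have s4 : ∀ x, x2 ≤ x → d ^ 2 * (x - x2) ^ 2 ≤ f x ^ 2 := by
    have m : MonotoneOn (fun x => f x ^ 2 - d ^ 2 * (x - x2) ^ 2) (Ici x2) := by
      refine monotoneOn_of_hasDerivWithinAt_nonneg cv ((cf.pow 2).sub (by fun_prop)).continuousOn
        (fun x hx => (((hf x).fun_pow 2).fun_sub ((((hasDerivAt_id x).sub_const x2).fun_pow 2).const_mul (d ^ 2))).hasDerivWithinAt) ?_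
      intro x hx
      rw [interior_Ici] at hx
      have h2 := s3 x (le_of_lt hx)
      norm_num
      nlinarith
    intro x hx
    have := m (mem_Ici.2 le_rfl) hx hx
    simp [h0] at this
    linarith
  have fne : ∀ x, x2 < x → f x ≠ 0 := by
    intro x hx h
    have := s4 x hx.le
    rw [h] at this
    have h3 : 0 < d ^ 2 * (x - x2) ^ 2 := by have := sub_pos.2 hx; positivity
    norm_num at this
    linarith
  have cv' : Convex ℝ (Ici (x2 + 1)) := convex_Ici _
  have dgf : ∀ x, x2 < x → HasDerivAt (fun x => g x / f x) (-κ / f x ^ 2) x := by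
    intro x hx
    refine ((hg x).fun_div (hf x) (fne x hx)).congr_deriv ?_
    rw [← hw x]; ring
  have a1 : AntitoneOn (fun x => g x / f x) (Ici (x2 + 1)) := by
    refine antitoneOn_of_hasDerivWithinAt_nonpos cv' (f' := fun x => -κ / f x ^ 2) ?_ ?_ ?_
    · exact fun x hx => (dgf x (by have := mem_Ici.1 hx; linarith)).continuousAt.continuousWithinAt
    · intro x hx
      rw [interior_Ici] at hx
      exact (dgf x (by have := mem_Ioi.1 hx; linarith)).hasDerivWithinAt
    · intro x hx
      exact div_nonpos_of_nonpos_of_nonneg (by linarith) (sq_nonneg _)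
  have d2 : ∀ x, x2 < x → HasDerivAt (fun x => g x / f x - κ / d ^ 2 * (x - x2)⁻¹) (-κ / f x ^ 2 + κ / d ^ 2 / (x - x2) ^ 2) x := by
    intro x hx
    refine ((dgf x hx).fun_sub ((((hasDerivAt_id x).sub_const x2).fun_inv (by simpa using (sub_pos.2 hx).ne')).const_mul (κ / d ^ 2))).congr_deriv ?_
    simp only [id]; ring
  have a2 : MonotoneOn (fun x => g x / f x - κ / d ^ 2 * (x - x2)⁻¹) (Ici (x2 + 1)) := by
    refine monotoneOn_of_hasDerivWithinAt_nonneg cv' (f' := fun x => -κ / f x ^ 2 + κ / d ^ 2 / (x - x2) ^ 2) ?_ ?_ ?_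
    · exact fun x hx => (d2 x (by have := mem_Ici.1 hx; linarith)).continuousAt.continuousWithinAt
    · intro x hx
      rw [interior_Ici] at hx
      exact (d2 x (by have := mem_Ioi.1 hx; linarith)).hasDerivWithinAt
    · intro x hx
      rw [interior_Ici] at hx
      have hx' : x2 < x := by have := mem_Ioi.1 hx; linarith
      have p1 := s4 x hx'.le
      have p2 : 0 < d ^ 2 * (x - x2) ^ 2 := by have := sub_pos.2 hx'; positivity
      have := div_le_div_of_nonneg_left hκ.le p2 p1
      rw [div_div, neg_div]
      linarith
  refine ⟨|g (x2 + 1) / f (x2 + 1)| + κ / d ^ 2, fun x hx => ?_⟩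
  have h1 := a1 (mem_Ici.2 le_rfl) hx hx
  have h2 := a2 (mem_Ici.2 le_rfl) hx hx
  simp only at h1 h2
  have hx' : x2 < x := by linarith
  have p : 0 ≤ κ / d ^ 2 * (x - x2)⁻¹ := by have := sub_pos.2 hx'; positivity
  have q : x2 + 1 - x2 = 1 := by ring
  rw [q, inv_one, mul_one] at h2
  have : |g x / f x| ≤ |g (x2 + 1) / f (x2 + 1)| + κ / d ^ 2 := by
    have := neg_abs_le (g (x2 + 1) / f (x2 + 1))
    have := le_abs_self (g (x2 + 1) / f (x2 + 1))
    have : 0 < κ / d ^ 2 := by positivity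
    rw [abs_le]; constructor <;> linarith
  rw [abs_div, div_le_iff₀ (abs_pos.2 (fne x hx'))] at this
  exact this

lemma Canon.asy (H : Canon c Y Y1) (μ : ℝ) {ε : ℝ} (hε : 0 < ε) :
    ∀ᶠ x : ℝ in atTop, 0 < (Y μ x).re ∧ |(Y μ x).im| ≤ ε * (Y μ x).re := by
  have h := H.real_asym μ
  have h1 : Tendsto (fun x : ℝ => (Y μ x / pw (3*c^2) x).re) atTop (𝓝 1) := by
    have := (Complex.continuous_re.tendsto _).comp h
    exact this
  have h2 : Tendsto (fun x : ℝ => |(Y μ x / pw (3*c^2) x).im|) atTop (𝓝 0) := by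
    have := ((Complex.continuous_im.tendsto _).comp h).abs
    rw [Complex.one_im, abs_zero] at this
    exact this
  have hlt : Tendsto (fun x : ℝ => |(Y μ x / pw (3*c^2) x).im| - ε * (Y μ x / pw (3*c^2) x).re) atTop (𝓝 (0 - ε * 1)) :=
    h2.sub (h1.const_mul ε)
  filter_upwards [h1.eventually (lt_mem_nhds one_pos), hlt.eventually (gt_mem_nhds (by linarith : 0 - ε * 1 < 0)), eventually_gt_atTop 0] with x k1 k2 hx
  obtain ⟨r, hr, e⟩ := pw_real (a := 3*c^2) hx
  rw [e, Complex.div_ofReal_re] at k1 k2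
  rw [Complex.div_ofReal_im] at k2
  constructor
  · have := mul_pos k1 hr
    rwa [div_mul_cancel₀ _ hr.ne'] at this
  · rw [abs_div, abs_of_pos hr] at k2
    have := mul_lt_mul_of_pos_right k2 hr
    field_simp at this
    linarith

lemma Canon.dre (H : Canon c Y Y1) (μ x : ℝ) : HasDerivAt (fun x : ℝ => (Y μ x).re) (Y1 μ x).re x :=
  hd_re (HasDerivAt.comp_ofReal ((H.sol μ).1 x))
lemma Canon.dim (H : Canon c Y Y1) (μ x : ℝ) : HasDerivAt (fun x : ℝ => (Y μ x).im) (Y1 μ x).im x :=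
  hd_im (HasDerivAt.comp_ofReal ((H.sol μ).1 x))

lemma VV_real (c μ x : ℝ) : V ((3*c^2:ℝ):ℂ) ((μ+2*c^3:ℝ):ℂ) x = (((x - c) ^ 2 * (x + 2 * c) + μ : ℝ) : ℂ) := by
  unfold V; push_cast; ring

lemma Canon.dim1 (H : Canon c Y Y1) (μ x : ℝ) :
    HasDerivAt (fun x : ℝ => (Y1 μ x).im) (((x - c) ^ 2 * (x + 2 * c) + μ) * (Y μ x).im) x := by
  have := hd_im (HasDerivAt.comp_ofReal ((H.sol μ).2 x))
  rwa [VV_real, im_ofReal_mul] at this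

lemma Canon.wr (H : Canon c Y Y1) (μ x : ℝ) : (Y1 μ x).im * (Y μ x).re - (Y μ x).im * (Y1 μ x).re = kap c Y Y1 μ := by
  rw [← H.kap_eq μ x, zl_zero]
  simp [fe]; ring

lemma Canon.im_ne (H : Canon c Y Y1) {μ : ℝ} (hμ : 0 ≤ μ) (hk : kap c Y Y1 μ ≠ 0) {x : ℝ} (hx : c ≤ x) : (Y μ x).im ≠ 0 := by
  intro h0
  have hV : ∀ s, x ≤ s → 0 ≤ (s - c) ^ 2 * (s + 2 * c) + μ := by
    intro s hs
    have := H.hc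
    have : 0 ≤ s + 2 * c := by linarith
    positivity
  obtain ⟨M, hM⟩ : ∃ M : ℝ, ∀ s, x + 1 ≤ s → |(Y μ s).re| ≤ M * |(Y μ s).im| := by
    rcases lt_or_gt_of_ne hk with hk | hk
    · obtain ⟨M, hM⟩ := real_bound (g := fun x => -(Y μ x).re) (κ := -kap c Y Y1 μ) (by linarith) (H.dim μ) (H.dim1 μ) (fun x => (H.dre μ x).fun_neg)
        (fun x => by rw [← H.wr μ x]; ring) hV h0
      exact ⟨M, fun s hs => by simpa using hM s hs⟩
    · exact real_bound hk (H.dim μ) (H.dim1 μ) (H.dre μ) (H.wr μ) hV h0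
  have hε : 0 < 1 / (|M| + 1) := by positivity
  obtain ⟨s, ⟨s1, s2⟩, s3⟩ := ((H.asy μ hε).and (eventually_ge_atTop (x + 1))).exists
  have h1 := hM s s3
  rw [abs_of_pos s1] at h1
  have h2 : M * |(Y μ s).im| ≤ |M| * |(Y μ s).im| := by gcongr; exact le_abs_self _
  have h3 : |(Y μ s).im| * (|M| + 1) ≤ (Y μ s).re := by
    rw [one_div_mul_eq_div, le_div_iff₀ (by positivity)] at s2; exact s2
  have h4 : |(Y μ s).im| ≤ 0 := by nlinarith
  have h5 : |(Y μ s).im| = 0 := le_antisymm h4 (abs_nonneg _)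
  rw [h5] at h1
  linarith

/-- the sign of the imaginary part on `[c,∞)` -/
lemma sgn_aux {f f1 g g1 : ℝ → ℝ} {κ : ℝ} (hκ : 0 < κ) (hf : ∀ x, HasDerivAt f (f1 x) x)
    (hg : ∀ x, HasDerivAt g (g1 x) x) (hw : ∀ x, f1 x * g x - f x * g1 x = κ)
    (hne : ∀ x, c ≤ x → f x ≠ 0) (hasy : ∀ ε, 0 < ε → ∀ᶠ x in atTop, 0 < g x ∧ |f x| ≤ ε * g x) {x : ℝ} (hx : c ≤ x) : f x < 0 := by
  by_contra hcon
  push Not at hcon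
  have cf : Continuous f := continuous_iff_continuousAt.2 fun x => (hf x).continuousAt
  have hpos : ∀ s, c ≤ s → 0 < f s := by
    intro s hs
    by_contra h
    push Not at h
    obtain ⟨u, hu, hu0⟩ := isPreconnected_Ici.intermediate_value (mem_Ici.2 hs) (mem_Ici.2 hx) cf.continuousOn ⟨h, hcon⟩
    exact hne u hu hu0
  have dgf : ∀ x, c ≤ x → HasDerivAt (fun x => g x / f x) (-κ / f x ^ 2) x := by
    intro x hx
    refine ((hg x).fun_div (hf x) (hne x hx)).congr_deriv ?_
    rw [← hw x]; ring
  have a1 : AntitoneOn (fun x => g x / f x) (Ici c) := by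
    refine antitoneOn_of_hasDerivWithinAt_nonpos (convex_Ici _) (f' := fun x => -κ / f x ^ 2) ?_ ?_ ?_
    · exact fun x hx => (dgf x hx).continuousAt.continuousWithinAt
    · intro x hx
      rw [interior_Ici] at hx
      exact (dgf x (le_of_lt hx)).hasDerivWithinAt
    · intro x hx
      exact div_nonpos_of_nonpos_of_nonneg (by linarith) (sq_nonneg _)
  set M := g c / f c
  have hε : 0 < 1 / (|M| + 1) := by positivity
  obtain ⟨s, ⟨s1, s2⟩, s3⟩ := ((hasy _ hε).and (eventually_ge_atTop c)).exists
  have h1 : g s / f s ≤ M := a1 (mem_Ici.2 le_rfl) s3 s3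
  have fs := hpos s s3
  rw [div_le_iff₀ fs] at h1
  have h2 : M * f s ≤ |M| * f s := by gcongr; exact le_abs_self _
  rw [abs_of_pos fs, one_div_mul_eq_div, le_div_iff₀ (by positivity)] at s2
  nlinarith

lemma Canon.sgn_pos (H : Canon c Y Y1) {μ : ℝ} (hμ : 0 ≤ μ) (hk : 0 < kap c Y Y1 μ) {x : ℝ} (hx : c ≤ x) : (Y μ x).im < 0 :=
  sgn_aux hk (H.dim μ) (H.dre μ) (H.wr μ) (fun _ hs => H.im_ne hμ hk.ne' hs) (fun _ hε => H.asy μ hε) hx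

lemma Canon.sgn_neg (H : Canon c Y Y1) {μ : ℝ} (hμ : 0 ≤ μ) (hk : kap c Y Y1 μ < 0) {x : ℝ} (hx : c ≤ x) : 0 < (Y μ x).im := by
  have := sgn_aux (f := fun x => -(Y μ x).im) (κ := -kap c Y Y1 μ) (by linarith) (fun x => (H.dim μ x).fun_neg) (H.dre μ)
    (fun x => by rw [← H.wr μ x]; ring) (fun _ hs => neg_ne_zero.2 (H.im_ne hμ hk.ne hs)) (fun _ hε => by simpa using H.asy μ hε) hx
  simpa using this

lemma Canon.sgn_zero (H : Canon c Y Y1) {μ : ℝ} (hk : kap c Y Y1 μ = 0) (x : ℝ) : (Y μ x).im = 0 := by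
  have := H.sym hk (x:ℂ)
  rw [Complex.conj_ofReal] at this
  exact Complex.conj_eq_iff_im.1 this.symm

lemma Canon.kap_zero_iff (H : Canon c Y Y1) {μ : ℝ} (hμ : 0 ≤ μ) {x : ℝ} (hx : c ≤ x) : kap c Y Y1 μ = 0 ↔ (Y μ x).im = 0 :=
  ⟨fun h => H.sgn_zero h x, fun h => by by_contra hk; exact H.im_ne hμ hk hx h⟩

lemma Canon.neg_iff (H : Canon c Y Y1) {μ : ℝ} (hμ : 0 ≤ μ) {x : ℝ} (hx : c ≤ x) : (Y μ x).im < 0 ↔ (Y μ c).im < 0 := by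
  have key : ∀ s : ℝ, c ≤ s → ((Y μ s).im < 0 ↔ 0 < kap c Y Y1 μ) := by
    intro s hs
    refine ⟨fun h => ?_, fun h => H.sgn_pos hμ h hs⟩
    rcases lt_trichotomy (kap c Y Y1 μ) 0 with k | k | k
    · have := H.sgn_neg hμ k hs; linarith
    · have := H.sgn_zero k s; linarith
    · exact k
  rw [key x hx, key c le_rfl]

/-- zeros on the real axis -/
lemma Canon.zero_real (H : Canon c Y Y1) {μ x1 : ℝ} (hμ : 0 ≤ μ) (hx : c ≤ x1) (h0 : Y μ x1 = 0) :
    kap c Y Y1 μ = 0 ∧ (Y μ c).re < 0 ∧ 0 < (Y1 μ x1).re ∧ ∀ x2 : ℝ, c ≤ x2 → Y μ x2 = 0 → x2 = x1 := by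
  have hk : kap c Y Y1 μ = 0 := by rw [← H.wr μ x1, h0]; simp
  set P : ℝ → ℝ := fun x => (Y μ x).re * (Y1 μ x).re with hP
  have im0 := H.sgn_zero hk
  have d1 : ∀ x : ℝ, HasDerivAt (fun x : ℝ => (Y1 μ x).re) (((x - c) ^ 2 * (x + 2 * c) + μ) * (Y μ x).re) x := by
    intro x
    have := hd_re (HasDerivAt.comp_ofReal ((H.sol μ).2 x))
    rwa [VV_real, re_ofReal_mul] at this
  have im1 : ∀ x : ℝ, (Y1 μ x).im = 0 := by
    intro x
    have := H.dim μ x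
    have h2 : HasDerivAt (fun x : ℝ => (Y μ x).im) 0 x := by
      have e : (fun x : ℝ => (Y μ x).im) = fun _ => 0 := funext im0
      rw [e]; exact hasDerivAt_const _ _
    exact this.unique h2
  have dP : ∀ x : ℝ, HasDerivAt P ((Y1 μ x).re ^ 2 + ((x - c) ^ 2 * (x + 2 * c) + μ) * (Y μ x).re ^ 2) x := by
    intro x
    refine ((H.dre μ x).fun_mul (d1 x)).congr_deriv ?_
    ring
  have cP : Continuous P := continuous_iff_continuousAt.2 fun x => (dP x).continuousAt
  have cre : Continuous (fun x : ℝ => (Y μ x).re) := continuous_iff_continuousAt.2 fun x => (H.dre μ x).continuousAt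
  have hnz : ∀ x : ℝ, (Y μ x).re = 0 → (Y1 μ x).re ≠ 0 := by
    intro x h h'
    exact H.nz (μ := μ) (z := x) ⟨Complex.ext h (im0 x), Complex.ext h' (im1 x)⟩
  have mP : StrictMonoOn P (Ici c) := by
    refine strictMonoOn_of_deriv_pos (convex_Ici _) cP.continuousOn ?_
    intro x hx
    rw [interior_Ici] at hx
    rw [(dP x).deriv]
    have hxc : 0 < x - c := sub_pos.2 hx
    have h2 : 0 < x + 2 * c := by have := H.hc; linarith
    rcases eq_or_ne (Y μ x).re 0 with h | h
    · have := hnz x h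
      positivity
    · positivity
  have P1 : P x1 = 0 := by simp [hP, h0]
  have uniq : ∀ x2 : ℝ, c ≤ x2 → (Y μ x2).re = 0 → x2 = x1 := by
    intro x2 h2 h3
    refine mP.injOn h2 hx ?_
    rw [P1]; simp [hP, h3]
  have pos : ∀ x : ℝ, x1 < x → 0 < (Y μ x).re := by
    intro x hxx
    by_contra h
    push Not at h
    obtain ⟨s, ⟨s1, -⟩, s2⟩ := ((H.asy μ one_pos).and (eventually_ge_atTop x)).exists
    obtain ⟨u, hu, hu0⟩ := intermediate_value_Icc s2 cre.continuousOn ⟨h, s1.le⟩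
    have := uniq u (by have := hu.1; linarith) hu0
    have := hu.1
    linarith
  have hre0 : (Y μ x1).re = 0 := by rw [h0]; simp
  have der : 0 < (Y1 μ x1).re := by
    have h1 : ∀ x : ℝ, x1 < x → 0 < (Y1 μ x).re := by
      intro x hxx
      have := mP hx (mem_Ici.2 (by linarith)) hxx
      rw [P1] at this
      exact (pos_iff_pos_of_mul_pos this).1 (pos x hxx)
    have h2 : 0 ≤ (Y1 μ x1).re := by
      refine ge_of_tendsto (x := 𝓝[>] x1) ((d1 x1).continuousAt.tendsto.mono_left nhdsWithin_le_nhds) ?_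
      filter_upwards [self_mem_nhdsWithin] with x hx
      exact (h1 x hx).le
    exact lt_of_le_of_ne h2 (hnz x1 hre0).symm
  have hcx : c ≠ x1 := by
    rintro rfl
    have := H.line_ne μ le_rfl
    rw [zl_zero] at this
    exact this h0
  have hlt : c < x1 := lt_of_le_of_ne hx hcx
  refine ⟨hk, ?_, der, fun x2 h2 h3 => uniq x2 h2 (by rw [h3]; simp)⟩
  by_contra hcon
  push Not at hcon
  have hcne : (Y μ c).re ≠ 0 := fun h => hcx (uniq c le_rfl h)
  have hcpos : 0 < (Y μ c).re := lt_of_le_of_ne hcon hcne.symm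
  have lpos : ∀ x : ℝ, c ≤ x → x < x1 → 0 < (Y μ x).re := by
    intro x h1 h2
    by_contra h
    push Not at h
    obtain ⟨u, hu, hu0⟩ := intermediate_value_Icc' h1 cre.continuousOn ⟨h, hcpos.le⟩
    have := uniq u hu.1 hu0
    have := hu.2
    linarith
  have hev : ∀ᶠ x : ℝ in 𝓝[<] x1, (Y1 μ x).re ≤ 0 := by
    filter_upwards [Ioo_mem_nhdsLT hlt] with x hxx
    have := mP (mem_Ici.2 hxx.1.le) hx hxx.2
    rw [P1] at this
    by_contra h
    push Not at h
    have := mul_pos (lpos x hxx.1.le hxx.2) h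
    simp only [hP] at *
    linarith
  have := le_of_tendsto ((d1 x1).continuousAt.tendsto.mono_left nhdsWithin_le_nhds) hev
  linarith

lemma Canon.exists_zero_real (H : Canon c Y Y1) {μ : ℝ} (hk : kap c Y Y1 μ = 0) (hneg : (Y μ c).re < 0) :
    ∃ x1 : ℝ, c ≤ x1 ∧ Y μ x1 = 0 := by
  have cre : Continuous (fun x : ℝ => (Y μ x).re) := continuous_iff_continuousAt.2 fun x => (H.dre μ x).continuousAt
  obtain ⟨s, ⟨s1, -⟩, s2⟩ := ((H.asy μ one_pos).and (eventually_ge_atTop c)).exists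
  obtain ⟨u, hu, hu0⟩ := intermediate_value_Icc s2 cre.continuousOn ⟨hneg.le, s1.le⟩
  exact ⟨u, hu.1, Complex.ext hu0 (H.sgn_zero hk u)⟩

end CubicPT

namespace CubicPT
open Topology Set

variable {c : ℝ} {Y Y1 : ℝ → ℂ → ℂ}

lemma Canon.local_zero (H : Canon c Y Y1) {μ0 : ℝ} {ζ : ℂ} (hζ : Y μ0 ζ = 0) :
    ∃ r0 > 0, ∀ r, 0 < r → r ≤ r0 → ∀ᶠ μ in 𝓝 μ0, (∃ z ∈ Metric.ball ζ r, Y μ z = 0) ∧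
      ∀ z ∈ Metric.ball ζ r, ∀ z' ∈ Metric.ball ζ r, ‖Y μ z - Y μ z' - Y1 μ0 ζ * (z - z')‖ ≤ ‖Y1 μ0 ζ‖ / 2 * ‖z - z'‖ := by
  set A := Y1 μ0 ζ with hA
  have A0 : A ≠ 0 := fun h => H.nz (μ := μ0) (z := ζ) ⟨hζ, h⟩
  have nA : 0 < ‖A‖ := norm_pos_iff.2 A0
  have ev : ∀ᶠ q : ℝ × ℂ in 𝓝 (μ0, ζ), ‖Y1 q.1 q.2 - A‖ < ‖A‖ / 2 := by
    have : Tendsto (fun q : ℝ × ℂ => ‖Y1 q.1 q.2 - A‖) (𝓝 (μ0, ζ)) (𝓝 ‖Y1 μ0 ζ - A‖) :=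
      ((H.cont1.sub continuous_const).norm).tendsto (μ0, ζ)
    rw [← hA, sub_self, norm_zero] at this
    exact this.eventually (gt_mem_nhds (by positivity))
  rw [nhds_prod_eq] at ev
  obtain ⟨p, hp, q, hq, hpq⟩ := Filter.eventually_prod_iff.1 ev
  obtain ⟨r0, h0, hr0⟩ := Metric.eventually_nhds_iff_ball.1 hq
  refine ⟨r0, h0, fun r hr hrr => ?_⟩
  have hcont : ∀ᶠ μ in 𝓝 μ0, ‖Y μ ζ‖ < ‖A‖ / 2 * (r / 2) / 2 := by
    have : Tendsto (fun μ => ‖Y μ ζ‖) (𝓝 μ0) (𝓝 ‖Y μ0 ζ‖) :=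
      ((H.cont.comp (continuous_id.prodMk continuous_const)).norm).tendsto μ0
    rw [hζ, norm_zero] at this
    exact this.eventually (gt_mem_nhds (by positivity))
  filter_upwards [hp, hcont] with μ h1 h2
  have est : ∀ z ∈ Metric.ball ζ r, ∀ z' ∈ Metric.ball ζ r, ‖Y μ z - Y μ z' - A * (z - z')‖ ≤ ‖A‖ / 2 * ‖z - z'‖ := by
    intro z hz z' hz'
    have := Convex.norm_image_sub_le_of_norm_hasDerivWithin_le (f := fun w => Y μ w - A * w) (f' := fun w => Y1 μ w - A)
      (s := Metric.ball ζ r) (C := ‖A‖ / 2) (x := z') (y := z)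
      (fun w hw => ((((H.sol μ).1 w).fun_sub ((hasDerivAt_id w).const_mul A)).congr_deriv (by simp)).hasDerivWithinAt)
      (fun w hw => (hpq h1 (hr0 w (Metric.ball_subset_ball hrr hw))).le) (convex_ball _ _) hz' hz
    have e : Y μ z - A * z - (Y μ z' - A * z') = Y μ z - Y μ z' - A * (z - z') := by ring
    rwa [e] at this
  refine ⟨?_, est⟩
  have hζr : ζ ∈ Metric.ball ζ r := Metric.mem_ball_self hr
  have low : ∀ z ∈ Metric.ball ζ r, ‖A‖ / 2 * ‖z - ζ‖ ≤ ‖Y μ z - Y μ ζ‖ := by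
    intro z hz
    have h3 := est z hz ζ hζr
    have h4 := norm_sub_norm_le (A * (z - ζ)) (A * (z - ζ) - (Y μ z - Y μ ζ))
    rw [norm_mul] at h4
    have h5 : A * (z - ζ) - (A * (z - ζ) - (Y μ z - Y μ ζ)) = Y μ z - Y μ ζ := by ring
    rw [h5, norm_sub_rev (A * (z - ζ))] at h4
    linarith
  have hd : Differentiable ℂ (Y μ) := fun z => ((H.sol μ).1 z).differentiableAt
  have hsub := DiffContOnCl.ball_subset_image_closedBall (f := Y μ) (z₀ := ζ) (r := r / 2) (ε := ‖A‖ / 2 * (r / 2)) hd.diffContOnCl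
    (by positivity) (fun z hz => by
      have hz' : ‖z - ζ‖ = r / 2 := by simpa [dist_eq_norm] using hz
      have := low z (by rw [Metric.mem_ball, dist_eq_norm, hz']; linarith)
      rwa [hz'] at this) (by
      refine Filter.Eventually.frequently (f := 𝓝[≠] ζ) ?_ |>.filter_mono nhdsWithin_le_nhds
      filter_upwards [self_mem_nhdsWithin, nhdsWithin_le_nhds (Metric.ball_mem_nhds ζ hr)] with z z1 z2 z3
      have := low z z2
      rw [z3, sub_self, norm_zero] at this
      have h6 : 0 < ‖z - ζ‖ := norm_pos_iff.2 (sub_ne_zero.2 z1)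
      have : 0 < ‖A‖ / 2 * ‖z - ζ‖ := by positivity
      linarith)
  obtain ⟨z, hz, hz0⟩ := hsub (show (0:ℂ) ∈ _ by rw [Metric.mem_ball, dist_comm, dist_zero_right]; exact h2)
  exact ⟨z, Metric.closedBall_subset_ball (by linarith) hz, hz0⟩

/-- zeros in the closed quadrant -/
def Sq (c : ℝ) (Y : ℝ → ℂ → ℂ) (μ : ℝ) : Set ℂ := {z | c ≤ z.re ∧ 0 ≤ z.im ∧ Y μ z = 0}

lemma Canon.Sq_re (H : Canon c Y Y1) {μ : ℝ} {z : ℂ} (hz : z ∈ Sq c Y μ) : c < z.re := by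
  refine lt_of_le_of_ne hz.1 fun h => ?_
  have := H.line_ne μ hz.2.1
  rw [h, zl_eta] at this
  exact this hz.2.2

lemma cpt (c R : ℝ) : IsCompact {z : ℂ | c ≤ z.re ∧ 0 ≤ z.im ∧ z.re + z.im ≤ R} := by
  refine (IsCompact.reProdIm (isCompact_Icc (a := c) (b := R)) (isCompact_Icc (a := 0) (b := R - c))).of_isClosed_subset ?_ ?_
  · exact (isClosed_le continuous_const Complex.continuous_re).inter
      ((isClosed_le continuous_const Complex.continuous_im).inter
        (isClosed_le (Complex.continuous_re.add Complex.continuous_im) continuous_const))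
  · rintro z ⟨h1, h2, h3⟩
    exact ⟨⟨h1, by linarith⟩, ⟨h2, by linarith⟩⟩

lemma Canon.Sq_finite (H : Canon c Y Y1) (μ : ℝ) : (Sq c Y μ).Finite := by
  obtain ⟨R, -, hR⟩ := H.far |μ|
  have hc := H.hc
  have cY : Continuous (Y μ) := H.cont.comp (continuous_const.prodMk continuous_id)
  have hcp : IsCompact (Sq c Y μ) := by
    refine (cpt c R).of_isClosed_subset ?_ ?_
    · exact (isClosed_le continuous_const Complex.continuous_re).inter
        ((isClosed_le continuous_const Complex.continuous_im).inter (isClosed_eq cY continuous_const))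
    · rintro z ⟨h1, h2, h3⟩
      refine ⟨h1, h2, ?_⟩
      by_contra h
      push Not at h
      exact hR μ le_rfl z (by linarith) h2 h.le h3
  have hU : ∀ z ∈ Sq c Y μ, {w | w ≠ z → Y μ w ≠ 0} ∈ 𝓝 z := by
    intro z hz
    have := ((H.sol μ).1 z).eventually_ne (c := 0) (fun h => H.nz _ _ ⟨hz.2.2, h⟩)
    exact eventually_nhdsWithin_iff.1 this
  obtain ⟨t, -, ht⟩ := hcp.elim_nhds_subcover _ hU
  refine t.finite_toSet.subset fun w hw => ?_
  obtain ⟨z, hz⟩ := mem_iUnion.1 (ht hw)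
  obtain ⟨hz1, hz2⟩ := mem_iUnion.1 hz
  by_cases h : w = z
  · rw [h]; exact hz1
  · exact absurd hw.2.2 (hz2 h)

lemma Zq_sub {μ : ℝ} : Zq c Y μ ⊆ Sq c Y μ := fun _ hz => ⟨hz.1.le, hz.2.1.le, hz.2.2⟩

lemma Canon.Zq_finite (H : Canon c Y Y1) (μ : ℝ) : (Zq c Y μ).Finite := (H.Sq_finite μ).subset Zq_sub

lemma Canon.count (H : Canon c Y Y1) {μ0 : ℝ} (h0 : 0 ≤ μ0) : ∀ᶠ μ in 𝓝 μ0, 0 ≤ μ →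
    (Zq c Y μ).ncard = {ζ ∈ Sq c Y μ0 | 0 < ζ.im ∨ (Y μ c).im < 0}.ncard := by
  have hfin := H.Sq_finite μ0
  have hc := H.hc
  choose! ρ hρ1 hρ2 using fun (ζ : ℂ) (hζ : ζ ∈ Sq c Y μ0) => H.local_zero hζ.2.2
  -- choice of the common radius
  have hr : ∃ r > 0, (∀ ζ ∈ Sq c Y μ0, r ≤ ρ ζ ∧ r < ζ.re - c ∧ (0 < ζ.im → r < ζ.im)) ∧
      ∀ ζ ∈ Sq c Y μ0, ∀ ζ' ∈ Sq c Y μ0, ζ ≠ ζ' → r < dist ζ ζ' / 2 := by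
    have e1 : ∀ᶠ r in 𝓝[>] (0:ℝ), ∀ ζ ∈ Sq c Y μ0, r ≤ ρ ζ ∧ r < ζ.re - c ∧ (0 < ζ.im → r < ζ.im) := by
      rw [eventually_all_finite hfin]
      intro ζ hζ
      have a1 : ∀ᶠ r in 𝓝[>] (0:ℝ), r < ρ ζ := nhdsWithin_le_nhds (gt_mem_nhds (hρ1 ζ hζ))
      have a2 : ∀ᶠ r in 𝓝[>] (0:ℝ), r < ζ.re - c := nhdsWithin_le_nhds (gt_mem_nhds (sub_pos.2 (H.Sq_re hζ)))
      have a3 : ∀ᶠ r in 𝓝[>] (0:ℝ), (0 < ζ.im → r < ζ.im) := by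
        by_cases h : 0 < ζ.im
        · have : ∀ᶠ r in 𝓝[>] (0:ℝ), r < ζ.im := nhdsWithin_le_nhds (gt_mem_nhds h)
          filter_upwards [this] with r hr _ using hr
        · exact Eventually.of_forall fun r h' => absurd h' h
      filter_upwards [a1, a2, a3] with r b1 b2 b3 using ⟨b1.le, b2, b3⟩
    have e2 : ∀ᶠ r in 𝓝[>] (0:ℝ), ∀ ζ ∈ Sq c Y μ0, ∀ ζ' ∈ Sq c Y μ0, ζ ≠ ζ' → r < dist ζ ζ' / 2 := by
      rw [eventually_all_finite hfin]
      intro ζ hζ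
      rw [eventually_all_finite hfin]
      intro ζ' hζ'
      by_cases h : ζ = ζ'
      · exact Eventually.of_forall fun r h' => absurd h h'
      · have : ∀ᶠ r in 𝓝[>] (0:ℝ), r < dist ζ ζ' / 2 := nhdsWithin_le_nhds (gt_mem_nhds (by have := dist_pos.2 h; positivity))
        filter_upwards [this] with r hr _ using hr
    obtain ⟨r, ⟨h1, h2⟩, h3⟩ := ((e1.and e2).and self_mem_nhdsWithin).exists
    exact ⟨r, h3, h1, h2⟩
  obtain ⟨r, r0, hr1, hr2⟩ := hr
  have evloc := (eventually_all_finite hfin).2 fun ζ hζ => hρ2 ζ hζ r r0 (hr1 ζ hζ).1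
  obtain ⟨R, -, hR⟩ := H.far (|μ0| + 1)
  have evc : ∀ᶠ μ in 𝓝 μ0, ∀ z ∈ {z : ℂ | c ≤ z.re ∧ 0 ≤ z.im ∧ z.re + z.im ≤ R} \ ⋃ ζ ∈ Sq c Y μ0, Metric.ball ζ r, Y μ z ≠ 0 := by
    refine IsCompact.eventually_forall_of_forall_eventually (P := fun μ z => Y μ z ≠ 0)
      ((cpt c R).diff (isOpen_biUnion fun _ _ => Metric.isOpen_ball)) ?_
    rintro z ⟨⟨z1, z2, z3⟩, z4⟩
    have hz : Y μ0 z ≠ 0 := fun h => z4 (mem_biUnion (show z ∈ Sq c Y μ0 from ⟨z1, z2, h⟩) (Metric.mem_ball_self r0))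
    exact (H.cont.tendsto (μ0, z)).eventually_ne hz
  have evb : ∀ᶠ μ in 𝓝 μ0, |μ| < |μ0| + 1 := (continuous_abs.tendsto μ0).eventually (gt_mem_nhds (by linarith))
  filter_upwards [evloc, evc, evb] with μ k1 k2 k3 hμ
  choose! F hF using fun ζ hζ => (k1 ζ hζ).1
  have hFb : ∀ ζ ∈ Sq c Y μ0, ‖F ζ - ζ‖ < r := fun ζ hζ => by
    have := (hF ζ hζ).1; rwa [Metric.mem_ball, dist_eq_norm] at this
  have hFre : ∀ ζ ∈ Sq c Y μ0, c < (F ζ).re := by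
    intro ζ hζ
    have h1 := (Complex.abs_re_le_norm (F ζ - ζ)).trans_lt (hFb ζ hζ)
    rw [Complex.sub_re] at h1
    have := (abs_lt.1 h1).1
    have := (hr1 ζ hζ).2.1
    linarith
  have hFim : ∀ ζ ∈ Sq c Y μ0, (0 < (F ζ).im ↔ 0 < ζ.im ∨ (Y μ c).im < 0) := by
    intro ζ hζ
    have h1 := (Complex.abs_im_le_norm (F ζ - ζ)).trans_lt (hFb ζ hζ)
    rw [Complex.sub_im] at h1
    have h2 := (abs_lt.1 h1).1
    rcases hζ.2.1.lt_or_eq with him | him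
    · have := (hr1 ζ hζ).2.2 him
      exact iff_of_true (by linarith) (Or.inl him)
    · have hζx : ζ = ((ζ.re : ℝ) : ℂ) := Complex.ext rfl (by simpa using him.symm)
      have hz0 : Y μ0 (ζ.re : ℂ) = 0 := hζx ▸ hζ.2.2
      obtain ⟨hk, -, hA, -⟩ := H.zero_real h0 hζ.1 hz0
      have hAim : (Y1 μ0 ζ).im = 0 := by
        rw [hζx]
        have h3 := H.dim μ0 ζ.re
        have h4 : HasDerivAt (fun x : ℝ => (Y μ0 x).im) 0 ζ.re := by
          have e : (fun x : ℝ => (Y μ0 x).im) = fun _ => 0 := funext (H.sgn_zero hk)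
          rw [e]; exact hasDerivAt_const _ _
        exact h3.unique h4
      rw [← hζx] at hA
      set A := (Y1 μ0 ζ).re with hAdef
      have hAc : Y1 μ0 ζ = (A : ℂ) := Complex.ext rfl (by simpa using hAim)
      set p : ℂ := ((F ζ).re : ℂ) with hp
      have hpm : p ∈ Metric.ball ζ r := by
        rw [Metric.mem_ball, dist_eq_norm]
        have e : p - ζ = (((F ζ - ζ).re : ℝ) : ℂ) := by
          apply Complex.ext
          · simp [hp]
          · simp [hp, ← him]
        rw [e, Complex.norm_real]
        exact (Complex.abs_re_le_norm _).trans_lt (hFb ζ hζ)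
      have est := (k1 ζ hζ).2 p hpm (F ζ) (hF ζ hζ).1
      have e2 : p - F ζ = -(((F ζ).im : ℝ) : ℂ) * I := by
        apply Complex.ext <;> simp [hp]
      rw [(hF ζ hζ).2, sub_zero, hAc, e2, norm_mul, norm_neg, norm_I, mul_one, Complex.norm_real, Complex.norm_real,
        Real.norm_eq_abs, Real.norm_eq_abs, abs_of_pos hA] at est
      have h5 := (Complex.abs_im_le_norm _).trans est
      have e3 : (Y μ p - (A:ℂ) * (-(((F ζ).im : ℝ) : ℂ) * I)).im = (Y μ p).im + A * (F ζ).im := by simp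
      rw [e3, abs_le] at h5
      have hiff := H.neg_iff hμ (hFre ζ hζ).le
      rw [← hp] at hiff
      rw [← him]
      simp only [lt_irrefl, false_or]
      rw [← hiff]
      constructor
      · intro hq
        rw [abs_of_pos hq] at h5
        have := mul_pos hA hq
        linarith [h5.2]
      · intro hy
        by_contra hq
        push Not at hq
        rw [abs_of_nonpos hq] at h5
        have := mul_nonpos_of_nonneg_of_nonpos hA.le hq
        linarith [h5.1]
  have hinj : InjOn F (Sq c Y μ0) := by
    intro ζ hζ ζ' hζ' he
    by_contra hne
    have h1 := hr2 ζ hζ ζ' hζ' hne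
    have h2 := (hF ζ hζ).1
    have h3 := (hF ζ' hζ').1
    rw [← he] at h3
    rw [Metric.mem_ball] at h2 h3
    have := dist_triangle_left ζ ζ' (F ζ)
    linarith
  have himg : Zq c Y μ = F '' {ζ ∈ Sq c Y μ0 | 0 < ζ.im ∨ (Y μ c).im < 0} := by
    ext z
    constructor
    · rintro ⟨z1, z2, z3⟩
      have zR : z.re + z.im ≤ R := by
        by_contra h
        push Not at h
        exact hR μ k3.le z (by linarith) z2.le h.le z3
      have hz : z ∈ ⋃ ζ ∈ Sq c Y μ0, Metric.ball ζ r := by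
        by_contra h
        exact k2 z ⟨⟨z1.le, z2.le, zR⟩, h⟩ z3
      obtain ⟨ζ, hζ, hzb⟩ := mem_iUnion₂.1 hz
      have hFz : F ζ = z := by
        have est := (k1 ζ hζ).2 (F ζ) (hF ζ hζ).1 z hzb
        rw [(hF ζ hζ).2, z3, sub_zero, zero_sub, norm_neg, norm_mul] at est
        have hA : 0 < ‖Y1 μ0 ζ‖ := norm_pos_iff.2 fun h => H.nz _ _ ⟨hζ.2.2, h⟩
        by_contra hne
        have : 0 < ‖F ζ - z‖ := norm_pos_iff.2 (sub_ne_zero.2 hne)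
        have := mul_pos hA this
        linarith
      exact ⟨ζ, ⟨hζ, (hFim ζ hζ).1 (by rw [hFz]; exact z2)⟩, hFz⟩
    · rintro ⟨ζ, ⟨hζ, hζ2⟩, rfl⟩
      exact ⟨hFre ζ hζ, (hFim ζ hζ).2 hζ2, (hF ζ hζ).2⟩
  rw [himg, (hinj.mono (fun _ h => h.1)).ncard_image]

end CubicPT

namespace CubicPT
open Topology Set

variable {c : ℝ} {Y Y1 : ℝ → ℂ → ℂ}

/-- the expected number of zeros -/
noncomputable def Cn (p : ℝ) : ℤ := ⌈(p - Real.pi) / (2 * Real.pi)⌉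

lemma Cn_eq {p : ℝ} {m : ℤ} : Cn p = m ↔ (2 * m - 1) * Real.pi < p ∧ p ≤ (2 * m + 1) * Real.pi := by
  have := Real.pi_pos
  unfold Cn
  rw [Int.ceil_eq_iff, lt_div_iff₀ (by positivity), div_le_iff₀ (by positivity)]
  constructor <;> rintro ⟨h1, h2⟩ <;> constructor <;> linarith

lemma Cn_mem (p : ℝ) : (2 * (Cn p : ℝ) - 1) * Real.pi < p ∧ p ≤ (2 * (Cn p : ℝ) + 1) * Real.pi := Cn_eq.1 rfl

lemma odd_of {p : ℝ} (h1 : Real.sin p = 0) (h2 : Real.cos p < 0) : p = (2 * (Cn p : ℝ) + 1) * Real.pi := by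
  have h3 : Real.cos p = -1 := by
    have := Real.sin_sq_add_cos_sq p
    rw [h1] at this
    have : (Real.cos p - 1) * (Real.cos p + 1) = 0 := by linarith
    rcases mul_eq_zero.1 this with h | h <;> linarith
  obtain ⟨k, hk⟩ := Real.cos_eq_neg_one_iff.1 h3
  have : Cn p = k := by
    have := Real.pi_pos
    rw [Cn_eq, ← hk]; constructor <;> linarith
  rw [this, ← hk]; ring

lemma sin_odd (m : ℤ) : Real.sin ((2 * (m:ℝ) + 1) * Real.pi) = 0 ∧ Real.cos ((2 * (m:ℝ) + 1) * Real.pi) = -1 := by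
  have e : (2 * (m:ℝ) + 1) * Real.pi = Real.pi + m * (2 * Real.pi) := by ring
  rw [e, Real.sin_add_int_mul_two_pi, Real.cos_add_int_mul_two_pi]
  simp

lemma Cn_loc1 {p : ℝ} (h : ¬ (Real.sin p = 0 ∧ Real.cos p < 0)) : ∀ᶠ q in 𝓝 p, Cn q = Cn p := by
  obtain ⟨h1, h2⟩ := Cn_mem p
  have h3 : p < (2 * (Cn p : ℝ) + 1) * Real.pi := by
    refine lt_of_le_of_ne h2 fun e => h ?_
    obtain ⟨s1, s2⟩ := sin_odd (Cn p)
    rw [← e] at s1 s2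
    exact ⟨s1, by rw [s2]; norm_num⟩
  filter_upwards [Ioo_mem_nhds h1 h3] with q hq
  exact Cn_eq.2 ⟨hq.1, hq.2.le⟩

open Classical in
lemma Cn_loc2 {p : ℝ} (h1 : Real.sin p = 0) (h2 : Real.cos p < 0) :
    ∀ᶠ q in 𝓝 p, Cn q = Cn p + if Real.sin q < 0 then 1 else 0 := by
  have e := odd_of h1 h2
  have hpi := Real.pi_pos
  filter_upwards [Ioo_mem_nhds (show p - Real.pi < p by linarith) (show p < p + Real.pi by linarith)] with q hq
  have hs : Real.sin q = - Real.sin (q - p) := by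
    have e2 : q = (q - p) + Real.pi + (Cn p) * (2 * Real.pi) := by
      have : p = Real.pi + (Cn p) * (2 * Real.pi) := by
        have e3 : (2 * (Cn p : ℝ) + 1) * Real.pi = Real.pi + (Cn p) * (2 * Real.pi) := by ring
        exact e.trans e3
      linarith
    conv_lhs => rw [e2]
    rw [Real.sin_add_int_mul_two_pi, Real.sin_add_pi]
  rcases le_or_gt q p with hle | hlt
  · have : ¬ Real.sin q < 0 := by
      rw [hs]
      have := Real.sin_nonpos_of_nonpos_of_neg_pi_le (x := q - p) (by linarith) (by linarith [hq.1])
      linarith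
    rw [if_neg this, add_zero, Cn_eq]
    constructor
    · have := hq.1; linarith
    · linarith
  · have : Real.sin q < 0 := by
      rw [hs]
      have := Real.sin_pos_of_pos_of_lt_pi (x := q - p) (by linarith) (by linarith [hq.2])
      linarith
    rw [if_pos this, Cn_eq]
    push_cast
    constructor
    · linarith
    · have := hq.2; linarith

lemma Canon.count_eq (H : Canon c Y Y1) {ψ : ℝ → ℝ} (cψ : Continuous ψ)
    (hψ : ∀ μ, ∃ r : ℝ, 0 < r ∧ Y μ c = r * exp (ψ μ * I)) (hψ0 : ψ 0 = arg (Y 0 c)) {μ : ℝ} (hμ : 0 ≤ μ) :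
    ((Zq c Y μ).ncard : ℤ) = Cn (ψ μ) := by
  classical
  have him : ∀ μ, ∃ r : ℝ, 0 < r ∧ (Y μ c).im = r * Real.sin (ψ μ) ∧ (Y μ c).re = r * Real.cos (ψ μ) := by
    intro μ
    obtain ⟨r, hr, e⟩ := hψ μ
    refine ⟨r, hr, ?_, ?_⟩
    · rw [e, im_ofReal_mul, exp_ofReal_mul_I_im]
    · rw [e, re_ofReal_mul, exp_ofReal_mul_I_re]
  have hneg : ∀ μ, (Y μ c).im < 0 ↔ Real.sin (ψ μ) < 0 := by
    intro μ
    obtain ⟨r, hr, e, -⟩ := him μ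
    rw [e, mul_neg_iff]
    exact ⟨fun h => by rcases h with h | h <;> linarith [h.1, h.2], fun h => Or.inl ⟨hr, h⟩⟩
  have hbad : ∀ μ, (kap c Y Y1 μ = 0 ∧ (Y μ c).re < 0) → (Real.sin (ψ μ) = 0 ∧ Real.cos (ψ μ) < 0) := by
    rintro μ ⟨h1, h2⟩
    obtain ⟨r, hr, e1, e2⟩ := him μ
    have := H.sgn_zero h1 c
    rw [e1] at this
    rw [e2] at h2
    refine ⟨(mul_eq_zero.1 this).resolve_left hr.ne', ?_⟩
    by_contra h
    push Not at h
    have := mul_nonneg hr.le h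
    linarith
  have hbad' : ∀ μ, 0 ≤ μ → (Real.sin (ψ μ) = 0 ∧ Real.cos (ψ μ) < 0) → (kap c Y Y1 μ = 0 ∧ (Y μ c).re < 0) := by
    rintro μ hμ ⟨h1, h2⟩
    obtain ⟨r, hr, e1, e2⟩ := him μ
    refine ⟨(H.kap_zero_iff hμ le_rfl).2 (by rw [e1, h1, mul_zero]), ?_⟩
    rw [e2]; exact mul_neg_of_pos_of_neg hr h2
  have hloc : ∀ μ0, 0 ≤ μ0 → ∀ᶠ μ in 𝓝 μ0, 0 ≤ μ →
      ((Zq c Y μ).ncard : ℤ) - Cn (ψ μ) = ((Zq c Y μ0).ncard : ℤ) - Cn (ψ μ0) := by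
    intro μ0 h0
    by_cases hz : ∃ x1 : ℝ, c ≤ x1 ∧ Y μ0 x1 = 0
    · obtain ⟨x1, hx1, hx0⟩ := hz
      obtain ⟨hk, hre, -, huniq⟩ := H.zero_real h0 hx1 hx0
      obtain ⟨s1, s2⟩ := hbad μ0 ⟨hk, hre⟩
      filter_upwards [H.count h0, cψ.continuousAt.eventually (Cn_loc2 s1 s2)] with μ k1 k2 hμ
      rw [k1 hμ, k2]
      by_cases hs : Real.sin (ψ μ) < 0
      · have hset : {ζ ∈ Sq c Y μ0 | 0 < ζ.im ∨ (Y μ c).im < 0} = insert (x1:ℂ) (Zq c Y μ0) := by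
          ext ζ
          constructor
          · rintro ⟨hζ, -⟩
            rcases hζ.2.1.lt_or_eq with h | h
            · exact Or.inr ⟨H.Sq_re hζ, h, hζ.2.2⟩
            · have hζx : ζ = ((ζ.re : ℝ) : ℂ) := Complex.ext rfl (by simpa using h.symm)
              have hz0 : Y μ0 (ζ.re : ℂ) = 0 := hζx ▸ hζ.2.2
              have := huniq ζ.re hζ.1 hz0
              rw [this] at hζx
              exact Or.inl hζx
          · rintro (h | h)
            · rw [h]
              exact ⟨⟨by simpa using hx1, by simp, hx0⟩, Or.inr ((hneg μ).2 hs)⟩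
            · exact ⟨Zq_sub h, Or.inl h.2.1⟩
        rw [hset, ncard_insert_of_notMem (fun h => by simpa using h.2.1) (H.Zq_finite μ0), if_pos hs]
        push_cast; ring
      · have hset : {ζ ∈ Sq c Y μ0 | 0 < ζ.im ∨ (Y μ c).im < 0} = Zq c Y μ0 := by
          ext ζ
          constructor
          · rintro ⟨hζ, h | h⟩
            · exact ⟨H.Sq_re hζ, h, hζ.2.2⟩
            · exact absurd ((hneg μ).1 h) hs
          · exact fun h => ⟨Zq_sub h, Or.inl h.2.1⟩
        rw [hset, if_neg hs]
        ring
    · have hn : ¬ (Real.sin (ψ μ0) = 0 ∧ Real.cos (ψ μ0) < 0) := by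
        intro h
        obtain ⟨h1, h2⟩ := hbad' μ0 h0 h
        exact hz (H.exists_zero_real h1 h2)
      filter_upwards [H.count h0, cψ.continuousAt.eventually (Cn_loc1 hn)] with μ k1 k2 hμ
      have hset : {ζ ∈ Sq c Y μ0 | 0 < ζ.im ∨ (Y μ c).im < 0} = Zq c Y μ0 := by
        ext ζ
        constructor
        · rintro ⟨hζ, -⟩
          refine ⟨H.Sq_re hζ, lt_of_le_of_ne hζ.2.1 fun h => hz ⟨ζ.re, hζ.1, ?_⟩, hζ.2.2⟩
          have hζx : ζ = ((ζ.re : ℝ) : ℂ) := Complex.ext rfl (by simpa using h.symm)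
          exact hζx ▸ hζ.2.2
        · exact fun h => ⟨Zq_sub h, Or.inl h.2.1⟩
      rw [k1 hμ, k2, hset]
  have hconst : ContinuousOn (fun μ => ((Zq c Y μ).ncard : ℤ) - Cn (ψ μ)) (Ici 0) := by
    intro μ0 h0
    refine tendsto_nhds_of_eventually_eq ?_
    filter_upwards [nhdsWithin_le_nhds (hloc μ0 h0), self_mem_nhdsWithin] with μ h1 h2 using h1 h2
  have hfin := isPreconnected_Ici.constant hconst (mem_Ici.2 hμ) (mem_Ici.2 le_rfl)
  have hZ : Zq c Y 0 = ∅ := by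
    rw [eq_empty_iff_forall_notMem]
    rintro z ⟨h1, h2, h3⟩
    have := H.e5c (μ := 0) le_rfl (X := z.re - c) (by linarith) (t := z.im) h2.le
    rw [add_sub_cancel, zl_eta] at this
    exact this h3
  have hC : Cn (ψ 0) = 0 := by
    rw [Cn_eq, hψ0]
    have h1 := Complex.neg_pi_lt_arg (Y 0 c)
    have h2 := Complex.arg_le_pi (Y 0 c)
    push_cast
    constructor <;> linarith
  rw [hZ, hC, ncard_empty] at hfin
  push_cast at hfin
  linarith

lemma Canon.main (H : Canon c Y Y1) (n : ℕ) : ∃ l1 l2 : ℝ, l1 ≠ l2 ∧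
    {l : ℝ | (3 * c ^ 2, l) ∈ cubicGamma n} = {l1, l2} := by
  obtain ⟨ψ, ms, cψ, lψ, hψ, hψ0⟩ := H.exists_phase
  have hpi := Real.pi_pos
  have hsin : ∀ μ, (Y μ c).im = 0 ↔ Real.sin (ψ μ) = 0 := by
    intro μ
    obtain ⟨r, hr, e⟩ := hψ μ
    rw [e, im_ofReal_mul, exp_ofReal_mul_I_im, mul_eq_zero]
    simp [hr.ne']
  have p0 : ψ 0 < 0 := by
    rw [hψ0]
    exact Complex.arg_neg_iff.2 (H.sgn_pos le_rfl (H.kap_pos le_rfl) le_rfl)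
  have p0' : -Real.pi < ψ 0 := by rw [hψ0]; exact Complex.neg_pi_lt_arg _
  have surj : ∀ v, 0 ≤ v → ∃ μ, 0 < μ ∧ ψ μ = v := by
    intro v hv
    obtain ⟨b, hb1, hb2⟩ := ((lψ.eventually_ge_atTop v).and (eventually_ge_atTop 0)).exists
    obtain ⟨μ, h1, h2⟩ := intermediate_value_Icc hb2 cψ.continuousOn ⟨p0.le.trans hv, hb1⟩
    refine ⟨μ, lt_of_le_of_ne h1.1 ?_, h2⟩
    rintro rfl
    linarith
  obtain ⟨m1, m10, e1⟩ := surj (2 * n * Real.pi) (by positivity)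
  obtain ⟨m2, m20, e2⟩ := surj ((2 * n + 1) * Real.pi) (by positivity)
  have hne : m1 ≠ m2 := by
    rintro rfl
    rw [e1] at e2
    linarith
  have key : ∀ μ, (3 * c ^ 2, μ + 2 * c ^ 3) ∈ cubicGamma n ↔ μ = m1 ∨ μ = m2 := by
    intro μ
    rw [H.gamma_iff (H.Zq_finite μ) n]
    constructor
    · rintro ⟨k1, k2⟩
      have hμ : 0 ≤ μ := by
        by_contra h
        push Not at h
        have := H.kap_pos (μ := μ) h.le
        linarith
      have h1 := H.count_eq cψ hψ hψ0 hμ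
      rw [k2, eq_comm, Cn_eq] at h1
      push_cast at h1
      obtain ⟨k, hk⟩ := Real.sin_eq_zero_iff.1 ((hsin μ).1 ((H.kap_zero_iff hμ le_rfl).1 k1))
      rw [← hk] at h1
      have a1 := lt_of_mul_lt_mul_right h1.1 hpi.le
      have a2 := le_of_mul_le_mul_right h1.2 hpi
      have a1' : 2 * (n:ℤ) - 1 < k := by exact_mod_cast a1
      have a2' : k ≤ 2 * (n:ℤ) + 1 := by exact_mod_cast a2
      have : k = 2 * n ∨ k = 2 * n + 1 := by omega
      rcases this with h | h
      · left; apply ms.injective; rw [e1, ← hk, h]; push_cast; ring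
      · right; apply ms.injective; rw [e2, ← hk, h]; push_cast; ring
    · intro h
      have hh : 0 ≤ μ ∧ Real.sin (ψ μ) = 0 ∧ Cn (ψ μ) = n := by
        rcases h with h | h
        · rw [h, e1]
          refine ⟨m10.le, ?_, ?_⟩
          · have := Real.sin_nat_mul_pi (2 * n)
            push_cast at this; exact this
          · rw [Cn_eq]; push_cast; constructor <;> linarith
        · rw [h, e2]
          refine ⟨m20.le, ?_, ?_⟩
          · have := Real.sin_nat_mul_pi (2 * n + 1)
            push_cast at this; exact this
          · rw [Cn_eq]; push_cast; constructor <;> linarith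
      obtain ⟨h1, h2, h3⟩ := hh
      refine ⟨(H.kap_zero_iff h1 le_rfl).2 ((hsin μ).2 h2), ?_⟩
      have := H.count_eq cψ hψ hψ0 h1
      rw [h3] at this
      exact_mod_cast this
  refine ⟨m1 + 2 * c ^ 3, m2 + 2 * c ^ 3, fun h => hne (by linarith), ?_⟩
  ext l
  have := key (l - 2 * c ^ 3)
  rw [sub_add_cancel] at this
  simp only [mem_ofPred_eq, mem_insert_iff, mem_singleton_iff]
  rw [this, sub_eq_iff_eq_add, sub_eq_iff_eq_add]

end CubicPT


theorem cubic_gamma_two_to_one (n : ℕ) (a : ℝ) (ha : 0 ≤ a) :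
    ∃ lam₁ lam₂ : ℝ, lam₁ ≠ lam₂ ∧
      {lam : ℝ | (a, lam) ∈ cubicGamma n} = {lam₁, lam₂} := by
  obtain ⟨Y, Y1, H⟩ := CubicPT.exists_canon (c := Real.sqrt (a / 3)) (Real.sqrt_nonneg _)
  have := H.main n
  rw [Real.sq_sqrt (by positivity), mul_div_cancel₀ a (by norm_num)] at this
  exact this
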